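/- Let Ω ⊆ ℂⁿ be a bounded open set with smooth boundary that is Levi pseudoconvex, and suppose there exist a real-valued function φ, twice continuously differentiable on an open neighborhood of the closure of Ω, and constants A, B > 0 such that |φ(z)| ≤ A for all z ∈ Ω and Hφ(z; ξ) ≥ B|ξ|² for all z ∈ Ω and ξ ∈ ℂⁿ. Then for every u ∈ D(∂̄) that is orthogonal in L²(Ω) to every element of N(∂̄), one has ‖u‖ ≤ e^A·√(2/B)·‖∂̄u‖; in particular, the range R(∂̄) is closed in (L²(Ω))ⁿ. -/

import Mathlib

open MeasureTheory Complex Metric Set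

noncomputable section

/-- The Wirtinger derivative `∂φ/∂z̄_j` of `φ : ℂⁿ → ℂ`:
`(1/2)(Dφ_z(e_j) + i·Dφ_z(i·e_j))`. -/
def dbarCoord (n : ℕ) (φ : (Fin n → ℂ) → ℂ) (j : Fin n) (z : Fin n → ℂ) : ℂ :=
  (1 / 2) * (fderiv ℝ φ z (Pi.single j 1) + Complex.I * fderiv ℝ φ z (Pi.single j Complex.I))

/-- A test function on `Ω`: smooth with compact support contained in `Ω`. -/
def IsTest (n : ℕ) (Ω : Set (Fin n → ℂ)) (φ : (Fin n → ℂ) → ℂ) : Prop :=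
  ContDiff ℝ (⊤ : ℕ∞) φ ∧ HasCompactSupport φ ∧ tsupport φ ⊆ Ω

/-- `∂̄u = α` distributionally on `Ω`. -/
def DbarEq (n : ℕ) (Ω : Set (Fin n → ℂ)) (u : (Fin n → ℂ) → ℂ)
    (α : Fin n → (Fin n → ℂ) → ℂ) : Prop :=
  ∀ j : Fin n, ∀ φ : (Fin n → ℂ) → ℂ, IsTest n Ω φ →
    ∫ z in Ω, α j z * φ z = - ∫ z in Ω, u z * dbarCoord n φ j z

/-- `α` is `∂̄`-closed on `Ω`. -/
def DbarClosed (n : ℕ) (Ω : Set (Fin n → ℂ)) (α : Fin n → (Fin n → ℂ) → ℂ) : Prop :=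
  ∀ j k : Fin n, ∀ φ : (Fin n → ℂ) → ℂ, IsTest n Ω φ →
    ∫ z in Ω, α j z * dbarCoord n φ k z = ∫ z in Ω, α k z * dbarCoord n φ j z

/-- The complex Hessian `Hf(z;ξ) = (1/4)(D²f_z(ξ,ξ) + D²f_z(iξ,iξ))`. -/
def hessC (n : ℕ) (f : (Fin n → ℂ) → ℝ) (z ξ : Fin n → ℂ) : ℝ :=
  (1 / 4) * (iteratedFDeriv ℝ 2 f z ![ξ, ξ]
    + iteratedFDeriv ℝ 2 f z ![Complex.I • ξ, Complex.I • ξ])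

/-- The pairing `⟨∂f(z), ξ⟩ = (1/2)(Df_z(ξ) − i·Df_z(iξ))`. -/
def delPair (n : ℕ) (f : (Fin n → ℂ) → ℝ) (z ξ : Fin n → ℂ) : ℂ :=
  (1 / 2) * ((fderiv ℝ f z ξ : ℂ) - Complex.I * (fderiv ℝ f z (Complex.I • ξ) : ℂ))

/-- Squared Euclidean norm of `ξ ∈ ℂⁿ`. -/
def enormSq (n : ℕ) (ξ : Fin n → ℂ) : ℝ := ∑ j, Complex.normSq (ξ j)

/-- The twisted curvature expression
`Θ_{λ,τ}(z;ξ) = τ(z)·Hλ(z;ξ) − Hτ(z;ξ) − τ(z)⁻¹·|⟨∂τ(z),ξ⟩|²`. -/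
def Theta (n : ℕ) (lam tau : (Fin n → ℂ) → ℝ) (z ξ : Fin n → ℂ) : ℝ :=
  tau z * hessC n lam z ξ - hessC n tau z ξ - (tau z)⁻¹ * Complex.normSq (delPair n tau z ξ)

/-- `Φ` is an exhaustion function of `Ω`: every sublevel set has compact closure inside `Ω`. -/
def ExhaustsOn (n : ℕ) (Ω : Set (Fin n → ℂ)) (Φ : (Fin n → ℂ) → ℝ) : Prop :=
  ∀ c : ℝ, IsCompact (closure {z ∈ Ω | Φ z < c}) ∧ closure {z ∈ Ω | Φ z < c} ⊆ Ω

/-- `Ω` is pseudoconvex: it admits a smooth plurisubharmonic exhaustion function. -/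
def Pseudoconvex (n : ℕ) (Ω : Set (Fin n → ℂ)) : Prop :=
  ∃ Φ : (Fin n → ℂ) → ℝ, ContDiffOn ℝ (⊤ : ℕ∞) Φ Ω ∧ (∀ z ∈ Ω, ∀ ξ, 0 ≤ hessC n Φ z ξ) ∧
    ExhaustsOn n Ω Φ

/-- `r` is a smooth defining function for `Ω` which is Levi pseudoconvex. -/
def IsLeviDefiningFn (n : ℕ) (Ω : Set (Fin n → ℂ)) (r : (Fin n → ℂ) → ℝ) : Prop :=
  ContDiff ℝ (⊤ : ℕ∞) r ∧ Ω = {z | r z < 0} ∧ (∀ z, r z = 0 → fderiv ℝ r z ≠ 0) ∧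
    (∀ p, r p = 0 → ∀ ξ, delPair n r p ξ = 0 → 0 ≤ hessC n r p ξ)

/-- The Wirtinger derivative `∂F/∂z_j`. -/
def dzCoord (n : ℕ) (F : (Fin n → ℂ) → ℂ) (j : Fin n) (z : Fin n → ℂ) : ℂ :=
  (1 / 2) * (fderiv ℝ F z (Pi.single j 1) - Complex.I * fderiv ℝ F z (Pi.single j Complex.I))

section Wirtinger

variable {n : ℕ} {f g : (Fin n → ℂ) → ℂ} {z : Fin n → ℂ}

lemma dbarCoord_mul (hf : DifferentiableAt ℝ f z) (hg : DifferentiableAt ℝ g z) (j : Fin n) :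
    dbarCoord n (fun x => f x * g x) j z = f z * dbarCoord n g j z + dbarCoord n f j z * g z := by
  simp only [dbarCoord, fderiv_fun_mul hf hg]
  simp
  ring

lemma dzCoord_mul (hf : DifferentiableAt ℝ f z) (hg : DifferentiableAt ℝ g z) (j : Fin n) :
    dzCoord n (fun x => f x * g x) j z = f z * dzCoord n g j z + dzCoord n f j z * g z := by
  simp only [dzCoord, fderiv_fun_mul hf hg]
  simp
  ring

lemma dbarCoord_sub (hf : DifferentiableAt ℝ f z) (hg : DifferentiableAt ℝ g z) (j : Fin n) :
    dbarCoord n (fun x => f x - g x) j z = dbarCoord n f j z - dbarCoord n g j z := by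
  simp only [dbarCoord, fderiv_fun_sub hf hg]
  simp
  ring

lemma fderiv_conj_apply (v : Fin n → ℂ) :
    fderiv ℝ (fun x => (starRingEnd ℂ) (f x)) z v = (starRingEnd ℂ) (fderiv ℝ f z v) := by
  have := Complex.conjCLE.comp_fderiv (f := f) (x := z)
  have h2 : (fun x => (starRingEnd ℂ) (f x)) = Complex.conjCLE ∘ f := by ext; simp
  rw [h2, this]; simp

lemma dbarCoord_conj (j : Fin n) :
    dbarCoord n (fun x => (starRingEnd ℂ) (f x)) j z = (starRingEnd ℂ) (dzCoord n f j z) := by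
  simp only [dbarCoord, dzCoord, fderiv_conj_apply]
  simp [sub_eq_add_neg, Complex.conj_ofNat]

lemma dzCoord_conj (j : Fin n) :
    dzCoord n (fun x => (starRingEnd ℂ) (f x)) j z = (starRingEnd ℂ) (dbarCoord n f j z) := by
  simp only [dbarCoord, dzCoord, fderiv_conj_apply]
  simp [sub_eq_add_neg, Complex.conj_ofNat]

lemma ContDiff.dbarCoord {m k : WithTop ℕ∞} (hf : ContDiff ℝ m f) (h : k + 1 ≤ m) (j : Fin n) :
    ContDiff ℝ k (dbarCoord n f j) := by
  have h1 := hf.fderiv_right h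
  unfold _root_.dbarCoord
  fun_prop

lemma ContDiff.dzCoord {m k : WithTop ℕ∞} (hf : ContDiff ℝ m f) (h : k + 1 ≤ m) (j : Fin n) :
    ContDiff ℝ k (dzCoord n f j) := by
  have h1 := hf.fderiv_right h
  unfold _root_.dzCoord
  fun_prop

lemma tsupport_dbarCoord_subset (j : Fin n) : tsupport (dbarCoord n f j) ⊆ tsupport f := by
  refine closure_minimal (fun x hx => ?_) (isClosed_tsupport f)
  by_contra h
  refine hx ?_
  have : fderiv ℝ f x = 0 := by
    by_contra h2
    exact h (support_fderiv_subset ℝ h2)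
  simp [dbarCoord, this]

lemma tsupport_dzCoord_subset (j : Fin n) : tsupport (dzCoord n f j) ⊆ tsupport f := by
  refine closure_minimal (fun x hx => ?_) (isClosed_tsupport f)
  by_contra h
  refine hx ?_
  have : fderiv ℝ f x = 0 := by
    by_contra h2
    exact h (support_fderiv_subset ℝ h2)
  simp [dzCoord, this]

lemma HasCompactSupport.dbarCoord (hf : HasCompactSupport f) (j : Fin n) :
    HasCompactSupport (dbarCoord n f j) :=
  IsCompact.of_isClosed_subset hf (isClosed_tsupport _) (tsupport_dbarCoord_subset j)

lemma HasCompactSupport.dzCoord (hf : HasCompactSupport f) (j : Fin n) :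
    HasCompactSupport (dzCoord n f j) :=
  IsCompact.of_isClosed_subset hf (isClosed_tsupport _) (tsupport_dzCoord_subset j)

lemma integral_fderiv_eq_zero (hf : ContDiff ℝ 1 f) (hc : HasCompactSupport f) (v : Fin n → ℂ) :
    ∫ x, fderiv ℝ f x v = 0 := by
  have hd : Continuous (fun x => fderiv ℝ f x v) := by
    have := hf.continuous_fderiv (by norm_num)
    fun_prop
  have hdc : HasCompactSupport (fun x => fderiv ℝ f x v) :=
    (hc.fderiv (𝕜 := ℝ)).comp_left (g := fun L : (Fin n → ℂ) →L[ℝ] ℂ => L v) (by simp)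
  have := integral_smul_fderiv_eq_neg_fderiv_smul_of_integrable (μ := volume) (𝕜 := ℝ)
    (f := fun _ => (1 : ℝ)) (g := f) (v := v) (by simp)
    (by simpa using hd.integrable_of_hasCompactSupport hdc)
    (by simpa using hf.continuous.integrable_of_hasCompactSupport hc)
    (by fun_prop) (fun x _ => hf.differentiable (by norm_num) x)
  simpa using this

lemma continuous_fderiv_apply_const (hf : ContDiff ℝ 1 f) (v : Fin n → ℂ) :
    Continuous (fun x => fderiv ℝ f x v) := by
  have := hf.continuous_fderiv (by norm_num)
  fun_prop

lemma integrable_fderiv_apply (hf : ContDiff ℝ 1 f) (hc : HasCompactSupport f) (v : Fin n → ℂ) :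
    Integrable (fun x => fderiv ℝ f x v) :=
  (continuous_fderiv_apply_const hf v).integrable_of_hasCompactSupport
    ((hc.fderiv (𝕜 := ℝ)).comp_left (g := fun L : (Fin n → ℂ) →L[ℝ] ℂ => L v) (by simp))

lemma integral_dbarCoord_eq_zero (hf : ContDiff ℝ 1 f) (hc : HasCompactSupport f) (j : Fin n) :
    ∫ x, dbarCoord n f j x = 0 := by
  unfold dbarCoord
  rw [integral_const_mul, integral_add (integrable_fderiv_apply hf hc _)
    ((integrable_fderiv_apply hf hc _).const_mul _), integral_const_mul,
    integral_fderiv_eq_zero hf hc, integral_fderiv_eq_zero hf hc]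
  simp

lemma integral_dzCoord_eq_zero (hf : ContDiff ℝ 1 f) (hc : HasCompactSupport f) (j : Fin n) :
    ∫ x, dzCoord n f j x = 0 := by
  unfold dzCoord
  rw [integral_const_mul, integral_sub (integrable_fderiv_apply hf hc _)
    ((integrable_fderiv_apply hf hc _).const_mul _), integral_const_mul,
    integral_fderiv_eq_zero hf hc, integral_fderiv_eq_zero hf hc]
  simp

lemma fderiv_fderiv_apply_const (hf : ContDiff ℝ 2 f) (v w : Fin n → ℂ) :
    fderiv ℝ (fun x => fderiv ℝ f x v) z w = fderiv ℝ (fderiv ℝ f) z w v := by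
  have h1 : DifferentiableAt ℝ (fderiv ℝ f) z :=
    (hf.fderiv_right (m := 1) (by norm_num)).differentiable (by norm_num) z
  rw [fderiv_clm_apply h1 (by fun_prop)]
  simp

lemma dbarCoord_dzCoord_comm (hf : ContDiff ℝ 2 f) (j k : Fin n) :
    dbarCoord n (dzCoord n f j) k z = dzCoord n (dbarCoord n f k) j z := by
  have h1 : Differentiable ℝ (fderiv ℝ f) :=
    (hf.fderiv_right (m := 1) (by norm_num)).differentiable (by norm_num)
  have h2 : ∀ v w, fderiv ℝ (fderiv ℝ f) z v w = fderiv ℝ (fderiv ℝ f) z w v := by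
    intro v w
    have := (hf.contDiffAt (x := z)).isSymmSndFDerivAt (by simp)
    exact this v w
  have e : ∀ (c : ℂ) (v w u : Fin n → ℂ), fderiv ℝ (fun x => (1 / 2 : ℂ) * (fderiv ℝ f x v + c * fderiv ℝ f x w)) z u
      = (1 / 2) * (fderiv ℝ (fderiv ℝ f) z u v + c * fderiv ℝ (fderiv ℝ f) z u w) := by
    intro c v w u
    have hv : DifferentiableAt ℝ (fun x => fderiv ℝ f x v) z := by fun_prop
    have hw : DifferentiableAt ℝ (fun x => fderiv ℝ f x w) z := by fun_prop
    rw [fderiv_const_mul (by fun_prop), fderiv_fun_add hv (by fun_prop), fderiv_const_mul hw]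
    simp only [fderiv_fderiv_apply_const hf, add_apply,
      smul_apply, smul_eq_mul]
  have e1 : dzCoord n f j = fun x => (1 / 2 : ℂ) * (fderiv ℝ f x (Pi.single j 1) + (-I) * fderiv ℝ f x (Pi.single j I)) := by
    ext x; simp only [dzCoord]; ring
  have e2 : dbarCoord n f k = fun x => (1 / 2 : ℂ) * (fderiv ℝ f x (Pi.single k 1) + I * fderiv ℝ f x (Pi.single k I)) := by
    ext x; simp only [dbarCoord]
  rw [e1, e2]
  simp only [dbarCoord, dzCoord, e]
  rw [h2 (Pi.single k 1) (Pi.single j 1), h2 (Pi.single k 1) (Pi.single j I),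
    h2 (Pi.single k I) (Pi.single j 1), h2 (Pi.single k I) (Pi.single j I)]
  ring

end Wirtinger

section Hessian

variable {n : ℕ}

lemma eq_sum_re_im_single (ξ : Fin n → ℂ) :
    ξ = ∑ j, ((ξ j).re • (Pi.single j 1 : Fin n → ℂ) + (ξ j).im • (Pi.single j I : Fin n → ℂ)) := by
  ext k
  simp only [Finset.sum_apply, Pi.add_apply, Pi.smul_apply, Pi.single_apply]
  simp [Finset.sum_add_distrib, Complex.re_add_im]

lemma clm_apply_eq_sum {F : Type*} [NormedAddCommGroup F] [NormedSpace ℝ F]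
    (L : (Fin n → ℂ) →L[ℝ] F) (ξ : Fin n → ℂ) :
    L ξ = ∑ j, ((ξ j).re • L (Pi.single j 1) + (ξ j).im • L (Pi.single j I)) := by
  conv_lhs => rw [eq_sum_re_im_single ξ]
  simp

lemma fderiv_ofReal_comp (Φ : (Fin n → ℂ) → ℝ) (z v : Fin n → ℂ) :
    fderiv ℝ (fun x => (Φ x : ℂ)) z v = (fderiv ℝ Φ z v : ℂ) := by
  by_cases h : DifferentiableAt ℝ Φ z
  · have := (Complex.ofRealCLM.hasFDerivAt.comp z h.hasFDerivAt).fderiv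
    have e : (fun x => (Φ x : ℂ)) = ⇑Complex.ofRealCLM ∘ Φ := by ext; simp
    rw [e, this]; simp
  · have h' : ¬ DifferentiableAt ℝ (fun x => (Φ x : ℂ)) z := by
      intro h2
      apply h
      have := Complex.reCLM.differentiableAt.comp z h2
      simpa [Function.comp_def] using this
    simp [fderiv_zero_of_not_differentiableAt h, fderiv_zero_of_not_differentiableAt h']

lemma delPair_eq_sum (f : (Fin n → ℂ) → ℝ) (z ξ : Fin n → ℂ) :
    delPair n f z ξ = ∑ j, ξ j * dzCoord n (fun x => (f x : ℂ)) j z := by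
  have h1 := clm_apply_eq_sum (fderiv ℝ f z) ξ
  have h2 := clm_apply_eq_sum (fderiv ℝ f z) (I • ξ)
  simp only [delPair, dzCoord, fderiv_ofReal_comp, h1, h2]
  push_cast
  rw [Finset.mul_sum, ← Finset.sum_sub_distrib, Finset.mul_sum]
  refine Finset.sum_congr rfl fun j _ => ?_
  have := Complex.re_add_im (ξ j)
  simp only [Pi.smul_apply, smul_eq_mul, Complex.I_mul_re, Complex.I_mul_im]
  push_cast
  linear_combination (1 / 2) * ((fderiv ℝ f z (Pi.single j 1) : ℂ)
    - I * (fderiv ℝ f z (Pi.single j I) : ℂ)) * this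
    + (1 / 2) * ((ξ j).im : ℂ) * (fderiv ℝ f z (Pi.single j I) : ℂ) * Complex.I_sq

lemma iteratedFDeriv_two_pair (f : (Fin n → ℂ) → ℝ) (z ξ η : Fin n → ℂ) :
    iteratedFDeriv ℝ 2 f z ![ξ, η] = fderiv ℝ (fderiv ℝ f) z ξ η := by
  rw [iteratedFDeriv_two_apply]; simp

lemma hessC_eq_sum {f : (Fin n → ℂ) → ℝ} (hf : ContDiff ℝ 2 f) (z ξ : Fin n → ℂ) :
    hessC n f z ξ = (∑ j, ∑ k, ξ j * (starRingEnd ℂ) (ξ k) *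
      dbarCoord n (dzCoord n (fun x => (f x : ℂ)) j) k z).re := by
  have hfc : ContDiff ℝ 2 (fun x => (f x : ℂ)) := Complex.ofRealCLM.contDiff.comp hf
  have h1 : Differentiable ℝ (fderiv ℝ f) :=
    (hf.fderiv_right (m := 1) (by norm_num)).differentiable (by norm_num)
  set b := fderiv ℝ (fderiv ℝ f) z with hb
  have hs : ∀ v w, b v w = b w v := by
    intro v w
    exact (hf.contDiffAt (x := z)).isSymmSndFDerivAt (by simp) v w
  have key : ∀ j k, dbarCoord n (dzCoord n (fun x => (f x : ℂ)) j) k z =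
      (1 / 4) * ((b (Pi.single k 1) (Pi.single j 1) - I * b (Pi.single k 1) (Pi.single j I))
        + I * (b (Pi.single k I) (Pi.single j 1) - I * b (Pi.single k I) (Pi.single j I))) := by
    intro j k
    have e1 : dzCoord n (fun x => (f x : ℂ)) j = fun x => (1 / 2 : ℂ) *
        ((fderiv ℝ f x (Pi.single j 1) : ℂ) - I * (fderiv ℝ f x (Pi.single j I) : ℂ)) := by
      ext x; simp only [dzCoord, fderiv_ofReal_comp]
    have hv : ∀ v, DifferentiableAt ℝ (fun x => (fderiv ℝ f x v : ℂ)) z := by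
      intro v
      have : DifferentiableAt ℝ (fun x => fderiv ℝ f x v) z := by fun_prop
      exact Complex.ofRealCLM.differentiableAt.comp z this
    have e2 : ∀ u, fderiv ℝ (dzCoord n (fun x => (f x : ℂ)) j) z u =
        (1 / 2 : ℂ) * ((b u (Pi.single j 1) : ℂ) - I * (b u (Pi.single j I) : ℂ)) := by
      intro u
      rw [e1, fderiv_const_mul ((hv _).fun_sub ((hv _).const_mul _)),
        fderiv_fun_sub (hv _) ((hv _).const_mul _), fderiv_const_mul (hv _)]
      have e3 : ∀ v, fderiv ℝ (fun x => fderiv ℝ f x v) z u = b u v := by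
        intro v
        rw [fderiv_clm_apply (h1 z) (by fun_prop)]; simp [hb]
      simp only [smul_apply, sub_apply, smul_eq_mul, fderiv_ofReal_comp, e3]
    rw [dbarCoord, e2, e2]; ring
  have hL : ∀ v, b v v = ∑ j, ∑ k, ((v j).re * ((v k).re * b (Pi.single k 1) (Pi.single j 1)
      + (v k).im * b (Pi.single k I) (Pi.single j 1))
      + (v j).im * ((v k).re * b (Pi.single k 1) (Pi.single j I)
      + (v k).im * b (Pi.single k I) (Pi.single j I))) := by
    intro v
    conv_lhs => rw [clm_apply_eq_sum (b v) v]
    refine Finset.sum_congr rfl fun j _ => ?_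
    have e : b v = ∑ k, ((v k).re • b (Pi.single k 1) + (v k).im • b (Pi.single k I)) :=
      clm_apply_eq_sum b v
    rw [e]
    simp only [sum_apply, add_apply, smul_apply, smul_eq_mul, Finset.mul_sum]
    rw [← Finset.sum_add_distrib]
  rw [hessC, iteratedFDeriv_two_pair, iteratedFDeriv_two_pair, ← hb, hL, hL,
    ← Finset.sum_add_distrib, Finset.mul_sum, Complex.re_sum]
  refine Finset.sum_congr rfl fun j _ => ?_
  rw [← Finset.sum_add_distrib, Finset.mul_sum, Complex.re_sum]
  refine Finset.sum_congr rfl fun k _ => ?_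
  rw [key]
  simp only [Pi.smul_apply, smul_eq_mul, Complex.mul_re, Complex.mul_im, Complex.add_re, Complex.add_im, Complex.sub_re, Complex.sub_im,
    Complex.ofReal_re, Complex.ofReal_im, Complex.conj_re, Complex.conj_im, Complex.I_re,
    Complex.I_im]
  norm_num
  ring

end Hessian

section BasicEstimate

variable {n : ℕ}

/-- The current whose distributional divergence produces the Bochner–Kodaira identity. -/
def bochnerDiv (n : ℕ) (Φ : (Fin n → ℂ) → ℝ) (g : Fin n → (Fin n → ℂ) → ℂ) (j k : Fin n)
    (z : Fin n → ℂ) : ℂ :=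
  dbarCoord n (fun x => (dzCoord n (g j) j x - g j x * dzCoord n (fun y => (Φ y : ℂ)) j x) *
      ((starRingEnd ℂ) (g k x) * (Real.exp (-Φ x) : ℂ))) k z -
    dzCoord n (fun x => dbarCoord n (g j) k x *
      ((starRingEnd ℂ) (g k x) * (Real.exp (-Φ x) : ℂ))) j z

lemma contDiff_ofReal_exp_neg {m : WithTop ℕ∞} {Φ : (Fin n → ℂ) → ℝ} (hΦ : ContDiff ℝ m Φ) :
    ContDiff ℝ m (fun x => (Real.exp (-Φ x) : ℂ)) :=
  Complex.ofRealCLM.contDiff.comp (hΦ.neg.exp)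

lemma fderiv_ofReal_exp_neg {Φ : (Fin n → ℂ) → ℝ} {z : Fin n → ℂ} (hΦ : DifferentiableAt ℝ Φ z)
    (v : Fin n → ℂ) :
    fderiv ℝ (fun x => (Real.exp (-Φ x) : ℂ)) z v =
      -(Real.exp (-Φ z) : ℂ) * (fderiv ℝ Φ z v : ℂ) := by
  rw [fderiv_ofReal_comp (fun x => Real.exp (-Φ x)), fderiv_exp (f := fun x => -Φ x) hΦ.fun_neg,
    fderiv_fun_neg]
  simp

lemma dbarCoord_ofReal_exp_neg {Φ : (Fin n → ℂ) → ℝ} {z : Fin n → ℂ}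
    (hΦ : DifferentiableAt ℝ Φ z) (j : Fin n) :
    dbarCoord n (fun x => (Real.exp (-Φ x) : ℂ)) j z =
      -(Real.exp (-Φ z) : ℂ) * dbarCoord n (fun x => (Φ x : ℂ)) j z := by
  simp only [dbarCoord, fderiv_ofReal_exp_neg hΦ, fderiv_ofReal_comp]; ring

lemma dzCoord_ofReal_exp_neg {Φ : (Fin n → ℂ) → ℝ} {z : Fin n → ℂ}
    (hΦ : DifferentiableAt ℝ Φ z) (j : Fin n) :
    dzCoord n (fun x => (Real.exp (-Φ x) : ℂ)) j z =
      -(Real.exp (-Φ z) : ℂ) * dzCoord n (fun x => (Φ x : ℂ)) j z := by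
  simp only [dzCoord, fderiv_ofReal_exp_neg hΦ, fderiv_ofReal_comp]; ring

lemma dbarCoord_ofReal (Φ : (Fin n → ℂ) → ℝ) (z : Fin n → ℂ) (j : Fin n) :
    dbarCoord n (fun x => (Φ x : ℂ)) j z =
      (starRingEnd ℂ) (dzCoord n (fun x => (Φ x : ℂ)) j z) := by
  rw [← dbarCoord_conj]; simp

lemma bochnerDiv_eq {Φ : (Fin n → ℂ) → ℝ} (hΦ : ContDiff ℝ 2 Φ) {g : Fin n → (Fin n → ℂ) → ℂ}
    (hg : ∀ j, ContDiff ℝ 2 (g j)) (j k : Fin n) (z : Fin n → ℂ) :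
    bochnerDiv n Φ g j k z =
      ((dzCoord n (g j) j z - g j z * dzCoord n (fun y => (Φ y : ℂ)) j z) *
        (starRingEnd ℂ) (dzCoord n (g k) k z - g k z * dzCoord n (fun y => (Φ y : ℂ)) k z) -
      dbarCoord n (g j) k z * (starRingEnd ℂ) (dbarCoord n (g k) j z) -
      g j z * (starRingEnd ℂ) (g k z) *
        dbarCoord n (dzCoord n (fun y => (Φ y : ℂ)) j) k z) * (Real.exp (-Φ z) : ℂ) := by
  have hΦc : ContDiff ℝ 2 (fun x => (Φ x : ℂ)) := Complex.ofRealCLM.contDiff.comp hΦ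
  have dd : ∀ {F : (Fin n → ℂ) → ℂ}, ContDiff ℝ 1 F → DifferentiableAt ℝ F z :=
    fun h => h.differentiable (by norm_num) z
  have le2 : (1 : WithTop ℕ∞) ≤ 2 := by norm_num
  have lt2 : (1 : WithTop ℕ∞) + 1 ≤ 2 := by norm_num
  have dΦ : DifferentiableAt ℝ Φ z := hΦ.differentiable (by norm_num) z
  have dgj := dd ((hg j).of_le le2)
  have dgk : DifferentiableAt ℝ (fun x => (starRingEnd ℂ) (g k x)) z :=
    dd (Complex.conjCLE.contDiff.comp ((hg k).of_le le2))
  have dW := dd ((contDiff_ofReal_exp_neg hΦ).of_le le2)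
  have d1 := dd ((hg j).dzCoord lt2 j)
  have d2 := dd (hΦc.dzCoord lt2 j)
  have d3 := dd ((hg j).dbarCoord lt2 k)
  rw [bochnerDiv, dbarCoord_mul (d1.fun_sub (dgj.fun_mul d2)) (dgk.fun_mul dW),
    dbarCoord_sub d1 (dgj.fun_mul d2), dbarCoord_mul dgj d2, dbarCoord_mul dgk dW,
    dzCoord_mul d3 (dgk.fun_mul dW), dzCoord_mul dgk dW, dbarCoord_conj, dzCoord_conj,
    dbarCoord_ofReal_exp_neg dΦ, dzCoord_ofReal_exp_neg dΦ, dbarCoord_dzCoord_comm (hg j),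
    dbarCoord_ofReal, map_sub, map_mul]
  ring

lemma integral_bochnerDiv {Φ : (Fin n → ℂ) → ℝ} (hΦ : ContDiff ℝ 2 Φ)
    {g : Fin n → (Fin n → ℂ) → ℂ} (hg : ∀ j, ContDiff ℝ 2 (g j))
    (hc : ∀ j, HasCompactSupport (g j)) (j k : Fin n) :
    Integrable (bochnerDiv n Φ g j k) ∧ ∫ z, bochnerDiv n Φ g j k z = 0 := by
  have hΦc : ContDiff ℝ 2 (fun x => (Φ x : ℂ)) := Complex.ofRealCLM.contDiff.comp hΦ
  have le2 : (1 : WithTop ℕ∞) ≤ 2 := by norm_num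
  have lt2 : (1 : WithTop ℕ∞) + 1 ≤ 2 := by norm_num
  have cg : ContDiff ℝ 1 (fun x => (starRingEnd ℂ) (g k x)) :=
    Complex.conjCLE.contDiff.comp ((hg k).of_le le2)
  have cW := (contDiff_ofReal_exp_neg hΦ).of_le le2
  have c1 := (hg j).dzCoord lt2 j
  have c2 := hΦc.dzCoord lt2 j
  have c3 := (hg j).dbarCoord lt2 k
  have c4 := (hg j).of_le le2
  have sk : HasCompactSupport (fun x => (starRingEnd ℂ) (g k x)) :=
    (hc k).comp_left (g := starRingEnd ℂ) (by simp)
  have C1 : ContDiff ℝ 1 (fun x => (dzCoord n (g j) j x -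
      g j x * dzCoord n (fun y => (Φ y : ℂ)) j x) *
      ((starRingEnd ℂ) (g k x) * (Real.exp (-Φ x) : ℂ))) :=
    (c1.sub (c4.mul c2)).mul (cg.mul cW)
  have S1 : HasCompactSupport (fun x => (dzCoord n (g j) j x -
      g j x * dzCoord n (fun y => (Φ y : ℂ)) j x) *
      ((starRingEnd ℂ) (g k x) * (Real.exp (-Φ x) : ℂ))) := (sk.mul_right).mul_left
  have C2 : ContDiff ℝ 1 (fun x => dbarCoord n (g j) k x *
      ((starRingEnd ℂ) (g k x) * (Real.exp (-Φ x) : ℂ))) := c3.mul (cg.mul cW)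
  have S2 : HasCompactSupport (fun x => dbarCoord n (g j) k x *
      ((starRingEnd ℂ) (g k x) * (Real.exp (-Φ x) : ℂ))) := (sk.mul_right).mul_left
  have I1 := (C1.dbarCoord (k := 0) (by norm_num) k).continuous.integrable_of_hasCompactSupport
    (S1.dbarCoord k) (μ := volume)
  have I2 := (C2.dzCoord (k := 0) (by norm_num) j).continuous.integrable_of_hasCompactSupport
    (S2.dzCoord j) (μ := volume)
  refine ⟨I1.sub I2, ?_⟩
  unfold bochnerDiv
  rw [integral_sub I1 I2, integral_dbarCoord_eq_zero C1 S1, integral_dzCoord_eq_zero C2 S2, sub_zero]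

lemma re_sum_bochnerDiv {Φ : (Fin n → ℂ) → ℝ} (hΦ : ContDiff ℝ 2 Φ)
    {g : Fin n → (Fin n → ℂ) → ℂ} (hg : ∀ j, ContDiff ℝ 2 (g j)) (z : Fin n → ℂ) :
    hessC n Φ z (fun j => g j z) * Real.exp (-Φ z) ≤
      (normSq (∑ j, (dzCoord n (g j) j z - g j z * dzCoord n (fun y => (Φ y : ℂ)) j z)) +
        (1 / 2) * ∑ j, ∑ k, normSq (dbarCoord n (g j) k z - dbarCoord n (g k) j z))
        * Real.exp (-Φ z) - (∑ j, ∑ k, bochnerDiv n Φ g j k z).re := by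
  set δ : Fin n → ℂ := fun j => dzCoord n (g j) j z - g j z * dzCoord n (fun y => (Φ y : ℂ)) j z
    with hδ
  have h1 : (normSq (∑ j, δ j) : ℂ) = ∑ j, ∑ k, δ j * (starRingEnd ℂ) (δ k) := by
    rw [← Complex.mul_conj, map_sum, Finset.sum_mul_sum]
  have h2 : (∑ j, ∑ k, bochnerDiv n Φ g j k z) = ((normSq (∑ j, δ j) : ℂ) -
      ∑ j, ∑ k, dbarCoord n (g j) k z * (starRingEnd ℂ) (dbarCoord n (g k) j z) -
      ∑ j, ∑ k, g j z * (starRingEnd ℂ) (g k z) *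
        dbarCoord n (dzCoord n (fun y => (Φ y : ℂ)) j) k z) * (Real.exp (-Φ z) : ℂ) := by
    rw [h1]
    simp only [← Finset.sum_sub_distrib, Finset.sum_mul]
    exact Finset.sum_congr rfl fun j _ => Finset.sum_congr rfl fun k _ => by
      rw [bochnerDiv_eq hΦ hg]
  have h3 : -(∑ j, ∑ k, dbarCoord n (g j) k z * (starRingEnd ℂ) (dbarCoord n (g k) j z)).re ≤
      (1 / 2) * ∑ j, ∑ k, normSq (dbarCoord n (g j) k z - dbarCoord n (g k) j z) := by
    simp only [Complex.re_sum, Finset.mul_sum, ← Finset.sum_neg_distrib]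
    refine Finset.sum_le_sum fun j _ => Finset.sum_le_sum fun k _ => ?_
    rw [Complex.normSq_sub]
    have := Complex.normSq_nonneg (dbarCoord n (g j) k z)
    have := Complex.normSq_nonneg (dbarCoord n (g k) j z)
    linarith
  rw [h2, Complex.re_mul_ofReal, Complex.sub_re, Complex.sub_re, Complex.ofReal_re, hessC_eq_sum hΦ]
  have h4 := mul_le_mul_of_nonneg_right h3 (Real.exp_nonneg (-Φ z))
  nlinarith

/-- The weighted a priori estimate for smooth compactly supported `(0,1)`-forms. -/
lemma basic_estimate {Φ : (Fin n → ℂ) → ℝ} (hΦ : ContDiff ℝ 2 Φ)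
    {g : Fin n → (Fin n → ℂ) → ℂ} (hg : ∀ j, ContDiff ℝ 2 (g j))
    (hc : ∀ j, HasCompactSupport (g j))
    {σ : (Fin n → ℂ) → ℝ} (hσ : Continuous σ) {b : Fin n → (Fin n → ℂ) → ℂ}
    (hb : ∀ j, Continuous (b j)) (B : ℝ) (K : Set (Fin n → ℂ))
    (hK : ∀ j, ∀ z ∉ K, g j z = 0)
    (hH : ∀ z ∈ K, ∀ ξ : Fin n → ℂ,
      B * σ z * enormSq n ξ + 2 * normSq (∑ j, ξ j * b j z) ≤ hessC n Φ z ξ) :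
    B * ∫ z, σ z * enormSq n (fun j => g j z) * Real.exp (-Φ z) ≤
      2 * (∫ z, normSq (∑ j, (dzCoord n (g j) j z -
        g j z * (dzCoord n (fun y => (Φ y : ℂ)) j z - b j z))) * Real.exp (-Φ z)) +
      (1 / 2) * ∑ j, ∑ k, ∫ z, normSq (dbarCoord n (g j) k z - dbarCoord n (g k) j z) *
        Real.exp (-Φ z) := by
  have hΦc : ContDiff ℝ 2 (fun x => (Φ x : ℂ)) := Complex.ofRealCLM.contDiff.comp hΦ
  have lt2 : (0 : WithTop ℕ∞) + 1 ≤ 2 := by norm_num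
  have cΦ : Continuous Φ := hΦ.continuous
  have cg : ∀ j, Continuous (g j) := fun j => (hg j).continuous
  have cΦz : ∀ j, Continuous (dzCoord n (fun x => (Φ x : ℂ)) j) :=
    fun j => (hΦc.dzCoord lt2 j).continuous
  have cgz : ∀ j k, Continuous (dzCoord n (g j) k) := fun j k => ((hg j).dzCoord lt2 k).continuous
  have cgb : ∀ j k, Continuous (dbarCoord n (g j) k) :=
    fun j k => ((hg j).dbarCoord lt2 k).continuous
  have hKc : IsCompact (⋃ j, tsupport (g j)) := isCompact_iUnion fun j => hc j
  have van : ∀ z ∉ (⋃ j, tsupport (g j)), ∀ j, g j z = 0 ∧ ∀ k, dzCoord n (g j) k z = 0 ∧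
      dbarCoord n (g j) k z = 0 := by
    intro z hz j
    have hz' : z ∉ tsupport (g j) := fun h => hz (mem_iUnion.2 ⟨j, h⟩)
    exact ⟨image_eq_zero_of_notMem_tsupport hz', fun k =>
      ⟨image_eq_zero_of_notMem_tsupport fun h => hz' (tsupport_dzCoord_subset k h),
       image_eq_zero_of_notMem_tsupport fun h => hz' (tsupport_dbarCoord_subset k h)⟩⟩
  have cn : Continuous (fun w : ℂ => normSq w) := Complex.continuous_normSq
  have i1 : Integrable (fun z => σ z * enormSq n (fun j => g j z) * Real.exp (-Φ z)) := by
    refine Continuous.integrable_of_hasCompactSupport ?_ (HasCompactSupport.intro hKc ?_)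
    · unfold enormSq; fun_prop
    · intro z hz; simp [enormSq, van z hz]
  have i2 : Integrable (fun z => normSq (∑ j, (dzCoord n (g j) j z -
        g j z * (dzCoord n (fun y => (Φ y : ℂ)) j z - b j z))) * Real.exp (-Φ z)) := by
    refine Continuous.integrable_of_hasCompactSupport ?_ (HasCompactSupport.intro hKc ?_)
    · fun_prop
    · intro z hz; simp [van z hz]
  have i3 : ∀ j k, Integrable (fun z => normSq (dbarCoord n (g j) k z - dbarCoord n (g k) j z) *
        Real.exp (-Φ z)) := by
    intro j k
    refine Continuous.integrable_of_hasCompactSupport ?_ (HasCompactSupport.intro hKc ?_)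
    · fun_prop
    · intro z hz; simp [van z hz]
  have i3' : Integrable (fun z => ∑ j, ∑ k,
      normSq (dbarCoord n (g j) k z - dbarCoord n (g k) j z) * Real.exp (-Φ z)) :=
    integrable_finsetSum _ fun j _ => integrable_finsetSum _ fun k _ => i3 j k
  have i4c : Integrable (fun z => ∑ j, ∑ k, bochnerDiv n Φ g j k z) :=
    integrable_finsetSum _ fun j _ => integrable_finsetSum _ fun k _ =>
      (integral_bochnerDiv hΦ hg hc j k).1
  have i4 : Integrable (fun z => (∑ j, ∑ k, bochnerDiv n Φ g j k z).re) := i4c.re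
  have z4 : ∫ z, (∑ j, ∑ k, bochnerDiv n Φ g j k z).re = 0 := by
    have h := integral_re i4c
    have h0 : ∫ z, ∑ j, ∑ k, bochnerDiv n Φ g j k z = 0 := by
      rw [integral_finsetSum _ fun j _ => integrable_finsetSum _ fun k _ =>
        (integral_bochnerDiv hΦ hg hc j k).1]
      refine Finset.sum_eq_zero fun j _ => ?_
      rw [integral_finsetSum _ fun k _ => (integral_bochnerDiv hΦ hg hc j k).1]
      exact Finset.sum_eq_zero fun k _ => (integral_bochnerDiv hΦ hg hc j k).2
    rw [h0] at h
    simpa using h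
  have pt : ∀ z, B * (σ z * enormSq n (fun j => g j z) * Real.exp (-Φ z)) ≤
      2 * (normSq (∑ j, (dzCoord n (g j) j z -
        g j z * (dzCoord n (fun y => (Φ y : ℂ)) j z - b j z))) * Real.exp (-Φ z)) +
      (1 / 2) * (∑ j, ∑ k, normSq (dbarCoord n (g j) k z - dbarCoord n (g k) j z) *
        Real.exp (-Φ z)) - (∑ j, ∑ k, bochnerDiv n Φ g j k z).re := by
    intro z
    have h1 := re_sum_bochnerDiv hΦ hg z
    have h2 : B * σ z * enormSq n (fun j => g j z) + 2 * normSq (∑ j, g j z * b j z)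
        ≤ hessC n Φ z (fun j => g j z) := by
      by_cases hz : z ∈ K
      · exact hH z hz _
      · have : (fun j => g j z) = fun _ => (0 : ℂ) := by ext j; exact hK j z hz
        have e : ∀ j, g j z = 0 := fun j => hK j z hz
        rw [this, hessC_eq_sum hΦ]
        simp [enormSq, e]
    have h3 : normSq (∑ j, (dzCoord n (g j) j z - g j z * dzCoord n (fun y => (Φ y : ℂ)) j z)) ≤
        2 * normSq (∑ j, (dzCoord n (g j) j z -
          g j z * (dzCoord n (fun y => (Φ y : ℂ)) j z - b j z))) +
        2 * normSq (∑ j, g j z * b j z) := by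
      have e : ∑ j, (dzCoord n (g j) j z - g j z * dzCoord n (fun y => (Φ y : ℂ)) j z) =
          ∑ j, (dzCoord n (g j) j z - g j z * (dzCoord n (fun y => (Φ y : ℂ)) j z - b j z)) -
          ∑ j, g j z * b j z := by
        rw [← Finset.sum_sub_distrib]; exact Finset.sum_congr rfl fun j _ => by ring
      rw [e]
      generalize ∑ j, (dzCoord n (g j) j z - g j z * (dzCoord n (fun y => (Φ y : ℂ)) j z - b j z)) = p
      generalize ∑ j, g j z * b j z = q
      simp only [Complex.normSq_apply, Complex.sub_re, Complex.sub_im]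
      nlinarith [sq_nonneg (p.re + q.re), sq_nonneg (p.im + q.im)]
    simp only [← Finset.sum_mul]
    have hW := Real.exp_nonneg (-Φ z)
    have h2' := mul_le_mul_of_nonneg_right h2 hW
    have h3' := mul_le_mul_of_nonneg_right h3 hW
    linarith
  have := integral_mono (i1.const_mul B)
    (((i2.const_mul 2).add (i3'.const_mul (1 / 2))).sub i4) pt
  rw [integral_const_mul, integral_sub', integral_add', integral_const_mul, integral_const_mul, z4,
    sub_zero, integral_finsetSum] at this
  · simpa only [integral_finsetSum _ fun k _ => i3 _ k] using this
  · exact fun j _ => integrable_finsetSum _ fun k _ => i3 j k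
  · exact i2.const_mul 2
  · exact i3'.const_mul _
  · exact (i2.const_mul 2).add (i3'.const_mul _)
  · exact i4

end BasicEstimate

section Mollify

open Filter Topology
open scoped ENNReal

variable {n : ℕ}

/-- A sequence of bump functions at the origin with radii tending to zero. -/
def mollBump (n m : ℕ) : ContDiffBump (0 : Fin n → ℂ) where
  rIn := 1 / (2 * ((m : ℝ) + 1))
  rOut := 1 / ((m : ℝ) + 1)
  rIn_pos := by positivity
  rIn_lt_rOut := by
    have : (0 : ℝ) < (m : ℝ) + 1 := by positivity
    apply one_div_lt_one_div_of_lt this; linarith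

/-- The normalized mollifying kernel. -/
def mollKer (n m : ℕ) : (Fin n → ℂ) → ℝ := (mollBump n m).normed volume

/-- Convolution with the mollifying kernel. -/
def mollify (m : ℕ) (F : (Fin n → ℂ) → ℂ) : (Fin n → ℂ) → ℂ :=
  convolution (mollKer n m) F (ContinuousLinearMap.lsmul ℝ ℝ) volume

lemma mollKer_nonneg (m : ℕ) (x : Fin n → ℂ) : 0 ≤ mollKer n m x :=
  (mollBump n m).nonneg_normed x

lemma contDiff_mollKer (m : ℕ) : ContDiff ℝ (⊤ : ℕ∞) (mollKer n m) :=
  (mollBump n m).contDiff_normed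

lemma hasCompactSupport_mollKer (m : ℕ) : HasCompactSupport (mollKer n m) :=
  (mollBump n m).hasCompactSupport_normed

lemma mollKer_eq_zero {m : ℕ} {x : Fin n → ℂ} (h : 1 / ((m : ℝ) + 1) ≤ ‖x‖) :
    mollKer n m x = 0 := by
  have := (mollBump n m).support_normed_eq (μ := volume)
  by_contra hx
  have h2 : x ∈ Function.support ((mollBump n m).normed volume) := hx
  rw [this, mem_ball_zero_iff] at h2
  exact absurd h2 (not_lt.2 h)

lemma mollify_apply (m : ℕ) (F : (Fin n → ℂ) → ℂ) (x : Fin n → ℂ) :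
    mollify m F x = ∫ t, (mollKer n m t : ℂ) * F (x - t) := by
  simp [mollify, convolution]

lemma mollify_apply' (m : ℕ) (F : (Fin n → ℂ) → ℂ) (x : Fin n → ℂ) :
    mollify m F x = ∫ t, F t * (mollKer n m (x - t) : ℂ) := by
  rw [mollify_apply, ← integral_sub_left_eq_self _ _ x]
  simp [mul_comm]

lemma contDiff_mollify (m : ℕ) {F : (Fin n → ℂ) → ℂ} (hF : LocallyIntegrable F) :
    ContDiff ℝ (⊤ : ℕ∞) (mollify m F) :=
  (hasCompactSupport_mollKer m).contDiff_convolution_left _ (contDiff_mollKer m) hF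

lemma mollify_eq_zero (m : ℕ) {F : (Fin n → ℂ) → ℂ} {K : Set (Fin n → ℂ)}
    (hK : ∀ z ∉ K, F z = 0) {z : Fin n → ℂ} (hz : z ∉ cthickening (1 / ((m : ℝ) + 1)) K) :
    mollify m F z = 0 := by
  rw [mollify_apply']
  refine integral_eq_zero_of_ae (Eventually.of_forall fun t => ?_)
  by_cases ht : t ∈ K
  · have : 1 / ((m : ℝ) + 1) ≤ ‖z - t‖ := by
      by_contra! h
      exact hz (mem_cthickening_of_dist_le z t _ K ht (by rw [dist_eq_norm]; exact h.le))
    simp [mollKer_eq_zero this]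
  · simp [hK t ht]

lemma fderiv_mollify (m : ℕ) {F : (Fin n → ℂ) → ℂ} (hF : LocallyIntegrable F)
    (x v : Fin n → ℂ) :
    Integrable (fun t => F t * fderiv ℝ (fun y => (mollKer n m (x - y) : ℂ)) t v) ∧
    fderiv ℝ (mollify m F) x v =
      -∫ t, F t * fderiv ℝ (fun y => (mollKer n m (x - y) : ℂ)) t v := by
  have hd : ∀ t, fderiv ℝ (fun y => (mollKer n m (x - y) : ℂ)) t v =
      -(fderiv ℝ (mollKer n m) (x - t) v : ℂ) := by
    intro t
    have h1 : HasFDerivAt (fun y => mollKer n m (x - y))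
        ((fderiv ℝ (mollKer n m) (x - t)).comp (-ContinuousLinearMap.id ℝ (Fin n → ℂ))) t :=
      ((contDiff_mollKer m).differentiable (by simp) (x - t)).hasFDerivAt.comp t
        ((hasFDerivAt_id t).const_sub x)
    rw [fderiv_ofReal_comp (fun y => mollKer n m (x - y)), h1.fderiv]
    simp
  have hc1 : ContDiff ℝ 1 (mollKer n m) := (contDiff_mollKer m).of_le (by exact_mod_cast le_top)
  have e := ((hasCompactSupport_mollKer m).hasFDerivAt_convolution_left
    (ContinuousLinearMap.lsmul ℝ ℝ) hc1 hF x).fderiv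
  have hex : ConvolutionExistsAt (fderiv ℝ (mollKer n m)) F x
      ((ContinuousLinearMap.lsmul ℝ ℝ : ℝ →L[ℝ] ℂ →L[ℝ] ℂ).precompL (Fin n → ℂ)) volume :=
    ((hasCompactSupport_mollKer m).fderiv ℝ).convolutionExists_left _
      (hc1.continuous_fderiv one_ne_zero) hF x
  have hint := ContinuousLinearMap.integrable_comp (ContinuousLinearMap.apply ℝ ℂ v) hex
  constructor
  · have := (integrable_comp_sub_left _ x).2 hint
    refine this.neg.congr (Eventually.of_forall fun t => ?_)
    simp only [hd, Pi.neg_apply]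
    simp [mul_comm]
  · rw [show mollify m F = convolution (mollKer n m) F (ContinuousLinearMap.lsmul ℝ ℝ) volume
      from rfl, e, convolution, ContinuousLinearMap.integral_apply hex,
      ← integral_sub_left_eq_self _ _ x, ← integral_neg]
    refine integral_congr_ae (Eventually.of_forall fun t => ?_)
    simp only [hd]
    simp [mul_comm]

lemma dbarCoord_mollify (m : ℕ) {F : (Fin n → ℂ) → ℂ} (hF : LocallyIntegrable F)
    (x : Fin n → ℂ) (k : Fin n) :
    Integrable (fun t => F t * dbarCoord n (fun y => (mollKer n m (x - y) : ℂ)) k t) ∧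
    dbarCoord n (mollify m F) k x =
      -∫ t, F t * dbarCoord n (fun y => (mollKer n m (x - y) : ℂ)) k t := by
  obtain ⟨i1, e1⟩ := fderiv_mollify m hF x (Pi.single k 1)
  obtain ⟨i2, e2⟩ := fderiv_mollify m hF x (Pi.single k I)
  have e : (fun t => F t * dbarCoord n (fun y => (mollKer n m (x - y) : ℂ)) k t) = fun t =>
      (1 / 2 : ℂ) * (F t * fderiv ℝ (fun y => (mollKer n m (x - y) : ℂ)) t (Pi.single k 1) +
      I * (F t * fderiv ℝ (fun y => (mollKer n m (x - y) : ℂ)) t (Pi.single k I))) := by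
    ext t; simp only [dbarCoord]; ring
  rw [e]
  refine ⟨(i1.add (i2.const_mul I)).const_mul _, ?_⟩
  rw [integral_const_mul, integral_add i1 (i2.const_mul I), integral_const_mul, dbarCoord, e1, e2]
  ring

lemma dzCoord_mollify (m : ℕ) {F : (Fin n → ℂ) → ℂ} (hF : LocallyIntegrable F)
    (x : Fin n → ℂ) (k : Fin n) :
    Integrable (fun t => F t * dzCoord n (fun y => (mollKer n m (x - y) : ℂ)) k t) ∧
    dzCoord n (mollify m F) k x =
      -∫ t, F t * dzCoord n (fun y => (mollKer n m (x - y) : ℂ)) k t := by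
  obtain ⟨i1, e1⟩ := fderiv_mollify m hF x (Pi.single k 1)
  obtain ⟨i2, e2⟩ := fderiv_mollify m hF x (Pi.single k I)
  have e : (fun t => F t * dzCoord n (fun y => (mollKer n m (x - y) : ℂ)) k t) = fun t =>
      (1 / 2 : ℂ) * (F t * fderiv ℝ (fun y => (mollKer n m (x - y) : ℂ)) t (Pi.single k 1) -
      I * (F t * fderiv ℝ (fun y => (mollKer n m (x - y) : ℂ)) t (Pi.single k I))) := by
    ext t; simp only [dzCoord]; ring
  rw [e]
  refine ⟨(i1.sub (i2.const_mul I)).const_mul _, ?_⟩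
  rw [integral_const_mul, integral_sub i1 (i2.const_mul I), integral_const_mul, dzCoord, e1, e2]
  ring

lemma tendsto_translate_L2 {F : (Fin n → ℂ) → ℂ} (hF : MemLp F 2 volume) :
    Tendsto (fun t : Fin n → ℂ => eLpNorm (fun x => F (x - t) - F x) 2 volume) (𝓝 0) (𝓝 0) := by
  let g : (Fin n → ℂ) → C(Fin n → ℂ, Fin n → ℂ) :=
    (ContinuousMap.mk (fun p : (Fin n → ℂ) × (Fin n → ℂ) => p.2 - p.1) (by fun_prop)).curry
  have hg : Continuous g := ContinuousMap.continuous _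
  have hgm : ∀ t, MeasurePreserving (g t) volume volume := fun t =>
    measurePreserving_sub_right volume t
  have h1 := ((continuous_const (y := hF.toLp F)).compMeasurePreservingLp hg hgm
    ENNReal.ofNat_ne_top).tendsto 0
  have h2 := (Lp.tendsto_Lp_iff_tendsto_eLpNorm' _ _).1 h1
  refine h2.congr fun t => ?_
  have a1 := Lp.coeFn_compMeasurePreserving (hF.toLp F) (hgm t)
  have a0 := Lp.coeFn_compMeasurePreserving (hF.toLp F) (hgm 0)
  have b1 := (hgm t).quasiMeasurePreserving.ae_eq_comp hF.coeFn_toLp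
  have b0 := (hgm 0).quasiMeasurePreserving.ae_eq_comp hF.coeFn_toLp
  apply eLpNorm_congr_ae
  filter_upwards [a1, a0, b1, b0] with x h1 h2 h3 h4
  simp only [Pi.sub_apply]
  rw [h1, h2, h3, h4]
  simp [g]

lemma tendsto_mollify_L2 {F : (Fin n → ℂ) → ℂ} (hm : Measurable F) (hF : MemLp F 2 volume) :
    Tendsto (fun m : ℕ => eLpNorm (fun x => mollify m F x - F x) 2 volume) atTop (𝓝 0) := by
  have hloc : LocallyIntegrable F := hF.locallyIntegrable one_le_two
  rw [ENNReal.tendsto_nhds_zero]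
  intro ε hε
  have h1 := (ENNReal.tendsto_nhds_zero.1 (tendsto_translate_L2 hF)) ε hε
  obtain ⟨δ, hδ, hball⟩ := Metric.eventually_nhds_iff.1 h1
  have h2 : ∀ᶠ m : ℕ in atTop, 1 / ((m : ℝ) + 1) < δ :=
    tendsto_one_div_add_atTop_nhds_zero_nat.eventually (gt_mem_nhds hδ)
  filter_upwards [h2] with m hmδ
  set P : Measure (Fin n → ℂ) := volume.withDensity (fun t => ENNReal.ofReal (mollKer n m t))
    with hP
  have kmeas : Measurable (mollKer n m) := (contDiff_mollKer m).continuous.measurable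
  have kint : Integrable (mollKer n m) := (mollBump n m).integrable_normed
  have : IsProbabilityMeasure P := by
    constructor
    rw [hP, withDensity_apply _ MeasurableSet.univ, Measure.restrict_univ,
      ← ofReal_integral_eq_lintegral_ofReal kint (Eventually.of_forall (mollKer_nonneg m)),
      mollKer, (mollBump n m).integral_normed, ENNReal.ofReal_one]
  have hPs : ∀ᵐ t ∂P, ‖t‖ < δ := by
    rw [hP, ae_withDensity_iff kmeas.ennreal_ofReal]
    refine Eventually.of_forall fun t ht => ?_
    by_contra! h
    exact ht (by rw [mollKer_eq_zero (hmδ.le.trans h), ENNReal.ofReal_zero])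
  have hm2 : Measurable (fun p : (Fin n → ℂ) × (Fin n → ℂ) => F (p.1 - p.2) - F p.1) :=
    (hm.comp (measurable_fst.sub measurable_snd)).sub (hm.comp measurable_fst)
  have hrep : ∀ x, mollify m F x - F x = ∫ t, (F (x - t) - F x) ∂P := by
    intro x
    rw [hP, integral_withDensity_eq_integral_toReal_smul kmeas.ennreal_ofReal
      (Eventually.of_forall fun _ => ENNReal.ofReal_lt_top)]
    have hex : Integrable (fun t => (mollKer n m t : ℂ) * F (x - t)) := by
      have : ConvolutionExistsAt (mollKer n m) F x (ContinuousLinearMap.lsmul ℝ ℝ) volume :=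
        (hasCompactSupport_mollKer m).convolutionExists_left _
          (contDiff_mollKer m).continuous hloc x
      simpa [ConvolutionExistsAt] using this
    have e : ∀ t, (ENNReal.ofReal (mollKer n m t)).toReal • (F (x - t) - F x) =
        (mollKer n m t : ℂ) * F (x - t) - (mollKer n m t : ℂ) * F x := by
      intro t
      rw [ENNReal.toReal_ofReal (mollKer_nonneg m t), Complex.real_smul, mul_sub]
    have ko : Integrable (fun t => (mollKer n m t : ℂ)) := kint.ofReal
    simp_rw [e]
    rw [integral_sub hex (ko.mul_const _), integral_mul_const, integral_complex_ofReal,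
      ← mollify_apply, mollKer, (mollBump n m).integral_normed]
    simp
  have sq : ∀ {α : Type} [MeasurableSpace α] (μ : Measure α) (f : α → ℂ),
      eLpNorm f 2 μ ^ (2 : ℕ) = ∫⁻ x, ‖f x‖ₑ ^ (2 : ℕ) ∂μ := by
    intro α _ μ f
    have := eLpNorm_nnreal_pow_eq_lintegral (f := f) (μ := μ) (p := 2) (by norm_num)
    rw [show ((2 : NNReal) : ℝ) = ((2 : ℕ) : ℝ) by norm_num] at this
    simp only [ENNReal.rpow_natCast] at this
    exact this
  have key : eLpNorm (fun x => mollify m F x - F x) 2 volume ^ (2 : ℕ) ≤ ε ^ (2 : ℕ) := by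
    rw [sq]
    calc ∫⁻ x, ‖mollify m F x - F x‖ₑ ^ (2 : ℕ)
        ≤ ∫⁻ x, ∫⁻ t, ‖F (x - t) - F x‖ₑ ^ (2 : ℕ) ∂P := by
          refine lintegral_mono fun x => ?_
          rw [hrep x, ← sq P (fun t => F (x - t) - F x)]
          gcongr
          refine (enorm_integral_le_lintegral_enorm _).trans ?_
          rw [← eLpNorm_one_eq_lintegral_enorm]
          refine eLpNorm_le_eLpNorm_of_exponent_le one_le_two ?_
          exact (hm2.comp measurable_prodMk_left).aestronglyMeasurable
      _ = ∫⁻ t, (∫⁻ x, ‖F (x - t) - F x‖ₑ ^ (2 : ℕ)) ∂P := by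
          refine lintegral_lintegral_swap ?_
          exact (hm2.enorm.pow_const 2).aemeasurable
      _ ≤ ∫⁻ t, ε ^ (2 : ℕ) ∂P := by
          refine lintegral_mono_ae ?_
          filter_upwards [hPs] with t ht
          rw [← sq volume (fun x => F (x - t) - F x)]
          gcongr
          exact hball (by simpa using ht)
      _ = ε ^ (2 : ℕ) := by simp
  exact (ENNReal.pow_le_pow_left_iff two_ne_zero).1 key

end Mollify

section L2Convergence

open Filter Topology
open scoped ENNReal

lemma inner_toLp_toLp {α : Type*} [MeasurableSpace α] {μ : Measure α} {f g : α → ℂ}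
    (hf : MemLp f 2 μ) (hg : MemLp g 2 μ) :
    inner ℂ (hf.toLp f) (hg.toLp g) = ∫ x, (starRingEnd ℂ) (f x) * g x ∂μ := by
  rw [L2.inner_def]
  refine integral_congr_ae ?_
  filter_upwards [hf.coeFn_toLp, hg.coeFn_toLp] with x h1 h2
  rw [h1, h2, RCLike.inner_apply, mul_comm]

lemma norm_toLp_sq {α : Type*} [MeasurableSpace α] {μ : Measure α} {f : α → ℂ}
    (hf : MemLp f 2 μ) : ‖hf.toLp f‖ ^ 2 = ∫ x, normSq (f x) ∂μ := by
  have h := inner_toLp_toLp hf hf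
  rw [inner_self_eq_norm_sq_to_K] at h
  have e : ∀ x, (starRingEnd ℂ) (f x) * f x = (normSq (f x) : ℂ) := fun x => by
    rw [mul_comm, Complex.mul_conj]
  simp_rw [e] at h
  rw [integral_complex_ofReal] at h
  have h' := congrArg Complex.re h
  rw [Complex.ofReal_re] at h'
  rw [← h', ← RCLike.ofReal_pow]
  exact (Complex.ofReal_re _).symm

variable {n : ℕ}

/-- Convergence in `L²` of a sequence of functions on `ℂⁿ`. -/
structure L2Conv (X : ℕ → (Fin n → ℂ) → ℂ) (Y : (Fin n → ℂ) → ℂ) : Prop where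
  memLp : ∀ m, MemLp (X m) 2 volume
  memLp_lim : MemLp Y 2 volume
  tendsto : Tendsto (fun m => eLpNorm (fun x => X m x - Y x) 2 volume) atTop (𝓝 0)

namespace L2Conv

variable {X X' : ℕ → (Fin n → ℂ) → ℂ} {Y Y' : (Fin n → ℂ) → ℂ}

lemma tendsto_toLp (h : L2Conv X Y) :
    Tendsto (fun m => (h.memLp m).toLp (X m)) atTop (𝓝 (h.memLp_lim.toLp Y)) :=
  (Lp.tendsto_Lp_iff_tendsto_eLpNorm'' _ _ _ _).2 h.tendsto

lemma sub (h : L2Conv X Y) (h' : L2Conv X' Y') :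
    L2Conv (fun m x => X m x - X' m x) (fun x => Y x - Y' x) where
  memLp m := (h.memLp m).sub (h'.memLp m)
  memLp_lim := h.memLp_lim.sub h'.memLp_lim
  tendsto := by
    refine tendsto_of_tendsto_of_tendsto_of_le_of_le tendsto_const_nhds
      (by simpa using h.tendsto.add h'.tendsto) (fun _ => zero_le) fun m => ?_
    have := eLpNorm_sub_le (μ := volume) (p := 2)
      ((h.memLp m).sub h.memLp_lim).aestronglyMeasurable
      ((h'.memLp m).sub h'.memLp_lim).aestronglyMeasurable one_le_two
    refine le_trans (le_of_eq ?_) this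
    congr 1; ext x; simp only [Pi.sub_apply]; ring

lemma zero : L2Conv (n := n) (fun _ _ => 0) (fun _ => 0) where
  memLp _ := MemLp.zero
  memLp_lim := MemLp.zero
  tendsto := by simp

lemma neg (h : L2Conv X Y) : L2Conv (fun m x => -X m x) (fun x => -Y x) := by
  simpa using zero.sub h

lemma add (h : L2Conv X Y) (h' : L2Conv X' Y') :
    L2Conv (fun m x => X m x + X' m x) (fun x => Y x + Y' x) := by
  simpa using h.sub h'.neg

lemma sum {ι : Type*} (s : Finset ι) {X : ι → ℕ → (Fin n → ℂ) → ℂ} {Y : ι → (Fin n → ℂ) → ℂ}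
    (h : ∀ i ∈ s, L2Conv (X i) (Y i)) :
    L2Conv (fun m x => ∑ i ∈ s, X i m x) (fun x => ∑ i ∈ s, Y i x) := by
  classical
  induction s using Finset.induction_on with
  | empty => simpa using zero
  | insert a s ha ih =>
    simp only [Finset.sum_insert ha]
    exact (h a (Finset.mem_insert_self a s)).add
      (ih fun i hi => h i (Finset.mem_insert_of_mem hi))

lemma mul_bdd (h : L2Conv X Y) {c : (Fin n → ℂ) → ℂ} (hc : Continuous c) {C : ℝ}
    (hC : ∀ x, ‖c x‖ ≤ C) : L2Conv (fun m x => X m x * c x) (fun x => Y x * c x) where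
  memLp m := (h.memLp m).of_le_mul (c := C)
    ((h.memLp m).aestronglyMeasurable.mul hc.aestronglyMeasurable)
    (Eventually.of_forall fun x => by
      rw [norm_mul, mul_comm]; exact mul_le_mul_of_nonneg_right (hC x) (norm_nonneg _))
  memLp_lim := h.memLp_lim.of_le_mul (c := C)
    (h.memLp_lim.aestronglyMeasurable.mul hc.aestronglyMeasurable)
    (Eventually.of_forall fun x => by
      rw [norm_mul, mul_comm]; exact mul_le_mul_of_nonneg_right (hC x) (norm_nonneg _))
  tendsto := by
    have h0 := ENNReal.Tendsto.const_mul (a := ENNReal.ofReal C) h.tendsto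
      (Or.inr ENNReal.ofReal_ne_top)
    rw [mul_zero] at h0
    refine tendsto_of_tendsto_of_tendsto_of_le_of_le tendsto_const_nhds h0
      (fun _ => zero_le) fun m => ?_
    refine eLpNorm_le_mul_eLpNorm_of_ae_le_mul (Eventually.of_forall fun x => ?_) 2
    rw [← sub_mul, norm_mul, mul_comm]
    exact mul_le_mul_of_nonneg_right (hC x) (norm_nonneg _)

lemma tendsto_integral_normSq (h : L2Conv X Y) :
    Tendsto (fun m => ∫ x, normSq (X m x)) atTop (𝓝 (∫ x, normSq (Y x))) := by
  have := (h.tendsto_toLp.norm).pow 2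
  simpa only [norm_toLp_sq] using this

lemma tendsto_integral_normSq_mul (h : L2Conv X Y) {q : (Fin n → ℂ) → ℝ} (hq : Continuous q)
    (h0 : ∀ x, 0 ≤ q x) {C : ℝ} (hC : ∀ x, q x ≤ C) :
    Tendsto (fun m => ∫ x, normSq (X m x) * q x) atTop (𝓝 (∫ x, normSq (Y x) * q x)) := by
  have := (h.mul_bdd (c := fun x => (Real.sqrt (q x) : ℂ)) (by fun_prop) (C := Real.sqrt C)
    (fun x => by
      rw [Complex.norm_real, Real.norm_of_nonneg (Real.sqrt_nonneg _)]
      exact Real.sqrt_le_sqrt (hC x))).tendsto_integral_normSq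
  simpa only [map_mul, Complex.normSq_ofReal, Real.mul_self_sqrt (h0 _)] using this

lemma tendsto_integral_mul (h : L2Conv X Y) {u : (Fin n → ℂ) → ℂ} (hu : MemLp u 2 volume) :
    Tendsto (fun m => ∫ x, u x * X m x) atTop (𝓝 (∫ x, u x * Y x)) := by
  have hu' : MemLp (fun x => (starRingEnd ℂ) (u x)) 2 volume := hu.star
  have := (tendsto_const_nhds (x := hu'.toLp _)).inner (𝕜 := ℂ) h.tendsto_toLp
  simpa only [inner_toLp_toLp, Complex.conj_conj] using this

end L2Conv

lemma hasCompactSupport_mollify (m : ℕ) {F : (Fin n → ℂ) → ℂ} {K : Set (Fin n → ℂ)}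
    (hK : IsCompact K) (h0 : ∀ z ∉ K, F z = 0) : HasCompactSupport (mollify m F) :=
  HasCompactSupport.intro hK.cthickening fun _ hz => mollify_eq_zero m h0 hz

lemma l2Conv_mollify {F : (Fin n → ℂ) → ℂ} (hm : Measurable F) (hF : MemLp F 2 volume)
    {K : Set (Fin n → ℂ)} (hK : IsCompact K) (h0 : ∀ z ∉ K, F z = 0) :
    L2Conv (fun m => mollify m F) F where
  memLp m := (contDiff_mollify m (hF.locallyIntegrable one_le_two)).continuous
    |>.memLp_of_hasCompactSupport (hasCompactSupport_mollify m hK h0)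
  memLp_lim := hF
  tendsto := tendsto_mollify_L2 hm hF

/-- The weighted a priori estimate for compactly supported `L²` forms whose curl and divergence
are in `L²`. -/
lemma basic_estimate_L2 {Φ : (Fin n → ℂ) → ℝ} (hΦ : ContDiff ℝ 2 Φ) (hΦc : HasCompactSupport Φ)
    {σ : (Fin n → ℂ) → ℝ} (hσ : Continuous σ) (hσc : HasCompactSupport σ) (hσ0 : ∀ z, 0 ≤ σ z)
    {b : Fin n → (Fin n → ℂ) → ℂ} (hb : ∀ j, Continuous (b j)) (hbc : ∀ j, HasCompactSupport (b j))
    (B : ℝ) {K K₀ : Set (Fin n → ℂ)} (hK₀ : IsCompact K₀) (hK : IsOpen K) (hKK : K₀ ⊆ K)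
    (hH : ∀ z ∈ K, ∀ ξ : Fin n → ℂ,
      B * σ z * enormSq n ξ + 2 * normSq (∑ j, ξ j * b j z) ≤ hessC n Φ z ξ)
    {G : Fin n → (Fin n → ℂ) → ℂ} (Gm : ∀ j, Measurable (G j)) (G2 : ∀ j, MemLp (G j) 2 volume)
    (G0 : ∀ j, ∀ z ∉ K₀, G j z = 0)
    {R : Fin n → Fin n → (Fin n → ℂ) → ℂ} (Rm : ∀ j k, Measurable (R j k))
    (R2 : ∀ j k, MemLp (R j k) 2 volume) (R0 : ∀ j k, ∀ z ∉ K₀, R j k z = 0)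
    {D : (Fin n → ℂ) → ℂ} (Dm : Measurable D) (D2 : MemLp D 2 volume) (D0 : ∀ z ∉ K₀, D z = 0)
    (hcurl : ∀ j k, ∀ w : (Fin n → ℂ) → ℂ, ContDiff ℝ (⊤ : ℕ∞) w → HasCompactSupport w →
      ∫ z, (G j z * dbarCoord n w k z - G k z * dbarCoord n w j z) = -∫ z, R j k z * w z)
    (hdiv : ∀ w : (Fin n → ℂ) → ℂ, ContDiff ℝ (⊤ : ℕ∞) w → HasCompactSupport w →
      ∫ z, (∑ j, G j z * dzCoord n w j z) = -∫ z, D z * w z) :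
    B * ∫ z, σ z * enormSq n (fun j => G j z) * Real.exp (-Φ z) ≤
      2 * (∫ z, normSq (D z - ∑ j, G j z * (dzCoord n (fun y => (Φ y : ℂ)) j z - b j z)) *
        Real.exp (-Φ z)) +
      (1 / 2) * ∑ j, ∑ k, ∫ z, normSq (R j k z) * Real.exp (-Φ z) := by
  have le2 : (2 : WithTop ℕ∞) ≤ ((⊤ : ℕ∞) : WithTop ℕ∞) :=
    WithTop.coe_le_coe.2 (le_top : (2 : ℕ∞) ≤ ⊤)
  have hl : ∀ j, LocallyIntegrable (G j) := fun j => (G2 j).locallyIntegrable one_le_two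
  have ker : ∀ (m : ℕ) (x : Fin n → ℂ),
      ContDiff ℝ (⊤ : ℕ∞) (fun y => (mollKer n m (x - y) : ℂ)) ∧
      HasCompactSupport (fun y => (mollKer n m (x - y) : ℂ)) := by
    intro m x
    refine ⟨Complex.ofRealCLM.contDiff.comp ((contDiff_mollKer m).comp
      (contDiff_const.sub contDiff_id)), ?_⟩
    have : HasCompactSupport (fun y => mollKer n m (x - y)) :=
      (hasCompactSupport_mollKer m).comp_homeomorph (Homeomorph.subLeft x)
    exact this.comp_left (g := fun r : ℝ => (r : ℂ)) (by simp)
  have ecurl : ∀ (m : ℕ) j k z, dbarCoord n (mollify m (G j)) k z -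
      dbarCoord n (mollify m (G k)) j z = mollify m (R j k) z := by
    intro m j k z
    obtain ⟨i1, e1⟩ := dbarCoord_mollify m (hl j) z k
    obtain ⟨i2, e2⟩ := dbarCoord_mollify m (hl k) z j
    have := hcurl j k _ (ker m z).1 (ker m z).2
    rw [integral_sub i1 i2] at this
    rw [e1, e2, mollify_apply']
    linear_combination -this
  have ediv : ∀ (m : ℕ) z, ∑ j, dzCoord n (mollify m (G j)) j z = mollify m D z := by
    intro m z
    have := hdiv _ (ker m z).1 (ker m z).2
    rw [integral_finsetSum _ fun j _ => (dzCoord_mollify m (hl j) z j).1] at this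
    simp_rw [(dzCoord_mollify m (hl _) z _).2]
    rw [Finset.sum_neg_distrib, this, mollify_apply', neg_neg]
  have cG := fun j => l2Conv_mollify (Gm j) (G2 j) hK₀ (G0 j)
  have cR := fun j k => l2Conv_mollify (Rm j k) (R2 j k) hK₀ (R0 j k)
  have cD := l2Conv_mollify Dm D2 hK₀ D0
  obtain ⟨δ, hδ, hδK⟩ := hK₀.exists_cthickening_subset_open hK hKK
  have hsmall : ∀ᶠ m : ℕ in atTop, 1 / ((m : ℝ) + 1) < δ :=
    tendsto_one_div_add_atTop_nhds_zero_nat.eventually (gt_mem_nhds hδ)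
  have cW : Continuous fun z => Real.exp (-Φ z) := by
    have := hΦ.continuous; fun_prop
  obtain ⟨M, hM⟩ := hΦc.exists_bound_of_continuous hΦ.continuous
  have bW : ∀ z, Real.exp (-Φ z) ≤ Real.exp M := fun z =>
    Real.exp_le_exp.2 ((neg_le_abs _).trans (hM z))
  obtain ⟨S, hS⟩ := hσc.exists_bound_of_continuous hσ
  have cc : ∀ j, Continuous (fun z => dzCoord n (fun y => (Φ y : ℂ)) j z - b j z) := fun j =>
    ((Complex.ofRealCLM.contDiff.comp hΦ).dzCoord (k := 0) (by norm_num) j).continuous.sub (hb j)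
  have bc : ∀ j, ∃ C, ∀ z, ‖dzCoord n (fun y => (Φ y : ℂ)) j z - b j z‖ ≤ C := fun j => by
    have h1 : HasCompactSupport (fun y => (Φ y : ℂ)) :=
      hΦc.comp_left (g := fun r : ℝ => (r : ℂ)) (by simp)
    exact ((h1.dzCoord j).sub (hbc j)).exists_bound_of_continuous (cc j)
  choose C hC using bc
  have hineq : ∀ᶠ m : ℕ in atTop,
      B * ∑ j, ∫ z, normSq (mollify m (G j) z) * (σ z * Real.exp (-Φ z)) ≤
      2 * (∫ z, normSq (mollify m D z -
        ∑ j, mollify m (G j) z * (dzCoord n (fun y => (Φ y : ℂ)) j z - b j z)) *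
        Real.exp (-Φ z)) +
      (1 / 2) * ∑ j, ∑ k, ∫ z, normSq (mollify m (R j k) z) * Real.exp (-Φ z) := by
    filter_upwards [hsmall] with m hm
    have hcs := fun j => hasCompactSupport_mollify m hK₀ (G0 j)
    have := basic_estimate hΦ (g := fun j => mollify m (G j))
      (fun j => (contDiff_mollify m (hl j)).of_le le2) hcs
      hσ hb B K (fun j z hz => mollify_eq_zero m (G0 j) fun h =>
        hz (hδK (cthickening_mono hm.le _ h))) hH
    simp_rw [ecurl, Finset.sum_sub_distrib, ediv] at this
    refine le_trans (le_of_eq ?_) this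
    congr 1
    rw [← integral_finsetSum]
    · refine integral_congr_ae (Eventually.of_forall fun z => ?_)
      simp only [enormSq, Finset.mul_sum, Finset.sum_mul]
      exact Finset.sum_congr rfl fun j _ => by ring
    · intro j _
      refine Continuous.integrable_of_hasCompactSupport ?_ ?_
      · exact (Complex.continuous_normSq.comp (contDiff_mollify m (hl j)).continuous).mul
          (hσ.mul cW)
      · exact ((hcs j).comp_left (g := normSq) (by simp)).mul_right
  have t1 : Tendsto (fun m : ℕ =>
      B * ∑ j, ∫ z, normSq (mollify m (G j) z) * (σ z * Real.exp (-Φ z))) atTop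
      (𝓝 (B * ∑ j, ∫ z, normSq (G j z) * (σ z * Real.exp (-Φ z)))) := by
    refine (tendsto_finsetSum _ fun j _ => ?_).const_mul B
    refine (cG j).tendsto_integral_normSq_mul (hσ.mul cW) (C := S * Real.exp M)
      (fun z => mul_nonneg (hσ0 z) (Real.exp_nonneg _)) fun z => ?_
    have h1 := (le_abs_self (σ z)).trans (hS z)
    exact mul_le_mul h1 (bW z) (Real.exp_nonneg _) ((hσ0 z).trans h1)
  have t2 := (cD.sub (L2Conv.sum Finset.univ fun j _ => (cG j).mul_bdd (cc j) (hC j)))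
    |>.tendsto_integral_normSq_mul cW (fun z => Real.exp_nonneg _) bW
  have t3 : Tendsto (fun m : ℕ => ∑ j, ∑ k, ∫ z, normSq (mollify m (R j k) z) * Real.exp (-Φ z))
      atTop (𝓝 (∑ j, ∑ k, ∫ z, normSq (R j k z) * Real.exp (-Φ z))) :=
    tendsto_finsetSum _ fun j _ => tendsto_finsetSum _ fun k _ =>
      (cR j k).tendsto_integral_normSq_mul cW (fun z => Real.exp_nonneg _) bW
  refine le_trans (le_of_eq ?_) (le_of_tendsto_of_tendsto t1
    ((t2.const_mul 2).add (t3.const_mul (1 / 2))) hineq)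
  congr 1
  rw [← integral_finsetSum]
  · refine integral_congr_ae (Eventually.of_forall fun z => ?_)
    simp only [enormSq, Finset.mul_sum, Finset.sum_mul]
    exact Finset.sum_congr rfl fun j _ => by ring
  · intro j _
    have h2 := (G2 j).integrable_norm_pow (by norm_num)
    refine Integrable.mono' (h2.const_mul (S * Real.exp M)) ?_ (Eventually.of_forall fun z => ?_)
    · exact (Complex.continuous_normSq.comp_aestronglyMeasurable
        (G2 j).aestronglyMeasurable).mul (hσ.mul cW).aestronglyMeasurable
    · have h1 := (le_abs_self (σ z)).trans (hS z)
      have h3 := mul_le_mul h1 (bW z) (Real.exp_nonneg _) ((hσ0 z).trans h1)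
      rw [Real.norm_of_nonneg (mul_nonneg (normSq_nonneg _)
        (mul_nonneg (hσ0 z) (Real.exp_nonneg _))), Complex.normSq_eq_norm_sq, mul_comm]
      exact mul_le_mul_of_nonneg_right h3 (by positivity)

end L2Convergence

section Cutoff

open Filter Topology
open scoped Manifold ContDiff

variable {n : ℕ}

lemma exists_cutoff {Ω K₀ : Set (Fin n → ℂ)} (hΩ : IsOpen Ω) (hK₀ : IsCompact K₀)
    (hsub : K₀ ⊆ Ω) :
    ∃ χ : (Fin n → ℂ) → ℝ, ContDiff ℝ (⊤ : ℕ∞) χ ∧ HasCompactSupport χ ∧ tsupport χ ⊆ Ω ∧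
      (∀ z, 0 ≤ χ z) ∧ ∃ K, IsOpen K ∧ K₀ ⊆ K ∧ K ⊆ Ω ∧ ∀ z ∈ K, χ z = 1 := by
  obtain ⟨L, hL, hKL, hLΩ⟩ := exists_compact_between hK₀ hΩ hsub
  obtain ⟨f, h1, h0, hf⟩ := exists_contMDiffMap_one_nhds_of_subset_interior
    (n := (⊤ : ℕ∞)) 𝓘(ℝ, Fin n → ℂ) hK₀.isClosed hKL
  have hts : tsupport f ⊆ L := closure_minimal (fun x hx => by
    by_contra h; exact hx (h0 x h)) hL.isClosed
  obtain ⟨K, hKo, hK0K, hK1⟩ := mem_nhdsSet_iff_exists.1 h1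
  exact ⟨f, f.contMDiff.contDiff, HasCompactSupport.intro hL h0, hts.trans hLΩ,
    fun z => (hf z).1, K ∩ Ω, hKo.inter hΩ, subset_inter hK0K hsub, inter_subset_right,
    fun z hz => hK1 hz.1⟩

lemma contDiff_of_tsupport_subset {F : Type*} [NormedAddCommGroup F] [NormedSpace ℝ F]
    {k : WithTop ℕ∞} {f : (Fin n → ℂ) → F} {Ω : Set (Fin n → ℂ)} (hΩ : IsOpen Ω)
    (hf : ContDiffOn ℝ k f Ω) (hs : tsupport f ⊆ Ω) : ContDiff ℝ k f := by
  rw [contDiff_iff_contDiffAt]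
  intro z
  by_cases hz : z ∈ Ω
  · exact hf.contDiffAt (hΩ.mem_nhds hz)
  · have : f =ᶠ[𝓝 z] fun _ => 0 := notMem_tsupport_iff_eventuallyEq.1 fun h => hz (hs h)
    exact contDiffAt_const.congr_of_eventuallyEq this

lemma integral_mul_dbarCoord {f g : (Fin n → ℂ) → ℂ} (hf : ContDiff ℝ 1 f) (hg : ContDiff ℝ 1 g)
    (hc : HasCompactSupport f) (j : Fin n) :
    ∫ z, f z * dbarCoord n g j z = -∫ z, dbarCoord n f j z * g z := by
  have h := integral_dbarCoord_eq_zero (hf.mul hg) (hc.mul_right (f' := g)) j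
  have e : ∀ z, dbarCoord n (fun x => f x * g x) j z =
      dbarCoord n f j z * g z + f z * dbarCoord n g j z := fun z => by
    rw [dbarCoord_mul (hf.differentiable one_ne_zero z) (hg.differentiable one_ne_zero z), add_comm]
  have i1 : Integrable (fun z => dbarCoord n f j z * g z) :=
    ((hf.dbarCoord (k := 0) (by norm_num) j).continuous.mul
      hg.continuous).integrable_of_hasCompactSupport ((hc.dbarCoord j).mul_right)
  have i2 : Integrable (fun z => f z * dbarCoord n g j z) :=
    (hf.continuous.mul
      (hg.dbarCoord (k := 0) (by norm_num) j).continuous).integrable_of_hasCompactSupport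
      hc.mul_right
  have h' : ∫ z, (dbarCoord n f j z * g z + f z * dbarCoord n g j z) = 0 := by
    rw [← h]; exact integral_congr_ae (Eventually.of_forall fun z => (e z).symm)
  rw [integral_add i1 i2] at h'
  linear_combination h'

lemma dbarCoord_mollify_eq (m : ℕ) {w : (Fin n → ℂ) → ℂ} (hw : ContDiff ℝ 1 w)
    (hc : HasCompactSupport w) (j : Fin n) (x : Fin n → ℂ) :
    dbarCoord n (mollify m w) j x = mollify m (dbarCoord n w j) x := by
  have hk : ContDiff ℝ 1 (fun y => (mollKer n m (x - y) : ℂ)) :=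
    Complex.ofRealCLM.contDiff.comp (((contDiff_mollKer m).of_le
      (WithTop.coe_le_coe.2 (le_top : (1 : ℕ∞) ≤ ⊤))).comp (contDiff_const.sub contDiff_id))
  rw [(dbarCoord_mollify m hw.continuous.locallyIntegrable x j).2,
    integral_mul_dbarCoord hw hk hc, mollify_apply', neg_neg]

/-- A weak `∂̄`-equation may be tested against compactly supported `C¹` functions. -/
lemma DbarEq.of_contDiff_one {Ω : Set (Fin n → ℂ)} (hΩ : IsOpen Ω) {u : (Fin n → ℂ) → ℂ}
    {α : Fin n → (Fin n → ℂ) → ℂ} (hu : MemLp u 2 (volume.restrict Ω))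
    (hα : ∀ j, MemLp (α j) 2 (volume.restrict Ω)) (h : DbarEq n Ω u α) (j : Fin n)
    {w : (Fin n → ℂ) → ℂ} (hw : ContDiff ℝ 1 w) (hc : HasCompactSupport w)
    (hs : tsupport w ⊆ Ω) :
    ∫ z in Ω, α j z * w z = -∫ z in Ω, u z * dbarCoord n w j z := by
  have res : ∀ (f g : (Fin n → ℂ) → ℂ), ∫ z in Ω, f z * g z = ∫ z, Ω.indicator f z * g z := by
    intro f g
    rw [← integral_indicator hΩ.measurableSet]
    exact integral_congr_ae (Eventually.of_forall fun z => indicator_mul_left _ _ _)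
  have hu' : MemLp (Ω.indicator u) 2 volume :=
    (memLp_indicator_iff_restrict hΩ.measurableSet).2 hu
  have hα' : MemLp (Ω.indicator (α j)) 2 volume :=
    (memLp_indicator_iff_restrict hΩ.measurableSet).2 (hα j)
  have hw0 : ∀ z ∉ tsupport w, w z = 0 := fun z hz => image_eq_zero_of_notMem_tsupport hz
  have hd0 : ∀ z ∉ tsupport w, dbarCoord n w j z = 0 := fun z hz =>
    image_eq_zero_of_notMem_tsupport fun h => hz (tsupport_dbarCoord_subset j h)
  have cd : Continuous (dbarCoord n w j) := (hw.dbarCoord (k := 0) (by norm_num) j).continuous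
  have c1 := l2Conv_mollify hw.continuous.measurable
    (hw.continuous.memLp_of_hasCompactSupport hc) hc hw0
  have c2 := l2Conv_mollify cd.measurable
    (cd.memLp_of_hasCompactSupport (hc.dbarCoord j)) hc hd0
  rw [res, res]
  have t1 := c1.tendsto_integral_mul hα'
  have t2 := (c2.tendsto_integral_mul hu').neg
  refine tendsto_nhds_unique (t1.congr' ?_) t2
  obtain ⟨δ, hδ, hδK⟩ := IsCompact.exists_cthickening_subset_open hc hΩ hs
  filter_upwards [tendsto_one_div_add_atTop_nhds_zero_nat.eventually (gt_mem_nhds hδ)] with m hm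
  have hz : ∀ z ∉ cthickening (1 / ((m : ℝ) + 1)) (tsupport w), mollify m w z = 0 :=
    fun z hz => mollify_eq_zero m hw0 hz
  have := h j (mollify m w) ⟨contDiff_mollify m hw.continuous.locallyIntegrable,
    hasCompactSupport_mollify m hc hw0, ?_⟩
  · rw [res, res] at this
    rw [this]
    simp_rw [dbarCoord_mollify_eq m hw hc]
  · refine (closure_minimal (fun z hz' => ?_) isClosed_cthickening).trans
      ((cthickening_mono hm.le _).trans hδK)
    by_contra hzn
    exact hz' (hz z hzn)

end Cutoff

section CutoffEstimate

open Filter Topology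
open scoped ContDiff

variable {n : ℕ} {Ω : Set (Fin n → ℂ)}

lemma memLp_mul_of_hasCompactSupport {V m : (Fin n → ℂ) → ℂ} (hV : MemLp V 2 volume)
    (hm : Continuous m) (hc : HasCompactSupport m) : MemLp (fun z => V z * m z) 2 volume := by
  obtain ⟨C, hC⟩ := hm.bounded_above_of_compact_support hc
  exact hV.of_le_mul (c := C) (hV.aestronglyMeasurable.mul hm.aestronglyMeasurable)
    (Eventually.of_forall fun x => by
      rw [norm_mul, mul_comm]; exact mul_le_mul_of_nonneg_right (hC x) (norm_nonneg _))

lemma integrable_mul_of_hasCompactSupport {V m : (Fin n → ℂ) → ℂ} (hV : MemLp V 2 volume)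
    (hm : Continuous m) (hc : HasCompactSupport m) : Integrable (fun z => V z * m z) :=
  MemLp.integrable_mul (p := 2) (q := 2) hV (hm.memLp_of_hasCompactSupport hc)

lemma continuous_mul_of_tsupport_subset {f g : (Fin n → ℂ) → ℂ} (hΩ : IsOpen Ω)
    (hf : ContinuousOn f Ω) (hg : Continuous g) (hs : tsupport g ⊆ Ω) :
    Continuous (fun z => f z * g z) := by
  rw [← contDiff_zero (𝕜 := ℝ)]
  exact contDiff_of_tsupport_subset hΩ (contDiffOn_zero.2 (hf.mul hg.continuousOn))
    ((tsupport_mul_subset_right (f := f) (g := g)).trans hs)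

lemma contDiff_mul_of_tsupport_subset {f g : (Fin n → ℂ) → ℂ} {k : WithTop ℕ∞} (hΩ : IsOpen Ω)
    (hf : ContDiffOn ℝ k f Ω) (hg : ContDiff ℝ k g) (hs : tsupport g ⊆ Ω) :
    ContDiff ℝ k (fun z => f z * g z) :=
  contDiff_of_tsupport_subset hΩ (hf.mul hg.contDiffOn)
    ((tsupport_mul_subset_right (f := f) (g := g)).trans hs)

/-- The weights entering the weighted `∂̄`-estimate on `Ω`. -/
structure WeightData (n : ℕ) (Ω : Set (Fin n → ℂ)) (Φ σ c : (Fin n → ℂ) → ℝ)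
    (b : Fin n → (Fin n → ℂ) → ℂ) (B : ℝ) : Prop where
  isOpen : IsOpen Ω
  contDiffOn_weight : ContDiffOn ℝ 2 Φ Ω
  continuousOn_sigma : ContinuousOn σ Ω
  contDiffOn_c : ContDiffOn ℝ 2 c Ω
  continuousOn_b : ∀ j, ContinuousOn (b j) Ω
  sigma_pos : ∀ z ∈ Ω, 0 < σ z
  c_pos : ∀ z ∈ Ω, 0 < c z
  sq_mul : ∀ z ∈ Ω, c z ^ 2 * σ z = Real.exp (Φ z)
  deriv_c : ∀ z ∈ Ω, ∀ j, 2 * dzCoord n (fun x => (c x : ℂ)) j z =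
    c z * (dzCoord n (fun x => (Φ x : ℂ)) j z - b j z)
  hess_le : ∀ z ∈ Ω, ∀ ξ : Fin n → ℂ,
    B * σ z * enormSq n ξ + 2 * normSq (∑ j, ξ j * b j z) ≤ hessC n Φ z ξ

lemma WeightData.estimate_cutoff {Φ σ c : (Fin n → ℂ) → ℝ} {b : Fin n → (Fin n → ℂ) → ℂ} {B : ℝ}
    (W : WeightData n Ω Φ σ c b B)
    {V : Fin n → (Fin n → ℂ) → ℂ} (Vm : ∀ j, Measurable (V j)) (V2 : ∀ j, MemLp (V j) 2 volume)
    {d : (Fin n → ℂ) → ℂ} (hd : Continuous d)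
    (hcurl : ∀ j k, ∀ w : (Fin n → ℂ) → ℂ, ContDiff ℝ 2 w → HasCompactSupport w →
      tsupport w ⊆ Ω → ∫ z, c z * (V j z * dbarCoord n w k z - V k z * dbarCoord n w j z) = 0)
    (hdiv : ∀ w : (Fin n → ℂ) → ℂ, ContDiff ℝ 2 w → HasCompactSupport w → tsupport w ⊆ Ω →
      ∫ z, (∑ j, V j z * dzCoord n w j z / c z) = -∫ z, d z * w z)
    {η : (Fin n → ℂ) → ℝ} (hη : ContDiff ℝ 2 η) (hηc : HasCompactSupport η)
    (hηs : tsupport η ⊆ Ω) :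
    B * ∫ z, η z ^ 2 * enormSq n (fun j => V j z) ≤
      2 * (∫ z, normSq (η z * c z * d z + ∑ j, V j z * dzCoord n (fun x => (η x : ℂ)) j z) / σ z) +
      (1 / 2) * ∑ j, ∑ k, ∫ z, normSq (V j z * dbarCoord n (fun x => (η x : ℂ)) k z -
        V k z * dbarCoord n (fun x => (η x : ℂ)) j z) / σ z := by
  obtain ⟨χ, hχ, hχc, hχs, hχ0, K, hKo, hKK, hKΩ, hK1⟩ := exists_cutoff W.isOpen hηc hηs
  have hχ2 : ContDiff ℝ 2 χ := hχ.of_le (WithTop.coe_le_coe.2 (le_top : (2 : ℕ∞) ≤ ⊤))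
  have hΩ := W.isOpen
  set ηC : (Fin n → ℂ) → ℂ := fun x => (η x : ℂ) with hηC
  set cC : (Fin n → ℂ) → ℂ := fun x => (c x : ℂ) with hcC
  have ηCd : ContDiff ℝ 2 ηC := Complex.ofRealCLM.contDiff.comp hη
  have ηCc : HasCompactSupport ηC := hηc.comp_left (g := fun x : ℝ => (x : ℂ)) (by simp)
  have ts_eq : tsupport ηC = tsupport η := by
    unfold tsupport; congr 1; ext x; simp [hηC]
  have ηCs : tsupport ηC ⊆ Ω := ts_eq ▸ hηs
  have cCd : ContDiffOn ℝ 2 cC Ω := Complex.ofRealCLM.contDiff.comp_contDiffOn W.contDiffOn_c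
  have η0 : ∀ z ∉ tsupport η, η z = 0 := fun z hz => image_eq_zero_of_notMem_tsupport hz
  have dη0 : ∀ j, ∀ z ∉ tsupport η, dzCoord n ηC j z = 0 := fun j z hz =>
    image_eq_zero_of_notMem_tsupport fun h => hz (ts_eq ▸ tsupport_dzCoord_subset j h)
  have dbη0 : ∀ j, ∀ z ∉ tsupport η, dbarCoord n ηC j z = 0 := fun j z hz =>
    image_eq_zero_of_notMem_tsupport fun h => hz (ts_eq ▸ tsupport_dbarCoord_subset j h)
  -- multipliers
  have m1 : ContDiff ℝ 2 (fun z => cC z * ηC z) := contDiff_mul_of_tsupport_subset hΩ cCd ηCd ηCs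
  have m1c : HasCompactSupport (fun z => cC z * ηC z) := ηCc.mul_left
  have m2 : ∀ k, Continuous (fun z => cC z * dbarCoord n ηC k z) := fun k =>
    continuous_mul_of_tsupport_subset hΩ cCd.continuousOn
      (ηCd.dbarCoord (k := 0) (by norm_num) k).continuous
      ((tsupport_dbarCoord_subset k).trans ηCs)
  have m2c : ∀ k, HasCompactSupport (fun z => cC z * dbarCoord n ηC k z) := fun k =>
    (ηCc.dbarCoord k).mul_left
  have m3 : ∀ k, Continuous (fun z => cC z * dzCoord n ηC k z) := fun k =>
    continuous_mul_of_tsupport_subset hΩ cCd.continuousOn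
      (ηCd.dzCoord (k := 0) (by norm_num) k).continuous
      ((tsupport_dzCoord_subset k).trans ηCs)
  have m3c : ∀ k, HasCompactSupport (fun z => cC z * dzCoord n ηC k z) := fun k =>
    (ηCc.dzCoord k).mul_left
  have hdc : ∀ j, ContinuousOn (dzCoord n cC j) Ω := by
    intro j
    have := (cCd.continuousOn_fderiv_of_isOpen hΩ (by norm_num))
    unfold dzCoord
    fun_prop
  have m4 : ∀ j, Continuous (fun z => (2 * dzCoord n cC j z) * ηC z) := fun j =>
    continuous_mul_of_tsupport_subset hΩ (continuousOn_const.mul (hdc j)) ηCd.continuous ηCs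
  have m4c : ∀ j, HasCompactSupport (fun z => (2 * dzCoord n cC j z) * ηC z) := fun j =>
    ηCc.mul_left
  have m5 : ContDiff ℝ 2 (fun z => cC z * (cC z * ηC z)) :=
    contDiff_mul_of_tsupport_subset hΩ cCd m1
      ((tsupport_mul_subset_right (f := cC) (g := ηC)).trans ηCs)
  have m5c : HasCompactSupport (fun z => cC z * (cC z * ηC z)) := m1c.mul_left
  -- the forms
  set G : Fin n → (Fin n → ℂ) → ℂ := fun j z => V j z * (cC z * ηC z) with hG
  set R : Fin n → Fin n → (Fin n → ℂ) → ℂ := fun j k z =>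
    V j z * (cC z * dbarCoord n ηC k z) - V k z * (cC z * dbarCoord n ηC j z) with hR
  set D : (Fin n → ℂ) → ℂ := fun z => d z * (cC z * (cC z * ηC z)) +
    ∑ j, (V j z * (cC z * dzCoord n ηC j z) + V j z * ((2 * dzCoord n cC j z) * ηC z)) with hD
  have hcurlG : ∀ j k, ∀ w : (Fin n → ℂ) → ℂ, ContDiff ℝ (⊤ : ℕ∞) w → HasCompactSupport w →
      ∫ z, (G j z * dbarCoord n w k z - G k z * dbarCoord n w j z) = -∫ z, R j k z * w z := by
    intro j k w hw hwc
    have hw2 : ContDiff ℝ 2 w := hw.of_le (WithTop.coe_le_coe.2 (le_top : (2 : ℕ∞) ≤ ⊤))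
    have h := hcurl j k (fun z => ηC z * w z) (ηCd.mul hw2) ηCc.mul_right
      ((tsupport_mul_subset_left (f := ηC) (g := w)).trans ηCs)
    have e : ∀ z, cC z * (V j z * dbarCoord n (fun z => ηC z * w z) k z -
        V k z * dbarCoord n (fun z => ηC z * w z) j z) =
        (G j z * dbarCoord n w k z - G k z * dbarCoord n w j z) + R j k z * w z := by
      intro z
      rw [dbarCoord_mul (ηCd.differentiable (by norm_num) z) (hw2.differentiable (by norm_num) z),
        dbarCoord_mul (ηCd.differentiable (by norm_num) z) (hw2.differentiable (by norm_num) z)]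
      simp only [hG, hR]
      ring
    have i1 : ∀ a l, Integrable (fun z => G a z * dbarCoord n w l z) := fun a l => by
      simp only [hG, mul_assoc (V a _)]
      exact integrable_mul_of_hasCompactSupport (V2 a) (m1.continuous.mul
        (hw2.dbarCoord (k := 0) (by norm_num) l).continuous) m1c.mul_right
    have i2 : Integrable (fun z => R j k z * w z) := by
      simp only [hR, sub_mul, mul_assoc (V _ _)]
      exact (integrable_mul_of_hasCompactSupport (V2 j) ((m2 k).mul hw2.continuous)
        (m2c k).mul_right).sub (integrable_mul_of_hasCompactSupport (V2 k)
        ((m2 j).mul hw2.continuous) (m2c j).mul_right)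
    have h' : ∫ z, ((G j z * dbarCoord n w k z - G k z * dbarCoord n w j z) + R j k z * w z) = 0 :=
      by rw [← h]; exact integral_congr_ae (Eventually.of_forall fun z => (e z).symm)
    have i12 : Integrable (fun z => G j z * dbarCoord n w k z - G k z * dbarCoord n w j z) :=
      (i1 j k).sub (i1 k j)
    rw [integral_add i12 i2] at h'
    linear_combination h'
  have hdivG : ∀ w : (Fin n → ℂ) → ℂ, ContDiff ℝ (⊤ : ℕ∞) w → HasCompactSupport w →
      ∫ z, (∑ j, G j z * dzCoord n w j z) = -∫ z, D z * w z := by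
    intro w hw hwc
    have hw2 : ContDiff ℝ 2 w := hw.of_le (WithTop.coe_le_coe.2 (le_top : (2 : ℕ∞) ≤ ⊤))
    have tm5 : tsupport (fun z => cC z * (cC z * ηC z)) ⊆ tsupport η :=
      ((tsupport_mul_subset_right (f := cC) (g := fun z => cC z * ηC z)).trans
        (tsupport_mul_subset_right (f := cC) (g := ηC))).trans ts_eq.subset
    have h := hdiv (fun z => w z * (cC z * (cC z * ηC z))) (hw2.mul m5) hwc.mul_right
      (((tsupport_mul_subset_right (f := w) (g := fun z => cC z * (cC z * ηC z))).trans
        tm5).trans hηs)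
    have e : ∀ z, (∑ j, V j z * dzCoord n (fun z => w z * (cC z * (cC z * ηC z))) j z / c z) =
        (∑ j, G j z * dzCoord n w j z) + (D z * w z - d z * (w z * (cC z * (cC z * ηC z)))) := by
      intro z
      have : D z * w z - d z * (w z * (cC z * (cC z * ηC z))) =
          ∑ j, (V j z * (cC z * dzCoord n ηC j z) +
            V j z * ((2 * dzCoord n cC j z) * ηC z)) * w z := by
        simp only [hD]; rw [← Finset.sum_mul]; ring
      rw [this, ← Finset.sum_add_distrib]
      refine Finset.sum_congr rfl fun j _ => ?_
      rw [dzCoord_mul (hw2.differentiable (by norm_num) z) (m5.differentiable (by norm_num) z)]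
      by_cases hz : z ∈ tsupport η
      · have hzΩ := hηs hz
        have hc0 : cC z ≠ 0 := Complex.ofReal_ne_zero.2 (W.c_pos z hzΩ).ne'
        have dc : DifferentiableAt ℝ cC z :=
          (cCd.contDiffAt (hΩ.mem_nhds hzΩ)).differentiableAt (by norm_num)
        rw [dzCoord_mul dc (m1.differentiable (by norm_num) z),
          dzCoord_mul dc (ηCd.differentiable (by norm_num) z)]
        change _ / cC z = _
        simp only [hG]
        field_simp
        ring
      · have h0 : dzCoord n (fun z => cC z * (cC z * ηC z)) j z = 0 :=
          image_eq_zero_of_notMem_tsupport fun h => hz (tm5 (tsupport_dzCoord_subset j h))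
        have h1 : ηC z = 0 := by simp [hηC, η0 z hz]
        simp [h0, h1, hG, dη0 j z hz]
    have i1 : Integrable (fun z => ∑ j, G j z * dzCoord n w j z) :=
      integrable_finsetSum _ fun j _ => by
        simp only [hG, mul_assoc (V j _)]
        exact integrable_mul_of_hasCompactSupport (V2 j) (m1.continuous.mul
          (hw2.dzCoord (k := 0) (by norm_num) j).continuous) m1c.mul_right
    have i3 : Integrable (fun z => d z * (w z * (cC z * (cC z * ηC z)))) :=
      (hd.mul (hw2.continuous.mul m5.continuous)).integrable_of_hasCompactSupport
        (hwc.mul_right.mul_left)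
    have i2 : Integrable (fun z => D z * w z) := by
      simp only [hD, add_mul, Finset.sum_mul, mul_assoc (V _ _)]
      refine ((hd.mul m5.continuous).mul hw2.continuous |>.integrable_of_hasCompactSupport
        hwc.mul_left).add (integrable_finsetSum _ fun j _ => ?_)
      exact (integrable_mul_of_hasCompactSupport (V2 j) ((m3 j).mul hw2.continuous)
        (m3c j).mul_right).add (integrable_mul_of_hasCompactSupport (V2 j)
        ((m4 j).mul hw2.continuous) (m4c j).mul_right)
    simp only [e] at h
    have i23 : Integrable (fun z => D z * w z - d z * (w z * (cC z * (cC z * ηC z)))) := i2.sub i3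
    rw [integral_add i1 i23, integral_sub i2 i3] at h
    linear_combination h
  have G0 : ∀ j, ∀ z ∉ tsupport η, G j z = 0 := fun j z hz => by simp [hG, hηC, η0 z hz]
  have R0 : ∀ j k, ∀ z ∉ tsupport η, R j k z = 0 := fun j k z hz => by
    simp [hR, dbη0 _ z hz]
  have D0 : ∀ z ∉ tsupport η, D z = 0 := fun z hz => by
    have h1 : ηC z = 0 := by simp [hηC, η0 z hz]
    simp [hD, dη0 _ z hz, h1]
  have key := basic_estimate_L2 (Φ := fun z => χ z * Φ z) (σ := fun z => χ z * σ z)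
    (b := fun j z => χ z * b j z) (K := K) (K₀ := tsupport η) (G := G) (R := R) (D := D)
    (contDiff_of_tsupport_subset hΩ (hχ2.contDiffOn.mul W.contDiffOn_weight)
      ((tsupport_mul_subset_left (f := χ) (g := Φ)).trans hχs)) hχc.mul_right
    (contDiff_zero (𝕜 := ℝ).1 (contDiff_of_tsupport_subset hΩ
      (contDiffOn_zero.2 (hχ.continuous.continuousOn.mul W.continuousOn_sigma))
      ((tsupport_mul_subset_left (f := χ) (g := σ)).trans hχs))) hχc.mul_right ?_ ?_ ?_ B hηc hKo
    hKK ?_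
    (fun j => (Vm j).mul m1.continuous.measurable)
    (fun j => memLp_mul_of_hasCompactSupport (V2 j) m1.continuous m1c) G0
    (fun j k => ((Vm j).mul (m2 k).measurable).sub ((Vm k).mul (m2 j).measurable))
    (fun j k => (memLp_mul_of_hasCompactSupport (V2 j) (m2 k) (m2c k)).sub
      (memLp_mul_of_hasCompactSupport (V2 k) (m2 j) (m2c j))) R0
    ((hd.mul m5.continuous).measurable.add (Finset.measurable_fun_sum _ fun j _ =>
      ((Vm j).mul (m3 j).measurable).add ((Vm j).mul (m4 j).measurable)))
    (((hd.mul m5.continuous).memLp_of_hasCompactSupport m5c.mul_left).add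
      (memLp_finsetSum _ fun j _ =>
        (memLp_mul_of_hasCompactSupport (V2 j) (m3 j) (m3c j)).add
        (memLp_mul_of_hasCompactSupport (V2 j) (m4 j) (m4c j)))) D0 hcurlG hdivG
  · have hE : ∀ z ∈ tsupport η, χ z = 1 ∧ z ∈ Ω := fun z hz => ⟨hK1 z (hKK hz), hηs hz⟩
    have e1 : ∀ z, χ z * σ z * enormSq n (fun j => G j z) * Real.exp (-(χ z * Φ z)) =
        η z ^ 2 * enormSq n (fun j => V j z) := by
      intro z
      by_cases hz : z ∈ tsupport η
      · obtain ⟨h1, h2⟩ := hE z hz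
        have h3 := W.sq_mul z h2
        have h4 : Real.exp (Φ z) * Real.exp (-Φ z) = 1 := by rw [← Real.exp_add]; simp
        simp only [h1, one_mul, enormSq, hG, hηC, hcC, Complex.normSq_mul, Complex.normSq_ofReal,
          ← Finset.sum_mul]
        rw [← h3] at h4
        linear_combination (η z ^ 2 * ∑ j, normSq (V j z)) * h4
      · simp [enormSq, G0 _ z hz, η0 z hz]
    have wt : ∀ z ∈ Ω, ∀ x : ℂ, normSq (c z * x) * Real.exp (-Φ z) = normSq x / σ z := by
      intro z h2 x
      have h3 := W.sq_mul z h2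
      have h5 := (W.sigma_pos z h2).ne'
      have h4 : Real.exp (Φ z) * Real.exp (-Φ z) = 1 := by rw [← Real.exp_add]; simp
      rw [← h3] at h4
      rw [Complex.normSq_mul, Complex.normSq_ofReal, eq_div_iff h5]
      linear_combination normSq x * h4
    have e2 : ∀ z, normSq (D z - ∑ j, G j z * (dzCoord n (fun y => ((χ y * Φ y : ℝ) : ℂ)) j z -
        χ z * b j z)) * Real.exp (-(χ z * Φ z)) =
        normSq (η z * c z * d z + ∑ j, V j z * dzCoord n ηC j z) / σ z := by
      intro z
      by_cases hz : z ∈ tsupport η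
      · obtain ⟨h1, h2⟩ := hE z hz
        have h3 : ∀ j, dzCoord n (fun y => ((χ y * Φ y : ℝ) : ℂ)) j z =
            dzCoord n (fun y => (Φ y : ℂ)) j z := by
          intro j
          have : (fun y => ((χ y * Φ y : ℝ) : ℂ)) =ᶠ[𝓝 z] fun y => (Φ y : ℂ) := by
            filter_upwards [hKo.mem_nhds (hKK hz)] with y hy
            rw [hK1 y hy, one_mul]
          unfold dzCoord
          rw [this.fderiv_eq]
        have h4 : D z - ∑ j, G j z * (dzCoord n (fun y => ((χ y * Φ y : ℝ) : ℂ)) j z -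
            χ z * b j z) = c z * (η z * c z * d z + ∑ j, V j z * dzCoord n ηC j z) := by
          simp only [hD, h1, h3, hG]
          rw [mul_add, Finset.mul_sum, add_sub_assoc, ← Finset.sum_sub_distrib]
          congr 1
          · simp only [hcC, hηC]; ring
          · refine Finset.sum_congr rfl fun j _ => ?_
            rw [W.deriv_c z h2 j]
            simp only [hcC, hηC]; push_cast; ring
        rw [h4, h1, one_mul, wt z h2]
      · simp [G0 _ z hz, D0 z hz, η0 z hz, dη0 _ z hz]
    have e3 : ∀ j k z, normSq (R j k z) * Real.exp (-(χ z * Φ z)) =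
        normSq (V j z * dbarCoord n ηC k z - V k z * dbarCoord n ηC j z) / σ z := by
      intro j k z
      by_cases hz : z ∈ tsupport η
      · obtain ⟨h1, h2⟩ := hE z hz
        have h4 : R j k z = c z * (V j z * dbarCoord n ηC k z - V k z * dbarCoord n ηC j z) := by
          simp only [hR, hcC]; ring
        rw [h4, h1, one_mul, wt z h2]
      · simp [R0 _ _ z hz, dbη0 _ z hz]
    simpa only [e1, e2, e3] using key
  · intro z
    by_cases hz : z ∈ Ω
    · exact mul_nonneg (hχ0 z) (W.sigma_pos z hz).le
    · rw [image_eq_zero_of_notMem_tsupport fun h => hz (hχs h), zero_mul]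
  · intro j
    have hχC : Continuous fun z => (χ z : ℂ) := Complex.continuous_ofReal.comp hχ.continuous
    have := continuous_mul_of_tsupport_subset hΩ (W.continuousOn_b j) hχC
      ((closure_mono fun z hz => by simpa using hz).trans hχs)
    simpa only [mul_comm] using this
  · intro j
    exact (hχc.comp_left (g := fun x : ℝ => (x : ℂ)) (by simp)).mul_right
  · intro z hz ξ
    have h := W.hess_le z (hKΩ hz) ξ
    have h2 : hessC n (fun z => χ z * Φ z) z ξ = hessC n Φ z ξ := by
      have : (fun y => χ y * Φ y) =ᶠ[𝓝 z] Φ := by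
        filter_upwards [hKo.mem_nhds hz] with y hy
        rw [hK1 y hy, one_mul]
      unfold hessC
      rw [(this.iteratedFDeriv ℝ 2).eq_of_nhds]
    simpa only [hK1 z hz, h2, one_mul, Complex.ofReal_one] using h

end CutoffEstimate

section CutoffLimit

open Filter Topology
open scoped ContDiff

variable {n : ℕ} {Ω : Set (Fin n → ℂ)}

lemma normSq_add_le (x y : ℂ) : normSq (x + y) ≤ 2 * normSq x + 2 * normSq y := by
  simp only [normSq_apply, add_re, add_im]
  nlinarith [sq_nonneg (x.re - y.re), sq_nonneg (x.im - y.im)]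

lemma normSq_sum_mul_le (a b : Fin n → ℂ) :
    normSq (∑ j, a j * b j) ≤ enormSq n a * enormSq n b := by
  have h1 : ‖∑ j, a j * b j‖ ≤ ∑ j, ‖a j‖ * ‖b j‖ :=
    (norm_sum_le _ _).trans (Finset.sum_le_sum fun j _ => (norm_mul _ _).le)
  have h2 := Finset.sum_mul_sq_le_sq_mul_sq Finset.univ (fun j => ‖a j‖) (fun j => ‖b j‖)
  simp only [enormSq, Complex.normSq_eq_norm_sq]
  exact (pow_le_pow_left₀ (norm_nonneg _) h1 2).trans h2

lemma integrable_normSq {V : (Fin n → ℂ) → ℂ} (hV : MemLp V 2 volume) :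
    Integrable (fun z => normSq (V z)) := by
  simpa only [Complex.normSq_eq_norm_sq] using hV.integrable_norm_pow (by norm_num)

lemma integrable_enormSq {V : Fin n → (Fin n → ℂ) → ℂ} (hV : ∀ j, MemLp (V j) 2 volume) :
    Integrable (fun z => enormSq n (fun j => V j z)) :=
  integrable_finsetSum _ fun j _ => integrable_normSq (hV j)

lemma enormSq_nonneg (ξ : Fin n → ℂ) : 0 ≤ enormSq n ξ :=
  Finset.sum_nonneg fun _ _ => normSq_nonneg _

lemma normSq_le_enormSq (ξ : Fin n → ℂ) (j : Fin n) : normSq (ξ j) ≤ enormSq n ξ :=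
  Finset.single_le_sum (f := fun j => normSq (ξ j)) (fun _ _ => normSq_nonneg _)
    (Finset.mem_univ j)

/-- Cutoff functions adapted to a weight `σ`: they exhaust `Ω` and their gradients are
controlled by `σ`. -/
structure CutoffSeq (n : ℕ) (Ω : Set (Fin n → ℂ)) (σ : (Fin n → ℂ) → ℝ) (C : ℝ)
    (η : ℕ → (Fin n → ℂ) → ℝ) : Prop where
  contDiff : ∀ m, ContDiff ℝ 2 (η m)
  hasCompactSupport : ∀ m, HasCompactSupport (η m)
  tsupport_subset : ∀ m, tsupport (η m) ⊆ Ω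
  nonneg : ∀ m z, 0 ≤ η m z
  le_one : ∀ m z, η m z ≤ 1
  grad_le : ∀ m, ∀ z ∈ Ω, ∀ j, normSq (dzCoord n (fun x => (η m x : ℂ)) j z) ≤ C * σ z
  eventually_eq_one : ∀ z ∈ Ω, ∀ᶠ m in atTop, η m =ᶠ[𝓝 z] fun _ => 1

lemma dbarCoord_ofReal_eq_conj (f : (Fin n → ℂ) → ℝ) (j : Fin n) (z : Fin n → ℂ) :
    dbarCoord n (fun x => (f x : ℂ)) j z =
      (starRingEnd ℂ) (dzCoord n (fun x => (f x : ℂ)) j z) := by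
  rw [← dbarCoord_conj]
  simp only [Complex.conj_ofReal]

lemma WeightData.estimate {Φ σ c : (Fin n → ℂ) → ℝ} {b : Fin n → (Fin n → ℂ) → ℂ} {B C : ℝ}
    (W : WeightData n Ω Φ σ c b B) (hσm : Measurable σ) {η : ℕ → (Fin n → ℂ) → ℝ}
    (hη : CutoffSeq n Ω σ C η)
    {V : Fin n → (Fin n → ℂ) → ℂ} (Vm : ∀ j, Measurable (V j)) (V2 : ∀ j, MemLp (V j) 2 volume)
    (V0 : ∀ j, ∀ z ∉ Ω, V j z = 0)
    {d : (Fin n → ℂ) → ℂ} (hd : Continuous d) (hdc : HasCompactSupport d) (hds : tsupport d ⊆ Ω)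
    (hcurl : ∀ j k, ∀ w : (Fin n → ℂ) → ℂ, ContDiff ℝ 2 w → HasCompactSupport w →
      tsupport w ⊆ Ω → ∫ z, c z * (V j z * dbarCoord n w k z - V k z * dbarCoord n w j z) = 0)
    (hdiv : ∀ w : (Fin n → ℂ) → ℂ, ContDiff ℝ 2 w → HasCompactSupport w → tsupport w ⊆ Ω →
      ∫ z, (∑ j, V j z * dzCoord n w j z / c z) = -∫ z, d z * w z) :
    B * ∫ z, enormSq n (fun j => V j z) ≤ 2 * ∫ z, normSq (c z * d z) / σ z := by
  have hΩ := W.isOpen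
  have d0 : ∀ z ∉ Ω, d z = 0 := fun z hz => image_eq_zero_of_notMem_tsupport fun h => hz (hds h)
  have cd : Continuous fun z => (c z : ℂ) * d z := continuous_mul_of_tsupport_subset hΩ
    (Complex.continuous_ofReal.comp_continuousOn W.contDiffOn_c.continuousOn) hd hds
  have σcd : Integrable fun z => normSq (c z * d z) / σ z := by
    have h1 : Continuous fun z => normSq (c z * d z) / σ z := by
      rw [← contDiff_zero (𝕜 := ℝ)]
      refine contDiff_of_tsupport_subset hΩ (contDiffOn_zero.2 (ContinuousOn.div
        (Complex.continuous_normSq.comp cd).continuousOn W.continuousOn_sigma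
        fun z hz => (W.sigma_pos z hz).ne')) ((closure_mono fun z hz => ?_).trans hds)
      intro h
      exact hz (by simp [h])
    refine h1.integrable_of_hasCompactSupport (hdc.mono fun z hz h => hz (by simp [h]))
  have dzlim : ∀ z ∈ Ω, ∀ j, ∀ᶠ m in atTop, dzCoord n (fun x => (η m x : ℂ)) j z = 0 := by
    intro z hz j
    filter_upwards [hη.eventually_eq_one z hz] with m hm
    have : (fun x => (η m x : ℂ)) =ᶠ[𝓝 z] fun _ => 1 := hm.mono fun x hx => by simp [hx]
    simp [dzCoord, this.fderiv_eq]
  have ηC : ∀ m, ContDiff ℝ 2 fun x => (η m x : ℂ) := fun m =>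
    Complex.ofRealCLM.contDiff.comp (hη.contDiff m)
  have mdz : ∀ m j, Measurable (dzCoord n (fun x => (η m x : ℂ)) j) := fun m j =>
    ((ηC m).dzCoord (k := 0) (by norm_num) j).continuous.measurable
  have L1 : Tendsto (fun m => ∫ z, η m z ^ 2 * enormSq n (fun j => V j z)) atTop
      (𝓝 (∫ z, enormSq n (fun j => V j z))) := by
    refine tendsto_integral_of_dominated_convergence (fun z => enormSq n (fun j => V j z))
      (fun m => ?_) (integrable_enormSq V2) (fun m => Eventually.of_forall fun z => ?_)
      (Eventually.of_forall fun z => ?_)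
    · exact ((hη.contDiff m).continuous.pow 2).aestronglyMeasurable.mul
        (integrable_enormSq V2).aestronglyMeasurable
    · rw [Real.norm_of_nonneg (mul_nonneg (sq_nonneg _) (enormSq_nonneg _))]
      exact mul_le_of_le_one_left (enormSq_nonneg _) (pow_le_one₀ (hη.nonneg m z) (hη.le_one m z))
    · by_cases hz : z ∈ Ω
      · refine tendsto_const_nhds.congr' ?_
        filter_upwards [hη.eventually_eq_one z hz] with m hm
        simp [hm.eq_of_nhds]
      · simp [enormSq, V0 _ z hz]
  have L2 : Tendsto (fun m => ∫ z, normSq (η m z * c z * d z +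
      ∑ j, V j z * dzCoord n (fun x => (η m x : ℂ)) j z) / σ z) atTop
      (𝓝 (∫ z, normSq (c z * d z) / σ z)) := by
    refine tendsto_integral_of_dominated_convergence (fun z => 2 * (normSq (c z * d z) / σ z) +
      2 * (n * C) * enormSq n (fun j => V j z)) (fun m => Measurable.aestronglyMeasurable ?_)
      ((σcd.const_mul 2).add ((integrable_enormSq V2).const_mul _))
      (fun m => Eventually.of_forall fun z => ?_) (Eventually.of_forall fun z => ?_)
    · refine Measurable.div (Complex.continuous_normSq.measurable.comp (Measurable.add ?_
        (Finset.measurable_fun_sum _ fun j _ => (Vm j).mul (mdz m j)))) hσm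
      simp only [mul_assoc]
      exact (ηC m).continuous.measurable.mul cd.measurable
    · by_cases hz : z ∈ Ω
      · have hσ := W.sigma_pos z hz
        rw [Real.norm_of_nonneg (div_nonneg (normSq_nonneg _) hσ.le), div_le_iff₀ hσ]
        have e1 := normSq_add_le (η m z * c z * d z)
          (∑ j, V j z * dzCoord n (fun x => (η m x : ℂ)) j z)
        have e2 := normSq_sum_mul_le (fun j => V j z)
          (fun j => dzCoord n (fun x => (η m x : ℂ)) j z)
        have e3 : enormSq n (fun j => dzCoord n (fun x => (η m x : ℂ)) j z) ≤ n * (C * σ z) := by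
          refine (Finset.sum_le_sum fun j _ => hη.grad_le m z hz j).trans ?_
          simp
        have e4 : normSq (η m z * c z * d z) ≤ normSq (c z * d z) := by
          rw [mul_assoc, Complex.normSq_mul, Complex.normSq_ofReal]
          have := hη.nonneg m z
          have := hη.le_one m z
          exact mul_le_of_le_one_left (normSq_nonneg _) (by nlinarith)
        have e5 := mul_le_mul_of_nonneg_left e3 (enormSq_nonneg fun j => V j z)
        have e6 : normSq (c z * d z) / σ z * σ z = normSq (c z * d z) := div_mul_cancel₀ _ hσ.ne'
        linear_combination e1 + 2 * e2 + 2 * e4 + 2 * e5 - 2 * e6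
      · simp [V0 _ z hz, d0 z hz, enormSq]
    · by_cases hz : z ∈ Ω
      · refine tendsto_const_nhds.congr' ?_
        filter_upwards [hη.eventually_eq_one z hz, eventually_all.2 (dzlim z hz)] with m hm hm'
        simp [hm.eq_of_nhds, hm']
      · simp [V0 _ z hz, d0 z hz]
  have L3 : ∀ j k, Tendsto (fun m => ∫ z, normSq (V j z * dbarCoord n (fun x => (η m x : ℂ)) k z -
      V k z * dbarCoord n (fun x => (η m x : ℂ)) j z) / σ z) atTop (𝓝 0) := by
    intro j k
    have := tendsto_integral_of_dominated_convergence (μ := volume) (f := fun _ => (0 : ℝ))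
      (F := fun m z => normSq (V j z * dbarCoord n (fun x => (η m x : ℂ)) k z -
      V k z * dbarCoord n (fun x => (η m x : ℂ)) j z) / σ z)
      (fun z => 2 * C * normSq (V j z) + 2 * C * normSq (V k z))
      (fun m => Measurable.aestronglyMeasurable ?_)
      (((integrable_normSq (V2 j)).const_mul _).add ((integrable_normSq (V2 k)).const_mul _))
      (fun m => Eventually.of_forall fun z => ?_) (Eventually.of_forall fun z => ?_)
    · simpa using this
    · simp only [dbarCoord_ofReal_eq_conj]
      exact Measurable.div (Complex.continuous_normSq.measurable.comp (Measurable.sub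
        ((Vm j).mul (Complex.continuous_conj.measurable.comp (mdz m k)))
        ((Vm k).mul (Complex.continuous_conj.measurable.comp (mdz m j))))) hσm
    · by_cases hz : z ∈ Ω
      · have hσ := W.sigma_pos z hz
        rw [Real.norm_of_nonneg (div_nonneg (normSq_nonneg _) hσ.le), div_le_iff₀ hσ, sub_eq_add_neg]
        have e1 := normSq_add_le (V j z * dbarCoord n (fun x => (η m x : ℂ)) k z)
          (-(V k z * dbarCoord n (fun x => (η m x : ℂ)) j z))
        simp only [Complex.normSq_neg, Complex.normSq_mul, dbarCoord_ofReal_eq_conj,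
          Complex.normSq_conj] at e1 ⊢
        have e2 := mul_le_mul_of_nonneg_left (hη.grad_le m z hz k) (normSq_nonneg (V j z))
        have e3 := mul_le_mul_of_nonneg_left (hη.grad_le m z hz j) (normSq_nonneg (V k z))
        linear_combination e1 + 2 * e2 + 2 * e3
      · simp [V0 _ z hz]
    · by_cases hz : z ∈ Ω
      · refine tendsto_const_nhds.congr' ?_
        filter_upwards [eventually_all.2 (dzlim z hz)] with m hm'
        simp [dbarCoord_ofReal_eq_conj, hm']
      · simp [V0 _ z hz]
  have L4 := (L2.const_mul 2).add ((tendsto_finsetSum Finset.univ fun j _ =>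
    tendsto_finsetSum Finset.univ fun k _ => L3 j k).const_mul (1 / 2))
  refine (le_of_tendsto_of_tendsto' (L1.const_mul B) L4 fun m => W.estimate_cutoff Vm V2 hd hcurl
    hdiv (hη.contDiff m) (hη.hasCompactSupport m) (hη.tsupport_subset m)).trans_eq ?_
  simp

end CutoffLimit

section Projection

open Filter Topology
open scoped ContDiff

variable {n : ℕ} {Ω : Set (Fin n → ℂ)}

lemma dbarCoord_dbarCoord_comm {f : (Fin n → ℂ) → ℂ} (hf : ContDiff ℝ 2 f) (j k : Fin n)
    (z : Fin n → ℂ) : dbarCoord n (dbarCoord n f j) k z = dbarCoord n (dbarCoord n f k) j z := by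
  have h1 : Differentiable ℝ (fderiv ℝ f) :=
    (hf.fderiv_right (m := 1) (by norm_num)).differentiable (by norm_num)
  have h2 : ∀ v w, fderiv ℝ (fderiv ℝ f) z v w = fderiv ℝ (fderiv ℝ f) z w v :=
    (hf.contDiffAt (x := z)).isSymmSndFDerivAt (by simp)
  have e : ∀ (v w u : Fin n → ℂ),
      fderiv ℝ (fun x => (1 / 2 : ℂ) * (fderiv ℝ f x v + I * fderiv ℝ f x w)) z u =
      (1 / 2) * (fderiv ℝ (fderiv ℝ f) z u v + I * fderiv ℝ (fderiv ℝ f) z u w) := by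
    intro v w u
    have hv : DifferentiableAt ℝ (fun x => fderiv ℝ f x v) z := by fun_prop
    have hw : DifferentiableAt ℝ (fun x => fderiv ℝ f x w) z := by fun_prop
    rw [fderiv_const_mul (by fun_prop), fderiv_fun_add hv (by fun_prop), fderiv_const_mul hw]
    simp only [fderiv_fderiv_apply_const hf, add_apply, smul_apply, smul_eq_mul]
  have e2 : ∀ k, dbarCoord n f k = fun x =>
      (1 / 2 : ℂ) * (fderiv ℝ f x (Pi.single k 1) + I * fderiv ℝ f x (Pi.single k I)) := fun k => by
    ext x; simp only [dbarCoord]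
  rw [e2 j, e2 k]
  simp only [dbarCoord, e]
  rw [h2 (Pi.single k 1) (Pi.single j 1), h2 (Pi.single k 1) (Pi.single j I),
    h2 (Pi.single k I) (Pi.single j 1), h2 (Pi.single k I) (Pi.single j I)]
  ring

lemma integral_dbarCoord_mul_dbarCoord_comm {f g : (Fin n → ℂ) → ℂ} (hf : ContDiff ℝ 2 f)
    (hg : ContDiff ℝ 2 g) (hc : HasCompactSupport f) (j k : Fin n) :
    ∫ z, dbarCoord n f j z * dbarCoord n g k z = ∫ z, dbarCoord n f k z * dbarCoord n g j z := by
  have h : ∀ j k, ∫ z, f z * dbarCoord n (dbarCoord n g k) j z =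
      -∫ z, dbarCoord n f j z * dbarCoord n g k z := fun j k =>
    integral_mul_dbarCoord (hf.of_le (by norm_num)) (hg.dbarCoord (by norm_num) k) hc j
  have h1 := h j k
  have h2 := h k j
  simp_rw [dbarCoord_dbarCoord_comm hg k j] at h1
  exact neg_injective (h1.symm.trans h2)

/-- The space of square-integrable `(0,1)`-forms on `Ω`. -/
abbrev L2Form (n : ℕ) (Ω : Set (Fin n → ℂ)) : Type :=
  PiLp 2 fun _ : Fin n => Lp ℂ 2 ((volume : Measure (Fin n → ℂ)).restrict Ω)

lemma integral_mul_eq_inner {α : Type*} [MeasurableSpace α] {μ : Measure α} {m : α → ℂ}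
    (hm : MemLp m 2 μ) (g : Lp ℂ 2 μ) :
    ∫ x, m x * g x ∂μ = inner ℂ ((MemLp.star hm).toLp _) g := by
  have := inner_toLp_toLp (MemLp.star hm) (Lp.memLp g)
  rw [Lp.toLp_coeFn] at this
  rw [this]
  simp

/-- Compactly supported `C²` functions in `Ω`. -/
structure IsC2Test (n : ℕ) (Ω : Set (Fin n → ℂ)) (w : (Fin n → ℂ) → ℂ) : Prop where
  contDiff : ContDiff ℝ 2 w
  hasCompactSupport : HasCompactSupport w
  tsupport_subset : tsupport w ⊆ Ω

lemma IsC2Test.memLp_mul_dbarCoord {w : (Fin n → ℂ) → ℂ} (hw : IsC2Test n Ω w) (hΩ : IsOpen Ω)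
    {c : (Fin n → ℂ) → ℝ} (hc : ContinuousOn c Ω) (k : Fin n) :
    MemLp (fun z => c z * dbarCoord n w k z) 2 (volume.restrict Ω) :=
  ((continuous_mul_of_tsupport_subset hΩ (Complex.continuous_ofReal.comp_continuousOn hc)
    (hw.contDiff.dbarCoord (k := 0) (by norm_num) k).continuous
    ((tsupport_dbarCoord_subset k).trans hw.tsupport_subset)).memLp_of_hasCompactSupport
    (hw.hasCompactSupport.dbarCoord k).mul_left).restrict Ω

/-- The forms `V` such that `cV` is weakly `∂̄`-closed. -/
def curlFree (hΩ : IsOpen Ω) {c : (Fin n → ℂ) → ℝ} (hc : ContinuousOn c Ω) :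
    Submodule ℂ (L2Form n Ω) where
  carrier := {V | ∀ j k, ∀ w, IsC2Test n Ω w →
    ∫ z in Ω, (c z * dbarCoord n w k z) * V j z = ∫ z in Ω, (c z * dbarCoord n w j z) * V k z}
  zero_mem' j k w hw := by
    rw [integral_mul_eq_inner (hw.memLp_mul_dbarCoord hΩ hc k),
      integral_mul_eq_inner (hw.memLp_mul_dbarCoord hΩ hc j)]
    simp
  add_mem' {V V'} h h' j k w hw := by
    have h := h j k w hw
    have h' := h' j k w hw
    rw [integral_mul_eq_inner (hw.memLp_mul_dbarCoord hΩ hc k),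
      integral_mul_eq_inner (hw.memLp_mul_dbarCoord hΩ hc j)] at *
    simp only [PiLp.add_apply, inner_add_right, h, h']
  smul_mem' a V h j k w hw := by
    have h := h j k w hw
    rw [integral_mul_eq_inner (hw.memLp_mul_dbarCoord hΩ hc k),
      integral_mul_eq_inner (hw.memLp_mul_dbarCoord hΩ hc j)] at *
    simp only [PiLp.smul_apply, inner_smul_right, h]

lemma isClosed_curlFree (hΩ : IsOpen Ω) {c : (Fin n → ℂ) → ℝ} (hc : ContinuousOn c Ω) :
    IsClosed (curlFree hΩ hc : Set (L2Form n Ω)) := by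
  have : (curlFree hΩ hc : Set (L2Form n Ω)) = ⋂ (j) (k) (w) (_ : IsC2Test n Ω w),
      {V | ∫ z in Ω, (c z * dbarCoord n w k z) * V j z =
        ∫ z in Ω, (c z * dbarCoord n w j z) * V k z} := by
    ext V; simp [curlFree]
  rw [this]
  refine isClosed_iInter fun j => isClosed_iInter fun k => isClosed_iInter fun w =>
    isClosed_iInter fun hw => ?_
  simp only [integral_mul_eq_inner (hw.memLp_mul_dbarCoord hΩ hc k),
      integral_mul_eq_inner (hw.memLp_mul_dbarCoord hΩ hc j)]
  exact isClosed_eq (by fun_prop) (by fun_prop)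

/-- The `L²`-form with the given components. -/
def toL2Form {F : Fin n → (Fin n → ℂ) → ℂ} (hF : ∀ j, MemLp (F j) 2 (volume.restrict Ω)) :
    L2Form n Ω := WithLp.toLp 2 fun j => (hF j).toLp (F j)

lemma inner_toL2Form {F : Fin n → (Fin n → ℂ) → ℂ} (hF : ∀ j, MemLp (F j) 2 (volume.restrict Ω))
    (V : L2Form n Ω) :
    inner ℂ (toL2Form hF) V = ∑ j, ∫ z in Ω, (starRingEnd ℂ) (F j z) * V j z := by
  rw [PiLp.inner_apply]
  refine Finset.sum_congr rfl fun j _ => ?_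
  have := inner_toLp_toLp (hF j) (Lp.memLp (V j))
  rwa [Lp.toLp_coeFn] at this

lemma toL2Form_coeFn {F : Fin n → (Fin n → ℂ) → ℂ}
    (hF : ∀ j, MemLp (F j) 2 (volume.restrict Ω)) (j : Fin n) :
    ⇑(toL2Form hF j) =ᵐ[volume.restrict Ω] F j := (hF j).coeFn_toLp

lemma norm_sq_L2Form (V : L2Form n Ω) : ‖V‖ ^ 2 = ∑ j, ∫ z in Ω, normSq (V j z) := by
  rw [PiLp.norm_sq_eq_of_L2]
  refine Finset.sum_congr rfl fun j _ => ?_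
  have := norm_toLp_sq (Lp.memLp (V j))
  rwa [Lp.toLp_coeFn] at this

lemma toL2Form_mem_curlFree (hΩ : IsOpen Ω) {c : (Fin n → ℂ) → ℝ} (hc : ContinuousOn c Ω)
    {F : Fin n → (Fin n → ℂ) → ℂ} (hF : ∀ j, MemLp (F j) 2 (volume.restrict Ω))
    (h : ∀ j k, ∀ w, IsC2Test n Ω w → ∫ z in Ω, dbarCoord n w k z * (c z * F j z) =
      ∫ z in Ω, dbarCoord n w j z * (c z * F k z)) :
    toL2Form hF ∈ curlFree hΩ hc := by
  have e : ∀ j k w, ∫ z in Ω, (c z * dbarCoord n w k z) * toL2Form hF j z =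
      ∫ z in Ω, dbarCoord n w k z * (c z * F j z) := fun j k w => by
    refine integral_congr_ae ?_
    filter_upwards [toL2Form_coeFn hF j] with z hz
    rw [hz]; ring
  intro j k w hw
  rw [e, e, h j k w hw]

end Projection

section Pairing

open Filter Topology
open scoped ContDiff

variable {n : ℕ} {Ω : Set (Fin n → ℂ)}

lemma WeightData.pairing_bound {Φ σ c : (Fin n → ℂ) → ℝ} {b : Fin n → (Fin n → ℂ) → ℂ} {B C : ℝ}
    (W : WeightData n Ω Φ σ c b B) (hσm : Measurable σ) {η : ℕ → (Fin n → ℂ) → ℝ}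
    (hη : CutoffSeq n Ω σ C η) (hB : 0 ≤ B) {M : ℝ} (hM : ∀ z ∈ Ω, 1 ≤ M * c z ^ 2)
    {u : (Fin n → ℂ) → ℂ} {f : Fin n → (Fin n → ℂ) → ℂ} (hu : MemLp u 2 (volume.restrict Ω))
    (hf : ∀ j, MemLp (f j) 2 (volume.restrict Ω)) (huf : DbarEq n Ω u f)
    {h : Fin n → (Fin n → ℂ) → ℂ} (hh : ∀ j, IsTest n Ω (h j)) :
    B * ‖∑ j, ∫ z in Ω, (starRingEnd ℂ) (f j z) * h j z‖ ^ 2 ≤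
      M * (∑ j, ∫ z in Ω, normSq (f j z)) *
      (2 * ∫ z, normSq (c z * ∑ j, dzCoord n (h j) j z) / σ z) := by
  have hΩ := W.isOpen
  have hcO : ContinuousOn c Ω := W.contDiffOn_c.continuousOn
  have cC : ContinuousOn (fun z => (c z : ℂ)) Ω := Complex.continuous_ofReal.comp_continuousOn hcO
  have c0 : ∀ z ∈ Ω, (c z : ℂ) ≠ 0 := fun z hz => Complex.ofReal_ne_zero.2 (W.c_pos z hz).ne'
  have cI : ContinuousOn (fun z => (c z : ℂ)⁻¹) Ω := cC.inv₀ c0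
  have hh2 : ∀ j, IsC2Test n Ω (h j) := fun j =>
    ⟨(hh j).1.of_le (WithTop.coe_le_coe.2 (le_top : (2 : ℕ∞) ≤ ⊤)), (hh j).2.1, (hh j).2.2⟩
  have aeΩ : ∀ᵐ z ∂(volume.restrict Ω), z ∈ Ω := ae_restrict_mem hΩ.measurableSet
  have bound : ∀ z ∈ Ω, normSq ((c z : ℂ)⁻¹) ≤ M := by
    intro z hz
    have := W.c_pos z hz
    rw [map_inv₀, Complex.normSq_ofReal, inv_le_iff_one_le_mul₀ (by positivity)]
    nlinarith [hM z hz]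
  have hF : ∀ j, MemLp (fun z => (c z : ℂ)⁻¹ * f j z) 2 (volume.restrict Ω) := fun j => by
    refine (hf j).of_le_mul (c := Real.sqrt M)
      ((cI.aestronglyMeasurable hΩ.measurableSet).mul (hf j).aestronglyMeasurable) ?_
    filter_upwards [aeΩ] with z hz
    rw [norm_mul]
    refine mul_le_mul_of_nonneg_right ?_ (norm_nonneg _)
    rw [Complex.norm_def]
    exact Real.sqrt_le_sqrt (bound z hz)
  have hp : ∀ j, MemLp (fun z => c z * h j z) 2 (volume.restrict Ω) := fun j =>
    ((continuous_mul_of_tsupport_subset hΩ cC (hh2 j).contDiff.continuous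
      (hh2 j).tsupport_subset).memLp_of_hasCompactSupport
      (hh2 j).hasCompactSupport.mul_left).restrict Ω
  have hg : ∀ w, IsC2Test n Ω w → ∀ j,
      MemLp (fun z => (c z : ℂ)⁻¹ * dbarCoord n w j z) 2 (volume.restrict Ω) := fun w hw j =>
    ((continuous_mul_of_tsupport_subset hΩ cI
      (hw.contDiff.dbarCoord (k := 0) (by norm_num) j).continuous
      ((tsupport_dbarCoord_subset j).trans hw.tsupport_subset)).memLp_of_hasCompactSupport
      (hw.hasCompactSupport.dbarCoord j).mul_left).restrict Ω
  set N := curlFree hΩ hcO with hN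
  have : CompleteSpace N := (isClosed_curlFree hΩ hcO).completeSpace_coe
  have cancel : ∀ (F w : (Fin n → ℂ) → ℂ), ∫ z in Ω, w z * (c z * ((c z : ℂ)⁻¹ * F z)) =
      ∫ z in Ω, F z * w z := fun F w =>
    setIntegral_congr_fun hΩ.measurableSet fun z hz => by
      have := c0 z hz
      field_simp
  have aN : toL2Form hF ∈ N := by
    refine toL2Form_mem_curlFree hΩ hcO hF fun j k w hw => ?_
    have key : ∀ j k, ∫ z in Ω, f j z * dbarCoord n w k z =
        -∫ z in Ω, u z * dbarCoord n (dbarCoord n w k) j z := fun j k =>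
      DbarEq.of_contDiff_one hΩ hu hf huf j (hw.contDiff.dbarCoord (by norm_num) k)
        (hw.hasCompactSupport.dbarCoord k)
        ((tsupport_dbarCoord_subset k).trans hw.tsupport_subset)
    rw [cancel, cancel, key, key]
    simp_rw [dbarCoord_dbarCoord_comm hw.contDiff j k]
  have gN : ∀ w (hw : IsC2Test n Ω w), toL2Form (hg w hw) ∈ N := by
    intro w hw
    refine toL2Form_mem_curlFree hΩ hcO (hg w hw) fun j k v hv => ?_
    rw [cancel, cancel, setIntegral_eq_integral_of_forall_compl_eq_zero,
      setIntegral_eq_integral_of_forall_compl_eq_zero]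
    · exact integral_dbarCoord_mul_dbarCoord_comm hw.contDiff hv.contDiff hw.hasCompactSupport j k
    all_goals
      intro z hz
      rw [image_eq_zero_of_notMem_tsupport fun h =>
        hz (((tsupport_dbarCoord_subset _).trans hw.tsupport_subset) h), zero_mul]
  set p := toL2Form hp with hpdef
  set Q := N.starProjection p with hQ
  have QN : Q ∈ N := Submodule.starProjection_apply_mem _ _
  have proj : ∀ x ∈ N, inner ℂ x p = inner ℂ x Q := by
    intro x hx
    have := Submodule.starProjection_inner_eq_zero p x hx
    rw [← sub_eq_zero, ← inner_sub_right, ← inner_conj_symm, this, map_zero]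
  have pcomp : ∀ (F : Fin n → (Fin n → ℂ) → ℂ) (hF : ∀ j, MemLp (F j) 2 (volume.restrict Ω)),
      inner ℂ (toL2Form hF) p = ∑ j, ∫ z in Ω, (starRingEnd ℂ) (F j z) * (c z * h j z) := by
    intro F hF
    rw [inner_toL2Form]
    refine Finset.sum_congr rfl fun j _ => integral_congr_ae ?_
    filter_upwards [toL2Form_coeFn hp j] with z hz
    rw [hz]
  set V : Fin n → (Fin n → ℂ) → ℂ := fun j => Ω.indicator (Q j) with hV
  have Vm : ∀ j, Measurable (V j) := fun j =>
    (Lp.stronglyMeasurable (Q j)).measurable.indicator hΩ.measurableSet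
  have V2 : ∀ j, MemLp (V j) 2 volume := fun j =>
    (memLp_indicator_iff_restrict hΩ.measurableSet).2 (Lp.memLp (Q j))
  have V0 : ∀ j, ∀ z ∉ Ω, V j z = 0 := fun j z hz => indicator_of_notMem hz _
  have V1 : ∀ j, ∀ z ∈ Ω, V j z = Q j z := fun j z hz => indicator_of_mem hz _
  set d : (Fin n → ℂ) → ℂ := fun z => ∑ j, dzCoord n (h j) j z with hd
  have dcj : ∀ j, Continuous (dzCoord n (h j) j) := fun j =>
    ((hh2 j).contDiff.dzCoord (k := 0) (by norm_num) j).continuous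
  have dc : Continuous d := continuous_finsetSum _ fun j _ => dcj j
  have d0 : ∀ z ∉ ⋃ j, tsupport (h j), d z = 0 := fun z hz => Finset.sum_eq_zero fun j _ =>
    image_eq_zero_of_notMem_tsupport fun h' =>
      hz (mem_iUnion.2 ⟨j, tsupport_dzCoord_subset j h'⟩)
  have hcomp : IsCompact (⋃ j, tsupport (h j)) := isCompact_iUnion fun j => (hh j).2.1
  have dsup : HasCompactSupport d := HasCompactSupport.intro hcomp d0
  have dts : tsupport d ⊆ Ω := (closure_minimal (fun z hz => by
    by_contra h'; exact hz (d0 z h')) hcomp.isClosed).trans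
    (iUnion_subset fun j => (hh j).2.2)
  have est := W.estimate hσm hη Vm V2 V0 dc dsup dts ?_ ?_
  · have n1 : ∫ z, enormSq n (fun j => V j z) = ‖Q‖ ^ 2 := by
      rw [norm_sq_L2Form]
      simp only [enormSq]
      rw [integral_finsetSum _ fun j _ => integrable_normSq (V2 j)]
      refine Finset.sum_congr rfl fun j _ => ?_
      rw [← setIntegral_eq_integral_of_forall_compl_eq_zero (s := Ω)
        fun z hz => by rw [V0 j z hz, map_zero]]
      exact setIntegral_congr_fun hΩ.measurableSet fun z hz => by simp only [V1 j z hz]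
    have n2 : ‖toL2Form hF‖ ^ 2 ≤ M * ∑ j, ∫ z in Ω, normSq (f j z) := by
      rw [norm_sq_L2Form, Finset.mul_sum]
      refine Finset.sum_le_sum fun j _ => ?_
      have i1 : ∀ g : (Fin n → ℂ) → ℂ, MemLp g 2 (volume.restrict Ω) →
          Integrable (fun z => normSq (g z)) (volume.restrict Ω) := fun g hg => by
        simpa only [Complex.normSq_eq_norm_sq] using hg.integrable_norm_pow (by norm_num)
      rw [← integral_const_mul]
      refine integral_mono_ae (i1 _ (Lp.memLp _)) ((i1 _ (hf j)).const_mul M) ?_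
      filter_upwards [aeΩ, toL2Form_coeFn hF j] with z hz h'
      rw [h', Complex.normSq_mul]
      exact mul_le_mul_of_nonneg_right (bound z hz) (normSq_nonneg _)
    have n3 : ∑ j, ∫ z in Ω, (starRingEnd ℂ) (f j z) * h j z = inner ℂ (toL2Form hF) Q := by
      rw [← proj _ aN, pcomp]
      refine Finset.sum_congr rfl fun j _ => setIntegral_congr_fun hΩ.measurableSet fun z hz => ?_
      have := c0 z hz
      simp only [map_mul, map_inv₀, Complex.conj_ofReal]
      field_simp
    rw [n1] at est
    rw [n3]
    have n4 : ‖inner ℂ (toL2Form hF) Q‖ ^ 2 ≤ ‖toL2Form hF‖ ^ 2 * ‖Q‖ ^ 2 := by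
      rw [← mul_pow]
      exact pow_le_pow_left₀ (norm_nonneg _) (norm_inner_le_norm _ _) 2
    calc B * ‖inner ℂ (toL2Form hF) Q‖ ^ 2 ≤ B * (‖toL2Form hF‖ ^ 2 * ‖Q‖ ^ 2) :=
          mul_le_mul_of_nonneg_left n4 hB
      _ = ‖toL2Form hF‖ ^ 2 * (B * ‖Q‖ ^ 2) := by ring
      _ ≤ _ := mul_le_mul n2 est (by positivity) ((sq_nonneg _).trans n2)
  · intro j k w hw hwc hws
    have hw' : IsC2Test n Ω w := ⟨hw, hwc, hws⟩
    have := QN j k w hw'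
    rw [← setIntegral_eq_integral_of_forall_compl_eq_zero (s := Ω)
        fun z hz => by rw [V0 j z hz, V0 k z hz]; simp]
    have i1 : ∀ a l, Integrable (fun z => (c z * dbarCoord n w l z) * Q a z)
        (volume.restrict Ω) := fun a l =>
      MemLp.integrable_mul (p := 2) (q := 2) (hw'.memLp_mul_dbarCoord hΩ hcO l) (Lp.memLp (Q a))
    rw [← sub_eq_zero, ← integral_sub (i1 j k) (i1 k j)] at this
    rw [← this]
    exact setIntegral_congr_fun hΩ.measurableSet fun z hz => by
      simp only [V1 _ z hz]; ring
  · intro w hw hwc hws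
    have hw' : IsC2Test n Ω (fun z => (starRingEnd ℂ) (w z)) :=
      ⟨Complex.conjCLE.contDiff.comp hw, hwc.comp_left (map_zero _),
        (closure_mono (Function.support_comp_subset (map_zero _) w)).trans hws⟩
    have key := proj _ (gN _ hw')
    rw [pcomp, inner_toL2Form] at key
    have cw : ∀ j z, (starRingEnd ℂ) (dbarCoord n (fun z => (starRingEnd ℂ) (w z)) j z) =
        dzCoord n w j z := fun j z => by rw [dbarCoord_conj, Complex.conj_conj]
    have il : ∀ j, Integrable (fun z => V j z * dzCoord n w j z / c z) := fun j => by
      have := integrable_mul_of_hasCompactSupport (V2 j) (continuous_mul_of_tsupport_subset hΩ cI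
        (hw.dzCoord (k := 0) (by norm_num) j).continuous
        ((tsupport_dzCoord_subset j).trans hws)) (hwc.dzCoord j).mul_left
      refine this.congr (Eventually.of_forall fun z => ?_)
      simp only [div_eq_mul_inv]; ring
    rw [integral_finsetSum _ fun j _ => il j]
    have e1 : ∀ j, ∫ z, V j z * dzCoord n w j z / c z = ∫ z in Ω, (starRingEnd ℂ) ((c z : ℂ)⁻¹ *
        dbarCoord n (fun z => (starRingEnd ℂ) (w z)) j z) * Q j z := fun j => by
      rw [← setIntegral_eq_integral_of_forall_compl_eq_zero (s := Ω)
        fun z hz => by rw [V0 j z hz]; simp]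
      refine setIntegral_congr_fun hΩ.measurableSet fun z hz => ?_
      simp only [V1 _ z hz, map_mul, cw, map_inv₀, Complex.conj_ofReal, div_eq_mul_inv]
      ring
    have e2 : ∀ j, ∫ z in Ω, (starRingEnd ℂ) ((c z : ℂ)⁻¹ *
        dbarCoord n (fun z => (starRingEnd ℂ) (w z)) j z) * (c z * h j z) =
        -∫ z, dzCoord n (h j) j z * w z := fun j => by
      rw [← setIntegral_eq_integral_of_forall_compl_eq_zero (s := Ω) (μ := volume)
        (f := fun z => dzCoord n (h j) j z * w z)
        fun z hz => by rw [image_eq_zero_of_notMem_tsupport fun h => hz (hws h), mul_zero]]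
      have := integral_dzCoord_eq_zero ((hh2 j).contDiff.mul hw |>.of_le (by norm_num))
        (hwc.mul_left (f := h j)) j
      have i1 : Integrable (fun z => h j z * dzCoord n w j z) :=
        ((hh2 j).contDiff.continuous.mul (hw.dzCoord (k := 0) (by norm_num) j).continuous
          ).integrable_of_hasCompactSupport (hwc.dzCoord j).mul_left
      have i2 : Integrable (fun z => dzCoord n (h j) j z * w z) :=
        ((dcj j).mul hw.continuous).integrable_of_hasCompactSupport hwc.mul_left
      have e : ∀ z, dzCoord n (fun x => h j x * w x) j z =
          h j z * dzCoord n w j z + dzCoord n (h j) j z * w z := fun z =>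
        dzCoord_mul ((hh2 j).contDiff.differentiable (by norm_num) z)
          (hw.differentiable (by norm_num) z) j
      have e' : ∫ z, (h j z * dzCoord n w j z + dzCoord n (h j) j z * w z) = 0 := by
        rw [← this]
        exact integral_congr_ae (Eventually.of_forall fun z => (e z).symm)
      rw [integral_add i1 i2, ← setIntegral_eq_integral_of_forall_compl_eq_zero (s := Ω)
        (f := fun z => h j z * dzCoord n w j z) fun z hz => by
          rw [image_eq_zero_of_notMem_tsupport fun h' => hz ((hh j).2.2 h'), zero_mul],
        ← setIntegral_eq_integral_of_forall_compl_eq_zero (s := Ω) (μ := volume)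
        (f := fun z => dzCoord n (h j) j z * w z)
        fun z hz => by
          rw [image_eq_zero_of_notMem_tsupport fun h => hz (hws h), mul_zero]] at e'
      rw [← eq_neg_of_add_eq_zero_left e']
      refine setIntegral_congr_fun hΩ.measurableSet fun z hz => ?_
      have := c0 z hz
      simp only [map_mul, cw, map_inv₀, Complex.conj_ofReal]
      field_simp
    simp_rw [e1, ← key, e2]
    rw [Finset.sum_neg_distrib]
    congr 1
    simp only [hd, Finset.sum_mul]
    have il' : ∀ j, Integrable (fun z => dzCoord n (h j) j z * w z) := fun j =>
      ((dcj j).mul hw.continuous).integrable_of_hasCompactSupport hwc.mul_left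
    rw [integral_finsetSum _ fun j _ => il' j]

end Pairing

section HessianCalculus

open Filter Topology
open scoped ContDiff

variable {n : ℕ}

lemma ContDiffAt.differentiableAt_fderiv {f : (Fin n → ℂ) → ℝ} {z : Fin n → ℂ}
    (hf : ContDiffAt ℝ 2 f z) : DifferentiableAt ℝ (fderiv ℝ f) z :=
  (hf.fderiv_right (m := 1) (by norm_num)).differentiableAt (by norm_num)

lemma hessC_eq_fderiv (f : (Fin n → ℂ) → ℝ) (z ξ : Fin n → ℂ) :
    hessC n f z ξ = (1 / 4) * (fderiv ℝ (fderiv ℝ f) z ξ ξ +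
      fderiv ℝ (fderiv ℝ f) z (I • ξ) (I • ξ)) := by
  simp only [hessC, iteratedFDeriv_two_pair]

lemma normSq_delPair (f : (Fin n → ℂ) → ℝ) (z ξ : Fin n → ℂ) :
    normSq (delPair n f z ξ) = (1 / 4) * (fderiv ℝ f z ξ ^ 2 + fderiv ℝ f z (I • ξ) ^ 2) := by
  simp [delPair, normSq_apply]
  ring

lemma fderiv_comp_real {f : (Fin n → ℂ) → ℝ} {z : Fin n → ℂ} {κ : ℝ → ℝ} {κ₁ : ℝ}
    (hf : DifferentiableAt ℝ f z) (h1 : HasDerivAt κ κ₁ (f z)) :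
    fderiv ℝ (fun y => κ (f y)) z = κ₁ • fderiv ℝ f z :=
  (h1.comp_hasFDerivAt z hf.hasFDerivAt).fderiv

lemma delPair_comp {f : (Fin n → ℂ) → ℝ} {z : Fin n → ℂ} {κ : ℝ → ℝ} {κ₁ : ℝ}
    (hf : DifferentiableAt ℝ f z) (h1 : HasDerivAt κ κ₁ (f z)) (ξ : Fin n → ℂ) :
    delPair n (fun y => κ (f y)) z ξ = κ₁ * delPair n f z ξ := by
  simp only [delPair, fderiv_comp_real hf h1, smul_apply, smul_eq_mul]
  push_cast; ring

lemma dzCoord_comp {f : (Fin n → ℂ) → ℝ} {z : Fin n → ℂ} {κ : ℝ → ℝ} {κ₁ : ℝ}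
    (hf : DifferentiableAt ℝ f z) (h1 : HasDerivAt κ κ₁ (f z)) (j : Fin n) :
    dzCoord n (fun y => (κ (f y) : ℂ)) j z = κ₁ * dzCoord n (fun y => (f y : ℂ)) j z := by
  simp only [dzCoord, fderiv_ofReal_comp (fun y => κ (f y)), fderiv_ofReal_comp f,
    fderiv_comp_real hf h1, smul_apply, smul_eq_mul]
  push_cast; ring

lemma hessC_comp {f : (Fin n → ℂ) → ℝ} {z : Fin n → ℂ} {κ κ' : ℝ → ℝ} {κ₂ : ℝ}
    (hf : ContDiffAt ℝ 2 f z) (h1 : ∀ᶠ t in 𝓝 (f z), HasDerivAt κ (κ' t) t)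
    (h2 : HasDerivAt κ' κ₂ (f z)) (ξ : Fin n → ℂ) :
    hessC n (fun y => κ (f y)) z ξ =
      κ' (f z) * hessC n f z ξ + κ₂ * normSq (delPair n f z ξ) := by
  have e : fderiv ℝ (fun y => κ (f y)) =ᶠ[𝓝 z] fun y => κ' (f y) • fderiv ℝ f y := by
    filter_upwards [hf.continuousAt.eventually h1, hf.eventually (by simp)] with y hy hy'
    exact fderiv_comp_real (hy'.differentiableAt (by norm_num)) hy
  have d : ∀ v w, fderiv ℝ (fderiv ℝ (fun y => κ (f y))) z v w =
      κ' (f z) * fderiv ℝ (fderiv ℝ f) z v w + κ₂ * (fderiv ℝ f z v * fderiv ℝ f z w) := by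
    intro v w
    have h3 : HasFDerivAt (fun y => κ' (f y)) (κ₂ • fderiv ℝ f z) z :=
      h2.comp_hasFDerivAt z (hf.differentiableAt (by norm_num)).hasFDerivAt
    rw [e.fderiv_eq, fderiv_fun_smul h3.differentiableAt hf.differentiableAt_fderiv, h3.fderiv]
    simp
    ring
  rw [hessC_eq_fderiv, hessC_eq_fderiv, normSq_delPair, d, d]
  ring

lemma hessC_add {f g : (Fin n → ℂ) → ℝ} {z : Fin n → ℂ} (hf : ContDiffAt ℝ 2 f z)
    (hg : ContDiffAt ℝ 2 g z) (ξ : Fin n → ℂ) :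
    hessC n (fun y => f y + g y) z ξ = hessC n f z ξ + hessC n g z ξ := by
  have e : fderiv ℝ (fun y => f y + g y) =ᶠ[𝓝 z] fun y => fderiv ℝ f y + fderiv ℝ g y := by
    filter_upwards [hf.eventually (by simp), hg.eventually (by simp)] with y h1 h2
    exact fderiv_fun_add (h1.differentiableAt (by norm_num)) (h2.differentiableAt (by norm_num))
  rw [hessC_eq_fderiv, hessC_eq_fderiv, hessC_eq_fderiv, e.fderiv_eq,
    fderiv_fun_add hf.differentiableAt_fderiv hg.differentiableAt_fderiv]
  simp only [add_apply]
  ring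

lemma hessC_const_mul {f : (Fin n → ℂ) → ℝ} {z : Fin n → ℂ} (hf : ContDiffAt ℝ 2 f z) (a : ℝ)
    (ξ : Fin n → ℂ) : hessC n (fun y => a * f y) z ξ = a * hessC n f z ξ := by
  have := hessC_comp (κ := fun t => a * t) (κ' := fun _ => a) (κ₂ := 0) hf
    (Eventually.of_forall fun t => by simpa using (hasDerivAt_id t).const_mul a)
    (hasDerivAt_const _ _) ξ
  simpa using this

lemma contDiff_enormSq : ContDiff ℝ (⊤ : ℕ∞) (enormSq n) := by
  have : enormSq n = fun z => ∑ j, ((z j).re * (z j).re + (z j).im * (z j).im) := by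
    ext z; simp [enormSq, normSq_apply]
  rw [this]
  refine ContDiff.sum fun j _ => ?_
  have h1 : ContDiff ℝ (⊤ : ℕ∞) fun z : Fin n → ℂ => (z j).re :=
    Complex.reCLM.contDiff.comp (contDiff_apply ℝ ℂ j)
  have h2 : ContDiff ℝ (⊤ : ℕ∞) fun z : Fin n → ℂ => (z j).im :=
    Complex.imCLM.contDiff.comp (contDiff_apply ℝ ℂ j)
  exact (h1.mul h1).add (h2.mul h2)

lemma hessC_enormSq (z ξ : Fin n → ℂ) : hessC n (enormSq n) z ξ = enormSq n ξ := by
  let R : Fin n → (Fin n → ℂ) →L[ℝ] ℝ := fun j =>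
    Complex.reCLM.comp (ContinuousLinearMap.proj (R := ℝ) (φ := fun _ : Fin n => ℂ) j)
  let J : Fin n → (Fin n → ℂ) →L[ℝ] ℝ := fun j =>
    Complex.imCLM.comp (ContinuousLinearMap.proj (R := ℝ) (φ := fun _ : Fin n => ℂ) j)
  have e : enormSq n = fun z => ∑ j, (R j z * R j z + J j z * J j z) := by
    ext z; simp [enormSq, normSq_apply, R, J]
  have d1 : ∀ y, fderiv ℝ (enormSq n) y =
      (∑ j, ((2 : ℝ) • (R j).smulRight (R j) + (2 : ℝ) • (J j).smulRight (J j))) y := by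
    intro y
    have : HasFDerivAt (enormSq n) (∑ j, ((R j y • R j + R j y • R j) +
        (J j y • J j + J j y • J j))) y := by
      rw [e]
      exact HasFDerivAt.fun_sum fun j _ => (((R j).hasFDerivAt.mul (R j).hasFDerivAt).add
        ((J j).hasFDerivAt.mul (J j).hasFDerivAt))
    rw [this.fderiv]
    ext w
    simp [two_mul]
  have d2 : fderiv ℝ (enormSq n) =
      ⇑(∑ j, ((2 : ℝ) • (R j).smulRight (R j) + (2 : ℝ) • (J j).smulRight (J j))) := by
    ext1 y; exact d1 y
  rw [hessC_eq_fderiv, d2, ContinuousLinearMap.fderiv]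
  simp only [sum_apply, add_apply, smul_apply, ContinuousLinearMap.smulRight_apply, smul_eq_mul,
    enormSq, R, J, ContinuousLinearMap.comp_apply, ContinuousLinearMap.proj_apply,
    Complex.reCLM_apply, Complex.imCLM_apply, Pi.smul_apply, normSq_apply, ← Finset.sum_add_distrib,
    Finset.mul_sum]
  refine Finset.sum_congr rfl fun j _ => ?_
  simp
  ring

end HessianCalculus

section BoundaryGeometry

open Filter Topology

variable {n : ℕ}

lemma delPair_smul (f : (Fin n → ℂ) → ℝ) (z ξ : Fin n → ℂ) (a : ℂ) :
    delPair n f z (a • ξ) = a * delPair n f z ξ := by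
  simp only [delPair_eq_sum, Finset.mul_sum, Pi.smul_apply, smul_eq_mul, mul_assoc]

lemma delPair_sub (f : (Fin n → ℂ) → ℝ) (z ξ η : Fin n → ℂ) :
    delPair n f z (ξ - η) = delPair n f z ξ - delPair n f z η := by
  simp only [delPair_eq_sum, ← Finset.sum_sub_distrib, Pi.sub_apply, sub_mul]

lemma delPair_re (f : (Fin n → ℂ) → ℝ) (z ξ : Fin n → ℂ) :
    (delPair n f z ξ).re = fderiv ℝ f z ξ / 2 := by
  simp [delPair]; ring

lemma norm_I_smul (ξ : Fin n → ℂ) : ‖I • ξ‖ = ‖ξ‖ := by rw [norm_smul]; simp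

lemma norm_half_sub_I_mul_le (L : (Fin n → ℂ) →L[ℝ] ℝ) (ξ : Fin n → ℂ) :
    ‖(1 / 2 : ℂ) * ((L ξ : ℂ) - I * (L (I • ξ) : ℂ))‖ ≤ ‖L‖ * ‖ξ‖ := by
  have h1 := L.le_opNorm ξ
  have h2 := L.le_opNorm (I • ξ)
  rw [norm_I_smul] at h2
  have h3 := norm_sub_le (L ξ : ℂ) (I * (L (I • ξ) : ℂ))
  simp only [norm_mul, Complex.norm_I, Complex.norm_real, one_mul] at h3
  rw [norm_mul]
  norm_num
  linarith

lemma norm_delPair_le (f : (Fin n → ℂ) → ℝ) (z ξ : Fin n → ℂ) :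
    ‖delPair n f z ξ‖ ≤ ‖fderiv ℝ f z‖ * ‖ξ‖ :=
  norm_half_sub_I_mul_le _ _

lemma norm_delPair_sub_le (f : (Fin n → ℂ) → ℝ) (z q ξ : Fin n → ℂ) :
    ‖delPair n f z ξ - delPair n f q ξ‖ ≤ ‖fderiv ℝ f z - fderiv ℝ f q‖ * ‖ξ‖ := by
  refine le_trans (le_of_eq ?_) (norm_half_sub_I_mul_le (fderiv ℝ f z - fderiv ℝ f q) ξ)
  congr 1
  simp only [delPair, sub_apply]
  push_cast; ring

lemma norm_sq_le_enormSq (ξ : Fin n → ℂ) : ‖ξ‖ ^ 2 ≤ enormSq n ξ := by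
  have h : ‖ξ‖ ≤ √(enormSq n ξ) := by
    refine (pi_norm_le_iff_of_nonneg (Real.sqrt_nonneg _)).2 fun j => ?_
    refine Real.le_sqrt_of_sq_le ?_
    rw [← normSq_eq_norm_sq]
    exact normSq_le_enormSq ξ j
  calc ‖ξ‖ ^ 2 ≤ √(enormSq n ξ) ^ 2 := by gcongr
    _ = _ := Real.sq_sqrt (enormSq_nonneg ξ)

lemma abs_bilin_sub_le {E : Type*} [NormedAddCommGroup E] [NormedSpace ℝ E]
    (b : E →L[ℝ] E →L[ℝ] ℝ) (x y : E) :
    |b x x - b y y| ≤ ‖b‖ * ‖x - y‖ * (‖x‖ + ‖y‖) := by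
  have e : b x x - b y y = b (x - y) x + b y (x - y) := by simp
  rw [e]
  have h1 := b.le_opNorm₂ (x - y) x
  have h2 := b.le_opNorm₂ y (x - y)
  rw [Real.norm_eq_abs] at h1 h2
  refine (abs_add_le _ _).trans ?_
  linarith

lemma abs_hessC_sub_le (f : (Fin n → ℂ) → ℝ) (z ξ η : Fin n → ℂ) :
    |hessC n f z ξ - hessC n f z η| ≤
      ‖fderiv ℝ (fderiv ℝ f) z‖ * ‖ξ - η‖ * (‖ξ‖ + ‖η‖) := by
  rw [hessC_eq_fderiv, hessC_eq_fderiv]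
  have h1 := abs_bilin_sub_le (fderiv ℝ (fderiv ℝ f) z) ξ η
  have h2 := abs_bilin_sub_le (fderiv ℝ (fderiv ℝ f) z) (I • ξ) (I • η)
  rw [← smul_sub, norm_I_smul, norm_I_smul, norm_I_smul] at h2
  rw [abs_le] at *
  constructor <;> linarith [h1.1, h1.2, h2.1, h2.2]

lemma abs_hessC_sub_le' (f : (Fin n → ℂ) → ℝ) (z q ξ : Fin n → ℂ) :
    |hessC n f z ξ - hessC n f q ξ| ≤
      ‖fderiv ℝ (fderiv ℝ f) z - fderiv ℝ (fderiv ℝ f) q‖ * ‖ξ‖ ^ 2 := by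
  rw [hessC_eq_fderiv, hessC_eq_fderiv]
  have h1 := (fderiv ℝ (fderiv ℝ f) z - fderiv ℝ (fderiv ℝ f) q).le_opNorm₂ ξ ξ
  have h2 := (fderiv ℝ (fderiv ℝ f) z - fderiv ℝ (fderiv ℝ f) q).le_opNorm₂ (I • ξ) (I • ξ)
  rw [norm_I_smul] at h2
  simp only [sub_apply, Real.norm_eq_abs] at h1 h2
  rw [abs_le] at *
  constructor <;> nlinarith [h1.1, h1.2, h2.1, h2.2]

lemma abs_hessC_le (f : (Fin n → ℂ) → ℝ) (z ξ : Fin n → ℂ) :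
    |hessC n f z ξ| ≤ ‖fderiv ℝ (fderiv ℝ f) z‖ * ‖ξ‖ ^ 2 := by
  have h := abs_hessC_sub_le f z ξ 0
  have h0 : hessC n f z 0 = 0 := by simp [hessC_eq_fderiv]
  simp only [h0, sub_zero, norm_zero, add_zero] at h
  linarith

/-- A descent to the zero set along a direction in which the function increases. -/
lemma exists_zero_along {r : (Fin n → ℂ) → ℝ} (hr : ContDiff ℝ 1 r) {z v : Fin n → ℂ}
    (hz : r z < 0) (hd : ∀ t ∈ Icc 0 (-r z), 1 ≤ fderiv ℝ r (z + t • v) v) :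
    ∃ t ∈ Icc 0 (-r z), r (z + t • v) = 0 := by
  set g : ℝ → ℝ := fun t => r (z + t • v)
  have hg : ∀ t, HasDerivAt g (fderiv ℝ r (z + t • v) v) t := by
    intro t
    have h1 : HasDerivAt (fun t : ℝ => z + t • v) v t := by
      simpa using ((hasDerivAt_id t).smul_const v).const_add z
    exact ((hr.differentiable (by norm_num)) (z + t • v)).hasFDerivAt.comp_hasDerivAt t h1
  have hc : Continuous g := continuous_iff_continuousAt.2 fun t => (hg t).continuousAt
  have h := (convex_Icc (0 : ℝ) (-r z)).mul_sub_le_image_sub_of_le_deriv hc.continuousOn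
    (fun t _ => (hg t).differentiableAt.differentiableWithinAt) (C := 1)
    (fun t ht => by rw [(hg t).deriv]; exact hd t (interior_subset ht))
    0 (left_mem_Icc.2 (by linarith)) (-r z) (right_mem_Icc.2 (by linarith)) (by linarith)
  have g0 : g 0 = r z := by simp [g]
  have hmem : (0 : ℝ) ∈ Icc (g 0) (g (-r z)) := by
    rw [g0] at h ⊢
    exact ⟨hz.le, by linarith⟩
  obtain ⟨t, ht, h0⟩ := intermediate_value_Icc (by linarith : (0 : ℝ) ≤ -r z) hc.continuousOn hmem
  exact ⟨t, ht, h0⟩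

end BoundaryGeometry

section LeviLowerBound

open Filter Topology

variable {n : ℕ} {r : (Fin n → ℂ) → ℝ}

lemma hessC_ge_of_zero {z q v : Fin n → ℂ} {K M V ρ : ℝ} (hM : 0 ≤ M)
    (hq : r q = 0)
    (hlevi : ∀ p, r p = 0 → ∀ ξ, delPair n r p ξ = 0 → 0 ≤ hessC n r p ξ)
    (hD : ‖fderiv ℝ r z - fderiv ℝ r q‖ ≤ K * ρ)
    (hb : ‖fderiv ℝ (fderiv ℝ r) z - fderiv ℝ (fderiv ℝ r) q‖ ≤ K * ρ)
    (hDq : ‖fderiv ℝ r q‖ ≤ M) (hbq : ‖fderiv ℝ (fderiv ℝ r) q‖ ≤ M)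
    (hv : ‖v‖ ≤ V) (hvq : 1 / 2 ≤ ‖delPair n r q v‖) (ξ : Fin n → ℂ) :
    -(K * ρ * ‖ξ‖ ^ 2 + M * (2 * (‖delPair n r z ξ‖ + K * ρ * ‖ξ‖) * V) *
      ((2 + 2 * M * V) * ‖ξ‖)) ≤ hessC n r z ξ := by
  have hvpos : 0 < ‖delPair n r q v‖ := by linarith
  have hv0 : delPair n r q v ≠ 0 := norm_pos_iff.1 hvpos
  set a := delPair n r q ξ / delPair n r q v with ha
  set ξ' := ξ - a • v with hξ'
  have hx := norm_nonneg ξ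
  have ht : delPair n r q ξ' = 0 := by
    rw [hξ', delPair_sub, delPair_smul, ha, div_mul_cancel₀ _ hv0, sub_self]
  have h0 := hlevi q hq ξ' ht
  have hna : ‖a‖ ≤ 2 * ‖delPair n r q ξ‖ := by
    rw [ha, norm_div, div_le_iff₀ hvpos]
    nlinarith [norm_nonneg (delPair n r q ξ)]
  have h1 : ‖delPair n r q ξ‖ ≤ ‖delPair n r z ξ‖ + K * ρ * ‖ξ‖ := by
    have h2 := norm_delPair_sub_le r z q ξ
    have h3 := norm_sub_norm_le (delPair n r q ξ) (delPair n r z ξ)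
    rw [norm_sub_rev] at h3
    nlinarith [mul_le_mul_of_nonneg_right hD hx]
  have h2 : ‖delPair n r q ξ‖ ≤ M * ‖ξ‖ :=
    (norm_delPair_le r q ξ).trans (mul_le_mul_of_nonneg_right hDq hx)
  have hav : ‖ξ - ξ'‖ = ‖a‖ * ‖v‖ := by rw [hξ', sub_sub_cancel, norm_smul]
  have h3 : ‖ξ - ξ'‖ ≤ 2 * (‖delPair n r z ξ‖ + K * ρ * ‖ξ‖) * V := by
    rw [hav]
    exact mul_le_mul (hna.trans (by linarith)) hv (norm_nonneg _)
      (by linarith [norm_nonneg (delPair n r q ξ)])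
  have h4 : ‖ξ - ξ'‖ ≤ 2 * (M * ‖ξ‖) * V := by
    rw [hav]
    exact mul_le_mul (hna.trans (by linarith)) hv (norm_nonneg _)
      (by linarith [norm_nonneg (delPair n r q ξ)])
  have h5 : ‖ξ'‖ ≤ ‖ξ‖ + ‖ξ - ξ'‖ := by
    have := norm_sub_norm_le ξ' ξ
    rw [norm_sub_rev ξ ξ']
    linarith
  have h6 : ‖ξ‖ + ‖ξ'‖ ≤ (2 + 2 * M * V) * ‖ξ‖ := by nlinarith
  have h7 := (abs_le.1 (abs_hessC_sub_le r q ξ ξ')).1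
  have h8 := (abs_le.1 (abs_hessC_sub_le' r z q ξ)).1
  have h9 : ‖fderiv ℝ (fderiv ℝ r) q‖ * ‖ξ - ξ'‖ * (‖ξ‖ + ‖ξ'‖) ≤
      M * (2 * (‖delPair n r z ξ‖ + K * ρ * ‖ξ‖) * V) * ((2 + 2 * M * V) * ‖ξ‖) := by
    refine mul_le_mul (mul_le_mul hbq h3 (norm_nonneg _) hM) h6
      (add_nonneg (norm_nonneg _) (norm_nonneg _)) (mul_nonneg hM ((norm_nonneg _).trans h3))
  have h10 := mul_le_mul_of_nonneg_right hb (sq_nonneg ‖ξ‖)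
  linarith

/-- The infinitesimal form of the plurisubharmonicity of `-log (-r) + L |z|²`. -/
def LogHessBound (n : ℕ) (r : (Fin n → ℂ) → ℝ) (L : ℝ) (z : Fin n → ℂ) : Prop :=
  ∀ ξ : Fin n → ℂ,
    0 ≤ -r z * hessC n r z ξ + normSq (delPair n r z ξ) + L * r z ^ 2 * ‖ξ‖ ^ 2

lemma LogHessBound.mono {L L' : ℝ} {z : Fin n → ℂ} (h : LogHessBound n r L z) (hL : L ≤ L') :
    LogHessBound n r L' z := fun ξ => (h ξ).trans (by gcongr)

lemma exists_logHessBound_nhds_of_neg (hr : ContDiff ℝ 2 r) {q₀ : Fin n → ℂ} (h0 : r q₀ < 0) :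
    ∃ L, ∀ᶠ z in 𝓝 q₀, LogHessBound n r L z := by
  have hb : Continuous fun z => ‖fderiv ℝ (fderiv ℝ r) z‖ :=
    ((hr.fderiv_right (m := 1) (by norm_num)).continuous_fderiv (by norm_num)).norm
  set M := ‖fderiv ℝ (fderiv ℝ r) q₀‖ + 1 with hM
  have hMpos : 0 < M := by positivity
  refine ⟨2 * M / -r q₀, ?_⟩
  filter_upwards [hb.continuousAt.eventually (gt_mem_nhds (lt_add_one _)),
    hr.continuous.continuousAt.eventually (gt_mem_nhds (by linarith : r q₀ < r q₀ / 2))]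
    with z hz1 hz2 ξ
  have h1 := (abs_le.1 (abs_hessC_le r z ξ)).1
  have h2 := mul_le_mul_of_nonneg_right hz1.le (sq_nonneg ‖ξ‖)
  have h3 : 1 ≤ 2 * -r z / -r q₀ := by rw [le_div_iff₀ (by linarith)]; linarith
  have h4 : M * ‖ξ‖ ^ 2 * (-r z) ≤ 2 * M / -r q₀ * r z ^ 2 * ‖ξ‖ ^ 2 := by
    have e : 2 * M / -r q₀ * r z ^ 2 * ‖ξ‖ ^ 2 = (M * ‖ξ‖ ^ 2 * (-r z)) * (2 * -r z / -r q₀) := by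
      ring
    rw [e]
    exact le_mul_of_one_le_right
      (mul_nonneg (mul_nonneg hMpos.le (sq_nonneg _)) (by linarith)) h3
  have h5 : -(M * ‖ξ‖ ^ 2) ≤ hessC n r z ξ := by linarith
  have h6 := mul_le_mul_of_nonneg_left h5 (by linarith : 0 ≤ -r z)
  have h7 := normSq_nonneg (delPair n r z ξ)
  linarith

set_option maxHeartbeats 1000000 in
lemma exists_logHessBound_nhds_of_eq_zero (hr : ContDiff ℝ 3 r) {q₀ : Fin n → ℂ} (h0 : r q₀ = 0)
    (hd : fderiv ℝ r q₀ ≠ 0)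
    (hlevi : ∀ p, r p = 0 → ∀ ξ, delPair n r p ξ = 0 → 0 ≤ hessC n r p ξ) :
    ∃ L, ∀ᶠ z in 𝓝 q₀, r z < 0 → LogHessBound n r L z := by
  have hr1 : ContDiff ℝ 2 (fderiv ℝ r) := hr.fderiv_right (by norm_num)
  have hr2 : ContDiff ℝ 1 (fderiv ℝ (fderiv ℝ r)) := hr1.fderiv_right (by norm_num)
  obtain ⟨v, hv⟩ : ∃ v, delPair n r q₀ v = 1 := by
    obtain ⟨w, hw⟩ : ∃ w, fderiv ℝ r q₀ w ≠ 0 := by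
      by_contra! h
      exact hd (by ext w; simp [h w])
    have hw' : delPair n r q₀ w ≠ 0 := by
      intro h
      have := delPair_re r q₀ w
      rw [h] at this
      rw [Complex.zero_re] at this
      exact hw (by linarith)
    exact ⟨(delPair n r q₀ w)⁻¹ • w, by rw [delPair_smul, inv_mul_cancel₀ hw']⟩
  have hvD : fderiv ℝ r q₀ v = 2 := by
    have := delPair_re r q₀ v
    rw [hv, Complex.one_re] at this
    linarith
  obtain ⟨K₁, t₁, ht₁, hK₁⟩ := (hr1.of_le (by norm_num) : ContDiff ℝ 1 _).contDiffAt (x := q₀)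
    |>.exists_lipschitzOnWith
  obtain ⟨K₂, t₂, ht₂, hK₂⟩ := hr2.contDiffAt (x := q₀) |>.exists_lipschitzOnWith
  set M : ℝ := max ‖fderiv ℝ r q₀‖ ‖fderiv ℝ (fderiv ℝ r) q₀‖ + 1 with hM
  have e1 : ∀ᶠ z in 𝓝 q₀, ‖fderiv ℝ r z‖ < M :=
    hr1.continuous.norm.continuousAt.eventually
      (gt_mem_nhds ((le_max_left _ _).trans_lt (lt_add_one _)))
  have e2 : ∀ᶠ z in 𝓝 q₀, ‖fderiv ℝ (fderiv ℝ r) z‖ < M :=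
    (show Continuous fun z => ‖fderiv ℝ (fderiv ℝ r) z‖ from
      (hr1.continuous_fderiv (by norm_num)).norm).continuousAt.eventually
      (gt_mem_nhds ((le_max_right _ _).trans_lt (lt_add_one _)))
  have e3 : ∀ᶠ z in 𝓝 q₀, 1 < fderiv ℝ r z v :=
    (hr1.continuous.clm_apply continuous_const).continuousAt.eventually
      (lt_mem_nhds (by change 1 < fderiv ℝ r q₀ v; rw [hvD]; norm_num))
  obtain ⟨δ, hδ, hball⟩ := Metric.eventually_nhds_iff_ball.1
    (e1.and (e2.and (e3.and (Filter.Eventually.and ht₁ ht₂))))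
  set V : ℝ := ‖v‖ + 1 with hV
  have hVpos : 0 < V := by positivity
  have hMpos : 0 < M := by positivity
  have e4 : ∀ᶠ z in 𝓝 q₀, -r z * V < δ / 2 :=
    (hr.continuous.neg.mul continuous_const).continuousAt.eventually
      (gt_mem_nhds (by change -r q₀ * V < δ / 2; rw [h0]; linarith))
  set K : ℝ := max K₁ K₂ * V with hK
  set C : ℝ := K + M * 2 * V * (2 + 2 * M * V) * (1 + K) with hC
  have hKnn : 0 ≤ K := by positivity
  refine ⟨C + C ^ 2, ?_⟩
  filter_upwards [e4, ball_mem_nhds q₀ (half_pos hδ)] with z hz4 hzb hz ξ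
  have hin : ∀ t ∈ Icc 0 (-r z), z + t • v ∈ ball q₀ δ ∧ ‖z - (z + t • v)‖ ≤ V * (-r z) := by
    intro t ht
    have h1 : ‖t • v‖ ≤ V * (-r z) := by
      rw [norm_smul, Real.norm_of_nonneg ht.1, mul_comm]
      exact mul_le_mul (by rw [hV]; linarith) ht.2 ht.1 hVpos.le
    constructor
    · rw [mem_ball, dist_eq_norm] at hzb ⊢
      have : z + t • v - q₀ = (z - q₀) + t • v := by abel
      rw [this]
      have := norm_add_le (z - q₀) (t • v)
      linarith
    · rw [sub_add_cancel_left, norm_neg]; exact h1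
  obtain ⟨t, ht, hq⟩ := exists_zero_along (hr.of_le (by norm_num)) hz
    (fun t ht => (hball _ (hin t ht).1).2.2.1.le)
  obtain ⟨hqb, hqd⟩ := hin t ht
  set q := z + t • v
  have hzb' : z ∈ ball q₀ δ := ball_subset_ball (by linarith) hzb
  obtain ⟨hq1, hq2, hq3, hq4, hq5⟩ := hball q hqb
  obtain ⟨-, -, -, hz5, hz6⟩ := hball z hzb'
  have hρ : 0 ≤ -r z := by linarith
  have hKρ : ∀ k : ℝ, k ≤ max K₁ K₂ → 0 ≤ k → k * ‖z - q‖ ≤ K * (-r z) := by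
    intro k hk hk0
    calc k * ‖z - q‖ ≤ max K₁ K₂ * (V * (-r z)) := by gcongr
      _ = K * (-r z) := by rw [hK]; ring
  have hvq : 1 / 2 ≤ ‖delPair n r q v‖ := by
    have h1 := Complex.re_le_norm (delPair n r q v)
    rw [delPair_re] at h1
    linarith
  have key := hessC_ge_of_zero (K := K) (M := M) (V := V) (ρ := -r z) hMpos.le hq hlevi
    (((hK₁.norm_sub_le hz5 hq4)).trans (hKρ _ (le_max_left _ _) K₁.coe_nonneg))
    (((hK₂.norm_sub_le hz6 hq5)).trans (hKρ _ (le_max_right _ _) K₂.coe_nonneg))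
    hq1.le hq2.le (by rw [hV]; linarith) hvq ξ
  set ρ := -r z with hρd
  have hrz : r z ^ 2 = ρ ^ 2 := by rw [hρd]; ring
  rw [hrz, normSq_eq_norm_sq]
  set p := ‖delPair n r z ξ‖
  set x := ‖ξ‖
  have hp : 0 ≤ p := norm_nonneg _
  have hx : 0 ≤ x := norm_nonneg _
  set E : ℝ := M * 2 * V * (2 + 2 * M * V) with hE
  have hEnn : 0 ≤ E := by positivity
  have hlow : -(C * ρ * x ^ 2 + C * p * x) ≤ hessC n r z ξ := by
    refine le_trans ?_ key
    have hpx : 0 ≤ p * x := mul_nonneg hp hx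
    have e : K * ρ * x ^ 2 + M * (2 * (p + K * ρ * x) * V) * ((2 + 2 * M * V) * x) =
        (K + E * K) * (ρ * x ^ 2) + E * (p * x) := by rw [hE]; ring
    rw [e, hC]
    have h1 : 0 ≤ E * (ρ * x ^ 2) := by positivity
    have h2 : 0 ≤ (K + E * K) * (p * x) := by positivity
    linarith
  have h2 := mul_le_mul_of_nonneg_left hlow hρ
  have h3 : p ^ 2 - C * ρ * p * x + (C * ρ * x) ^ 2 =
      (p - C * ρ * x / 2) ^ 2 + 3 / 4 * (C * ρ * x) ^ 2 := by ring
  have h4 : 0 ≤ (p - C * ρ * x / 2) ^ 2 + 3 / 4 * (C * ρ * x) ^ 2 := by positivity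
  linarith

lemma exists_logHessBound (hr : ContDiff ℝ 3 r) {Ω : Set (Fin n → ℂ)} (hΩ : Ω = {z | r z < 0})
    (hbd : Bornology.IsBounded Ω) (hd : ∀ z, r z = 0 → fderiv ℝ r z ≠ 0)
    (hlevi : ∀ p, r p = 0 → ∀ ξ, delPair n r p ξ = 0 → 0 ≤ hessC n r p ξ) :
    ∃ L, 0 ≤ L ∧ ∀ z ∈ Ω, LogHessBound n r L z := by
  have hcpt : IsCompact (closure Ω) := hbd.isCompact_closure
  have hle : ∀ z ∈ closure Ω, r z ≤ 0 := by
    intro z hz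
    have : closure Ω ⊆ {z | r z ≤ 0} :=
      closure_minimal (by rw [hΩ]; exact fun z (hz : r z < 0) => hz.le)
        (isClosed_le hr.continuous continuous_const)
    exact this hz
  have key : ∃ L, ∀ z ∈ closure Ω, r z < 0 → LogHessBound n r L z := by
    refine hcpt.induction_on (p := fun s => ∃ L, ∀ z ∈ s, r z < 0 → LogHessBound n r L z)
      ⟨0, by simp⟩ ?_ ?_ ?_
    · rintro s t hst ⟨L, hL⟩
      exact ⟨L, fun z hz => hL z (hst hz)⟩
    · rintro s t ⟨L₁, h₁⟩ ⟨L₂, h₂⟩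
      refine ⟨max L₁ L₂, fun z hz hz0 => ?_⟩
      rcases hz with hz | hz
      · exact (h₁ z hz hz0).mono (le_max_left _ _)
      · exact (h₂ z hz hz0).mono (le_max_right _ _)
    · intro q hq
      have : ∃ L, ∀ᶠ z in 𝓝 q, r z < 0 → LogHessBound n r L z := by
        rcases (hle q hq).lt_or_eq with h | h
        · obtain ⟨L, hL⟩ := exists_logHessBound_nhds_of_neg (hr.of_le (by norm_num)) h
          exact ⟨L, hL.mono fun z hz _ => hz⟩
        · exact exists_logHessBound_nhds_of_eq_zero hr h (hd q h) hlevi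
      obtain ⟨L, hL⟩ := this
      exact ⟨_, mem_nhdsWithin_of_mem_nhds hL, L, fun z hz => hz⟩
  obtain ⟨L, hL⟩ := key
  refine ⟨max L 0, le_max_right _ _, fun z hz => (hL z (subset_closure hz) ?_).mono (le_max_left _ _)⟩
  rw [hΩ] at hz
  exact hz

end LeviLowerBound

section Exhaustion

open Filter Topology

variable {n : ℕ} {r : (Fin n → ℂ) → ℝ} {Ω : Set (Fin n → ℂ)}

lemma isOpen_of_eq_neg (hr : Continuous r) (hΩ : Ω = {z | r z < 0}) : IsOpen Ω := by
  rw [hΩ]; exact isOpen_lt hr continuous_const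

lemma hessC_neg_log_ge {L : ℝ} (hr : ContDiff ℝ 2 r) {z : Fin n → ℂ} (hz : r z < 0)
    (hL : 0 ≤ L) (h : LogHessBound n r L z) (ξ : Fin n → ℂ) :
    -L * enormSq n ξ ≤ hessC n (fun y => -Real.log (-r y)) z ξ := by
  have h1 : ∀ t : ℝ, t < 0 → HasDerivAt (fun t => -Real.log (-t)) (-t⁻¹) t := by
    intro t ht
    refine (((hasDerivAt_neg t).log (by simpa using ht.ne)).fun_neg).congr_deriv ?_
    rw [neg_div_neg_eq, one_div]
  have h2 : HasDerivAt (fun t : ℝ => -t⁻¹) ((r z ^ 2)⁻¹) (r z) := by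
    refine ((hasDerivAt_inv hz.ne).fun_neg).congr_deriv ?_
    rw [neg_neg]
  rw [hessC_comp (κ := fun t => -Real.log (-t)) (κ' := fun t => -t⁻¹) hr.contDiffAt
    ((gt_mem_nhds hz : ∀ᶠ t in 𝓝 (r z), t < 0).mono h1) h2]
  have h3 := h ξ
  have h4 : 0 < r z ^ 2 := by have := hz.ne; positivity
  have e : -(r z)⁻¹ * hessC n r z ξ + (r z ^ 2)⁻¹ * normSq (delPair n r z ξ) =
      (-r z * hessC n r z ξ + normSq (delPair n r z ξ) + L * r z ^ 2 * ‖ξ‖ ^ 2) / r z ^ 2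
        - L * ‖ξ‖ ^ 2 := by
    have := hz.ne
    field_simp
    ring
  rw [e]
  have h5 := div_nonneg h3 h4.le
  nlinarith [norm_sq_le_enormSq ξ]

lemma exists_exhaustion (hr : ContDiff ℝ 2 r) (hΩ : Ω = {z | r z < 0}) {L : ℝ} (hL : 0 ≤ L)
    (h : ∀ z ∈ Ω, LogHessBound n r L z) {B : ℝ} (hB : 0 ≤ B) :
    ∃ s : (Fin n → ℂ) → ℝ, Measurable s ∧ ContDiffOn ℝ 2 s Ω ∧ (∀ z, 0 < s z) ∧
      (∀ z ∈ Ω, (r z ^ 2)⁻¹ ≤ s z) ∧ ∀ z ∈ Ω, ∀ ξ : Fin n → ℂ,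
        B * s z * enormSq n ξ + normSq (delPair n s z ξ) / s z ≤ hessC n s z ξ := by
  set p : (Fin n → ℂ) → ℝ := fun z => -Real.log (-r z) + (L + B / 2) * enormSq n z with hp
  have hneg : ∀ z ∈ Ω, r z < 0 := fun z hz => by rw [hΩ] at hz; exact hz
  have hlog : ∀ z ∈ Ω, ContDiffAt ℝ 2 (fun y => -Real.log (-r y)) z := fun z hz =>
    (hr.contDiffAt.neg.log (by simpa using (hneg z hz).ne)).neg
  have he : ContDiff ℝ 2 (enormSq n) :=
    contDiff_enormSq.of_le (WithTop.coe_le_coe.2 (le_top : (2 : ℕ∞) ≤ ⊤))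
  have he' : ContDiff ℝ 2 fun z => (L + B / 2) * enormSq n z := contDiff_const.mul he
  have hpd : ∀ z ∈ Ω, ContDiffAt ℝ 2 p z := fun z hz => (hlog z hz).add he'.contDiffAt
  refine ⟨fun z => Real.exp (2 * p z), ?_, ?_, fun z => Real.exp_pos _, ?_, ?_⟩
  · refine Real.measurable_exp.comp (Measurable.const_mul ?_ 2)
    exact (Real.measurable_log.comp hr.continuous.neg.measurable).neg.add he'.continuous.measurable
  · exact fun z hz => ((contDiffAt_const.mul (hpd z hz)).exp).contDiffWithinAt
  · intro z hz
    have h1 : (0 : ℝ) < -r z := by linarith [hneg z hz]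
    have e : Real.exp (2 * p z) =
        (r z ^ 2)⁻¹ * Real.exp (2 * ((L + B / 2) * enormSq n z)) := by
      have : 2 * p z = -(2 * Real.log (-r z)) + 2 * ((L + B / 2) * enormSq n z) := by
        simp only [hp]; ring
      rw [this, Real.exp_add, Real.exp_neg, two_mul (Real.log _), Real.exp_add, Real.exp_log h1]
      congr 2; ring
    change (r z ^ 2)⁻¹ ≤ Real.exp (2 * p z)
    rw [e]
    exact le_mul_of_one_le_right (by positivity) (Real.one_le_exp (by
      have := enormSq_nonneg z; positivity))
  · intro z hz ξ
    have h1 : ∀ t, HasDerivAt (fun t => Real.exp (2 * t)) (2 * Real.exp (2 * t)) t := by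
      intro t
      have := ((hasDerivAt_id t).const_mul 2).exp
      refine this.congr_deriv ?_
      simp only [id]; ring
    have h2 : HasDerivAt (fun t => 2 * Real.exp (2 * t)) (4 * Real.exp (2 * p z)) (p z) := by
      refine ((h1 (p z)).const_mul 2).congr_deriv ?_
      ring
    rw [hessC_comp (κ := fun t => Real.exp (2 * t)) (hpd z hz) (Eventually.of_forall h1) h2,
      delPair_comp (κ := fun t => Real.exp (2 * t)) ((hpd z hz).differentiableAt (by norm_num))
        (h1 (p z))]
    have h3 : B / 2 * enormSq n ξ ≤ hessC n p z ξ := by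
      rw [hp, hessC_add (hlog z hz) he'.contDiffAt, hessC_const_mul he.contDiffAt, hessC_enormSq]
      have := hessC_neg_log_ge hr (hneg z hz) hL (h z hz) ξ
      linarith
    have hs := Real.exp_pos (2 * p z)
    set S := Real.exp (2 * p z)
    have e : normSq (((2 * S : ℝ) : ℂ) * delPair n p z ξ) / S =
        4 * S * normSq (delPair n p z ξ) := by
      rw [normSq_mul, normSq_ofReal]; field_simp; ring
    rw [e]
    nlinarith

end Exhaustion

section Cutoffs

open Filter Topology

variable {n : ℕ} {r : (Fin n → ℂ) → ℝ} {Ω : Set (Fin n → ℂ)}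

lemma deriv_smoothTransition_eq_zero_of_lt {x : ℝ} (hx : x < 0) :
    deriv Real.smoothTransition x = 0 := by
  have : Real.smoothTransition =ᶠ[𝓝 x] fun _ => 0 :=
    (gt_mem_nhds hx : ∀ᶠ t in 𝓝 x, t < 0).mono fun t ht =>
      Real.smoothTransition.zero_of_nonpos ht.le
  rw [this.deriv_eq, deriv_const]

lemma deriv_smoothTransition_eq_zero_of_gt {x : ℝ} (hx : 1 < x) :
    deriv Real.smoothTransition x = 0 := by
  have : Real.smoothTransition =ᶠ[𝓝 x] fun _ => 1 :=
    (lt_mem_nhds hx : ∀ᶠ t in 𝓝 x, 1 < t).mono fun t ht =>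
      Real.smoothTransition.one_of_one_le ht.le
  rw [this.deriv_eq, deriv_const]

lemma exists_deriv_smoothTransition_bound :
    ∃ K, 0 ≤ K ∧ ∀ x, |deriv Real.smoothTransition x| ≤ K := by
  have hc : Continuous (deriv Real.smoothTransition) :=
    (Real.smoothTransition.contDiff (n := 1)).continuous_deriv (by norm_num)
  obtain ⟨K, hK⟩ := (isCompact_Icc (a := (0 : ℝ)) (b := 1)).exists_bound_of_continuousOn
    hc.continuousOn
  refine ⟨max K 0, le_max_right _ _, fun x => ?_⟩
  rcases lt_or_ge x 0 with h | h
  · simp [deriv_smoothTransition_eq_zero_of_lt h]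
  rcases lt_or_ge 1 x with h' | h'
  · simp [deriv_smoothTransition_eq_zero_of_gt h']
  · exact (hK x ⟨h, h'⟩).trans (le_max_left _ _)

lemma exists_cutoffSeq (hr : ContDiff ℝ 2 r) (hΩ : Ω = {z | r z < 0})
    (hbd : Bornology.IsBounded Ω) {σ : (Fin n → ℂ) → ℝ} {D : ℝ}
    (hσ : ∀ z ∈ Ω, (r z ^ 2)⁻¹ ≤ D * σ z) : ∃ C η, CutoffSeq n Ω σ C η := by
  obtain ⟨K, hK0, hK⟩ := exists_deriv_smoothTransition_bound
  have hneg : ∀ z ∈ Ω, r z < 0 := fun z hz => by rw [hΩ] at hz; exact hz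
  have hdz : ∀ j, Continuous (dzCoord n (fun x => (r x : ℂ)) j) := fun j =>
    (ContDiff.dzCoord (m := 2) (k := 1) (Complex.ofRealCLM.contDiff.comp hr)
      (by norm_num) j).continuous
  obtain ⟨G, hG⟩ := hbd.isCompact_closure.exists_bound_of_continuousOn
    (f := fun z => ∑ j, normSq (dzCoord n (fun x => (r x : ℂ)) j z))
    (continuous_finsetSum _ fun j _ => Complex.continuous_normSq.comp (hdz j)).continuousOn
  have hG' : ∀ z ∈ Ω, ∀ j, normSq (dzCoord n (fun x => (r x : ℂ)) j z) ≤ G := fun z hz j =>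
    (Finset.single_le_sum (f := fun j => normSq (dzCoord n (fun x => (r x : ℂ)) j z))
      (fun _ _ => normSq_nonneg _) (Finset.mem_univ j)).trans
      ((le_abs_self _).trans (hG z (subset_closure hz)))
  have hsupp : ∀ m : ℕ, tsupport (fun z => Real.smoothTransition (-((m : ℝ) + 1) * r z - 1)) ⊆
      {z | r z ≤ -(1 / ((m : ℝ) + 1))} := by
    intro m
    refine closure_minimal ?_ (isClosed_le hr.continuous continuous_const)
    intro z hz
    by_contra h
    apply hz
    refine Real.smoothTransition.zero_of_nonpos ?_
    have hm : (0 : ℝ) < m + 1 := by positivity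
    have h : -(1 / ((m : ℝ) + 1)) < r z := not_le.1 h
    have := mul_lt_mul_of_pos_left h hm
    have e : ((m : ℝ) + 1) * -(1 / ((m : ℝ) + 1)) = -1 := by field_simp
    rw [e] at this
    linarith
  have hsub : ∀ m : ℕ, {z | r z ≤ -(1 / ((m : ℝ) + 1))} ⊆ Ω := by
    intro m z hz
    rw [hΩ]
    have hm : (0 : ℝ) < 1 / (m + 1) := by positivity
    have hz : r z ≤ -(1 / ((m : ℝ) + 1)) := hz
    change r z < 0
    linarith
  refine ⟨4 * K ^ 2 * G * D, fun m z => Real.smoothTransition (-((m : ℝ) + 1) * r z - 1),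
    ⟨?_, ?_, fun m => (hsupp m).trans (hsub m), fun m z => Real.smoothTransition.nonneg _,
      fun m z => Real.smoothTransition.le_one _, ?_, ?_⟩⟩
  · intro m
    exact (Real.smoothTransition.contDiff (n := 2)).comp
      ((contDiff_const.mul hr).sub contDiff_const)
  · intro m
    refine HasCompactSupport.of_support_subset_isCompact (hbd.isCompact_closure) ?_
    exact (subset_tsupport _).trans (((hsupp m).trans (hsub m)).trans subset_closure)
  · intro m z hz j
    have h1 : HasDerivAt (fun t => Real.smoothTransition (-((m : ℝ) + 1) * t - 1))
        (deriv Real.smoothTransition (-((m : ℝ) + 1) * r z - 1) * -((m : ℝ) + 1)) (r z) := by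
      have h2 : HasDerivAt (fun t : ℝ => -((m : ℝ) + 1) * t - 1) (-((m : ℝ) + 1)) (r z) := by
        simpa using ((hasDerivAt_id (r z)).const_mul (-((m : ℝ) + 1))).sub_const 1
      exact HasDerivAt.comp (r z)
        ((Real.smoothTransition.contDiff (n := 1)).differentiable (by norm_num) _).hasDerivAt h2
    rw [dzCoord_comp (κ := fun t => Real.smoothTransition (-((m : ℝ) + 1) * t - 1))
      (hr.differentiable (by norm_num) z) h1, normSq_mul, normSq_ofReal]
    set T := deriv Real.smoothTransition (-((m : ℝ) + 1) * r z - 1) with hT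
    have hrz := hneg z hz
    have hr2 : 0 < r z ^ 2 := by have := hrz.ne; positivity
    have h3 : (T * -((m : ℝ) + 1)) * (T * -((m : ℝ) + 1)) ≤ 4 * K ^ 2 * (r z ^ 2)⁻¹ := by
      rcases lt_or_ge 1 (-((m : ℝ) + 1) * r z - 1) with h | h
      · rw [hT, deriv_smoothTransition_eq_zero_of_gt h]; simp; positivity
      · have h4 : ((m : ℝ) + 1) * (-r z) ≤ 2 := by linarith
        have h5 : 0 ≤ ((m : ℝ) + 1) * (-r z) := mul_nonneg (by positivity) (by linarith)
        rw [← div_eq_mul_inv, le_div_iff₀ hr2]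
        have e : T * -((m : ℝ) + 1) * (T * -((m : ℝ) + 1)) * r z ^ 2 =
          |T| ^ 2 * (((m : ℝ) + 1) * (-r z)) ^ 2 := by rw [sq_abs]; ring
        rw [e]
        calc |T| ^ 2 * (((m : ℝ) + 1) * (-r z)) ^ 2 ≤ K ^ 2 * 2 ^ 2 := by
              gcongr; exact hK _
          _ = 4 * K ^ 2 := by ring
    calc _ ≤ (4 * K ^ 2 * (r z ^ 2)⁻¹) * G :=
          mul_le_mul h3 (hG' z hz j) (normSq_nonneg _) (by positivity)
      _ = 4 * K ^ 2 * G * (r z ^ 2)⁻¹ := by ring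
      _ ≤ 4 * K ^ 2 * G * (D * σ z) := by
          have : 0 ≤ G := (normSq_nonneg _).trans (hG' z hz j)
          gcongr; exact hσ z hz
      _ = _ := by ring
  · intro z hz
    have hrz := hneg z hz
    obtain ⟨m₀, hm₀⟩ := exists_nat_gt (4 / -r z)
    filter_upwards [eventually_ge_atTop m₀] with m hm
    have h1 : r z < r z / 2 := by linarith
    filter_upwards [hr.continuous.continuousAt.eventually (gt_mem_nhds h1)] with y hy
    refine Real.smoothTransition.one_of_one_le ?_
    rw [div_lt_iff₀ (by linarith)] at hm₀
    have h2 : (m₀ : ℝ) ≤ m := by exact_mod_cast hm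
    have h3 : 4 ≤ (m : ℝ) * -r z := by nlinarith
    have h4 : (0 : ℝ) ≤ m := by positivity
    nlinarith

end Cutoffs

section KeyInequality

open Filter Topology

variable {n : ℕ} {Ω : Set (Fin n → ℂ)} {φ s : (Fin n → ℂ) → ℝ}

lemma continuousOn_dzCoord_ofReal {f : (Fin n → ℂ) → ℝ} (hΩ : IsOpen Ω) (hf : ContDiffOn ℝ 2 f Ω)
    (j : Fin n) : ContinuousOn (dzCoord n (fun x => (f x : ℂ)) j) Ω := by
  have h1 : ContinuousOn (fderiv ℝ f) Ω := hf.continuousOn_fderiv_of_isOpen hΩ (by norm_num)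
  have h2 : ∀ v, ContinuousOn (fun z => (fderiv ℝ f z v : ℂ)) Ω := fun v =>
    Complex.continuous_ofReal.comp_continuousOn (h1.clm_apply continuousOn_const)
  have e : dzCoord n (fun x => (f x : ℂ)) j = fun z => (1 / 2 : ℂ) *
      ((fderiv ℝ f z (Pi.single j 1) : ℂ) - I * (fderiv ℝ f z (Pi.single j I) : ℂ)) := by
    ext z; simp only [dzCoord, fderiv_ofReal_comp]
  rw [e]
  exact continuousOn_const.mul ((h2 _).sub (continuousOn_const.mul (h2 _)))

lemma dzCoord_ofReal_add {f g : (Fin n → ℂ) → ℝ} {z : Fin n → ℂ} (hf : DifferentiableAt ℝ f z)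
    (hg : DifferentiableAt ℝ g z) (j : Fin n) :
    dzCoord n (fun x => ((f x + g x : ℝ) : ℂ)) j z =
      dzCoord n (fun x => (f x : ℂ)) j z + dzCoord n (fun x => (g x : ℂ)) j z := by
  simp only [dzCoord, fderiv_ofReal_comp (fun x => f x + g x), fderiv_ofReal_comp f,
    fderiv_ofReal_comp g, fderiv_fun_add hf hg, add_apply]
  push_cast; ring

lemma weightData_of_exhaustion (hΩ : IsOpen Ω) (hφ : ContDiffOn ℝ 2 φ Ω) {B : ℝ}
    (hhess : ∀ z ∈ Ω, ∀ ξ : Fin n → ℂ, B * enormSq n ξ ≤ hessC n φ z ξ)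
    (hs : ContDiffOn ℝ 2 s Ω) (hs0 : ∀ z, 0 < s z)
    (hsh : ∀ z ∈ Ω, ∀ ξ : Fin n → ℂ,
      B * s z * enormSq n ξ + normSq (delPair n s z ξ) / s z ≤ hessC n s z ξ)
    {ε : ℝ} (hε : 0 < ε) :
    WeightData n Ω (fun z => φ z + ε * s z) (fun z => 1 + ε * s z)
      (fun z => Real.exp ((φ z + ε * s z - Real.log (1 + ε * s z)) / 2))
      (fun j z => ((ε / (1 + ε * s z) : ℝ) : ℂ) * dzCoord n (fun x => (s x : ℂ)) j z) B := by
  have hσ : ∀ z, 0 < 1 + ε * s z := fun z => by have := hs0 z; positivity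
  have hεs : ContDiffOn ℝ 2 (fun z => ε * s z) Ω := contDiffOn_const.mul hs
  have hσd : ContDiffOn ℝ 2 (fun z => 1 + ε * s z) Ω := contDiffOn_const.add hεs
  have hΦd : ContDiffOn ℝ 2 (fun z => φ z + ε * s z) Ω := hφ.add hεs
  have hld : ContDiffOn ℝ 2 (fun z => Real.log (1 + ε * s z)) Ω := hσd.log fun z _ => (hσ z).ne'
  refine ⟨hΩ, hΦd, hσd.continuousOn, ((hΦd.sub hld).div_const 2).exp, fun j => ?_,
    fun z _ => hσ z, fun z _ => Real.exp_pos _, fun z _ => ?_, fun z hz j => ?_,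
    fun z hz ξ => ?_⟩
  · exact (Complex.continuous_ofReal.comp_continuousOn
      (continuousOn_const.div hσd.continuousOn fun z _ => (hσ z).ne')).mul
      (continuousOn_dzCoord_ofReal hΩ hs j)
  · rw [sq, ← Real.exp_add, add_halves, Real.exp_sub, Real.exp_log (hσ z),
      div_mul_cancel₀ _ (hσ z).ne']
  · have hat : ∀ {f : (Fin n → ℂ) → ℝ}, ContDiffOn ℝ 2 f Ω → DifferentiableAt ℝ f z :=
      fun hf => (hf.contDiffAt (hΩ.mem_nhds hz)).differentiableAt (by norm_num)
    have h1 : HasDerivAt (fun t : ℝ => Real.exp (t / 2))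
        (Real.exp ((φ z + ε * s z - Real.log (1 + ε * s z)) / 2) * (1 / 2))
        (φ z + ε * s z - Real.log (1 + ε * s z)) :=
      ((hasDerivAt_id _).div_const 2).exp
    rw [dzCoord_comp (f := fun z => φ z + ε * s z - Real.log (1 + ε * s z))
      (hat (hΦd.sub hld)) h1]
    have h2 : HasDerivAt (fun t : ℝ => -Real.log (1 + ε * t)) (-(ε / (1 + ε * s z))) (s z) := by
      refine (((((hasDerivAt_id (s z)).const_mul ε).const_add 1).log
        (hσ z).ne').fun_neg).congr_deriv ?_
      simp
    have h3 := dzCoord_comp (hat hs) h2 j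
    have h4 : dzCoord n (fun x => ((φ x + ε * s x - Real.log (1 + ε * s x) : ℝ) : ℂ)) j z =
        dzCoord n (fun x => ((φ x + ε * s x : ℝ) : ℂ)) j z +
          dzCoord n (fun x => ((-Real.log (1 + ε * s x) : ℝ) : ℂ)) j z :=
      dzCoord_ofReal_add (hat hΦd) (hat hld.neg) j
    rw [h4, h3]
    push_cast
    ring
  · have hφz := hφ.contDiffAt (hΩ.mem_nhds hz)
    have hsz := hs.contDiffAt (hΩ.mem_nhds hz)
    rw [hessC_add hφz (hεs.contDiffAt (hΩ.mem_nhds hz)), hessC_const_mul hsz]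
    have e : ∑ j, ξ j * (((ε / (1 + ε * s z) : ℝ) : ℂ) * dzCoord n (fun x => (s x : ℂ)) j z) =
        ((ε / (1 + ε * s z) : ℝ) : ℂ) * delPair n s z ξ := by
      rw [delPair_eq_sum, Finset.mul_sum]
      exact Finset.sum_congr rfl fun j _ => by ring
    rw [e, normSq_mul, normSq_ofReal]
    have h1 := hhess z hz ξ
    have h2 := mul_le_mul_of_nonneg_left (hsh z hz ξ) hε.le
    have h3 : 2 * (ε / (1 + ε * s z) * (ε / (1 + ε * s z)) * normSq (delPair n s z ξ)) ≤
        ε * (normSq (delPair n s z ξ) / s z) := by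
      have h0 := hs0 z
      have hσz := hσ z
      have e1 : 2 * (ε / (1 + ε * s z) * (ε / (1 + ε * s z))) ≤ ε / s z := by
        rw [div_mul_div_comm, ← mul_div_assoc, div_le_div_iff₀ (by positivity) h0]
        have : 0 ≤ ε * (1 + (ε * s z) ^ 2) := by positivity
        nlinarith
      have := mul_le_mul_of_nonneg_right e1 (normSq_nonneg (delPair n s z ξ))
      calc _ = 2 * (ε / (1 + ε * s z) * (ε / (1 + ε * s z))) * normSq (delPair n s z ξ) := by ring
        _ ≤ _ := this
        _ = _ := by ring
    nlinarith

/-- A pairing of `∂̄u` with a test form is controlled by the divergence of the form. -/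
lemma pairing_le_of_bounded_weight {r : (Fin n → ℂ) → ℝ} (hr : IsLeviDefiningFn n Ω r)
    (hbd : Bornology.IsBounded Ω) (hφ : ContDiffOn ℝ 2 φ Ω) {A B : ℝ} (hB : 0 ≤ B)
    (hbdφ : ∀ z ∈ Ω, |φ z| ≤ A)
    (hhess : ∀ z ∈ Ω, ∀ ξ : Fin n → ℂ, B * enormSq n ξ ≤ hessC n φ z ξ)
    {u : (Fin n → ℂ) → ℂ} {f : Fin n → (Fin n → ℂ) → ℂ} (hu : MemLp u 2 (volume.restrict Ω))
    (hf : ∀ j, MemLp (f j) 2 (volume.restrict Ω)) (huf : DbarEq n Ω u f)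
    {h : Fin n → (Fin n → ℂ) → ℂ} (hh : ∀ j, IsTest n Ω (h j)) :
    B * ‖∑ j, ∫ z in Ω, (starRingEnd ℂ) (f j z) * h j z‖ ^ 2 ≤
      2 * Real.exp A ^ 2 * (∑ j, ∫ z in Ω, normSq (f j z)) *
        ∫ z in Ω, normSq (∑ j, dzCoord n (h j) j z) := by
  obtain ⟨hrs, hΩr, hd, hlevi⟩ := hr
  have hr2 : ContDiff ℝ 2 r := hrs.of_le (WithTop.coe_le_coe.2 (le_top : (2 : ℕ∞) ≤ ⊤))
  have hr3 : ContDiff ℝ 3 r := hrs.of_le (WithTop.coe_le_coe.2 (le_top : (3 : ℕ∞) ≤ ⊤))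
  have hΩ : IsOpen Ω := isOpen_of_eq_neg hrs.continuous hΩr
  obtain ⟨L, hL, hLb⟩ := exists_logHessBound hr3 hΩr hbd hd hlevi
  obtain ⟨s, hsm, hsd, hs0, hsr, hsh⟩ := exists_exhaustion hr2 hΩr hL hLb hB
  set d : (Fin n → ℂ) → ℂ := fun z => ∑ j, dzCoord n (h j) j z with hdd
  have hhd : ∀ j, Continuous (dzCoord n (h j) j) := fun j =>
    (ContDiff.dzCoord (m := (⊤ : ℕ∞)) (k := 1) (hh j).1
      (WithTop.coe_le_coe.2 (le_top : (2 : ℕ∞) ≤ ⊤)) j).continuous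
  have hdc : Continuous d := continuous_finsetSum _ fun j _ => hhd j
  set K : Set (Fin n → ℂ) := ⋃ j, tsupport (h j) with hK
  have hKc : IsCompact K := isCompact_iUnion fun j => (hh j).2.1
  have hKΩ : K ⊆ Ω := iUnion_subset fun j => (hh j).2.2
  have hdK : ∀ z, z ∉ K → d z = 0 := by
    intro z hz
    refine Finset.sum_eq_zero fun j _ => ?_
    exact image_eq_zero_of_notMem_tsupport fun hz' => hz (mem_iUnion.2 ⟨j,
      tsupport_dzCoord_subset j hz'⟩)
  have hdi : Integrable (fun z => normSq (d z)) :=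
    (Complex.continuous_normSq.comp hdc).integrable_of_hasCompactSupport
      (HasCompactSupport.intro hKc fun z hz => by simp [hdK z hz])
  have hset : ∫ z in Ω, normSq (d z) = ∫ z, normSq (d z) :=
    setIntegral_eq_integral_of_forall_compl_eq_zero fun z hz => by
      rw [hdK z fun hz' => hz (hKΩ hz'), map_zero]
  obtain ⟨S, hS⟩ := hKc.exists_bound_of_continuousOn (hsd.continuousOn.mono hKΩ)
  set F : ℝ := ∑ j, ∫ z in Ω, normSq (f j z) with hF
  have hF0 : 0 ≤ F := Finset.sum_nonneg fun j _ => integral_nonneg fun z => normSq_nonneg _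
  set N : ℝ := ∫ z, normSq (d z) with hN
  have hN0 : 0 ≤ N := integral_nonneg fun z => normSq_nonneg _
  have key : ∀ ε : ℝ, 0 < ε →
      B * ‖∑ j, ∫ z in Ω, (starRingEnd ℂ) (f j z) * h j z‖ ^ 2 ≤
        2 * Real.exp A ^ 2 * F * (Real.exp (ε * S) * N) := by
    intro ε hε
    have W := weightData_of_exhaustion hΩ hφ hhess hsd hs0 hsh hε
    have hσ1 : ∀ z, 1 ≤ 1 + ε * s z := fun z => by
      have := mul_pos hε (hs0 z); linarith
    obtain ⟨C, η, hη⟩ := exists_cutoffSeq hr2 hΩr hbd (σ := fun z => 1 + ε * s z) (D := ε⁻¹)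
      (fun z hz => (hsr z hz).trans (by rw [mul_add, inv_mul_cancel_left₀ hε.ne']
                                        have : 0 < ε⁻¹ := by positivity
                                        linarith))
    have hc2 : ∀ z, Real.exp ((φ z + ε * s z - Real.log (1 + ε * s z)) / 2) ^ 2 =
        Real.exp (φ z + ε * s z) / (1 + ε * s z) := fun z => by
      rw [sq, ← Real.exp_add, add_halves, Real.exp_sub, Real.exp_log (by linarith [hσ1 z])]
    have hM : ∀ z ∈ Ω, 1 ≤ Real.exp A *
        Real.exp ((φ z + ε * s z - Real.log (1 + ε * s z)) / 2) ^ 2 := by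
      intro z hz
      have h1 : 0 < 1 + ε * s z := by linarith [hσ1 z]
      rw [hc2, ← mul_div_assoc, le_div_iff₀ h1, one_mul, ← Real.exp_add]
      have h2 := (abs_le.1 (hbdφ z hz)).1
      have h3 := Real.add_one_le_exp (ε * s z)
      have h4 : Real.exp (ε * s z) ≤ Real.exp (A + (φ z + ε * s z)) :=
        Real.exp_le_exp.2 (by linarith)
      linarith
    have main := W.pairing_bound ((hsm.const_mul ε).const_add 1) hη hB hM hu hf huf hh
    have hint : ∫ z, normSq ((Real.exp ((φ z + ε * s z - Real.log (1 + ε * s z)) / 2) : ℝ) *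
        ∑ j, dzCoord n (h j) j z) / (1 + ε * s z) ≤ Real.exp A * Real.exp (ε * S) * N := by
      rw [hN, ← integral_const_mul]
      refine integral_mono_of_nonneg (Eventually.of_forall fun z =>
        div_nonneg (normSq_nonneg _) (by linarith [hσ1 z])) (hdi.const_mul _)
        (Eventually.of_forall fun z => ?_)
      change normSq (_ * d z) / _ ≤ _ * normSq (d z)
      by_cases hz : z ∈ K
      · have h1 : 0 < 1 + ε * s z := by linarith [hσ1 z]
        rw [normSq_mul, normSq_ofReal, ← sq, hc2, mul_div_right_comm]
        refine mul_le_mul_of_nonneg_right ?_ (normSq_nonneg _)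
        rw [← Real.exp_add]
        calc _ ≤ Real.exp (φ z + ε * s z) := by
              refine (div_le_self (by positivity) (hσ1 z)).trans
                (div_le_self (by positivity) (hσ1 z))
          _ ≤ _ := by
              refine Real.exp_le_exp.2 (add_le_add (abs_le.1 (hbdφ z (hKΩ hz))).2 ?_)
              exact mul_le_mul_of_nonneg_left ((le_abs_self _).trans (hS z hz)) hε.le
      · simp [hdK z hz]
    refine main.trans ?_
    have := mul_le_mul_of_nonneg_left hint (by positivity : 0 ≤ Real.exp A * F * 2)
    calc _ = Real.exp A * F * 2 * ∫ z, normSq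
          ((Real.exp ((φ z + ε * s z - Real.log (1 + ε * s z)) / 2) : ℝ) *
          ∑ j, dzCoord n (h j) j z) / (1 + ε * s z) := by ring
      _ ≤ _ := this
      _ = _ := by ring
  rw [hset]
  have hlim : Tendsto (fun ε : ℝ => 2 * Real.exp A ^ 2 * F * (Real.exp (ε * S) * N)) (𝓝[>] 0)
      (𝓝 (2 * Real.exp A ^ 2 * F * N)) := by
    have hcont : Continuous fun ε : ℝ => 2 * Real.exp A ^ 2 * F * (Real.exp (ε * S) * N) := by
      fun_prop
    have := hcont.tendsto 0
    simp only [zero_mul, Real.exp_zero, one_mul] at this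
    exact this.mono_left nhdsWithin_le_nhds
  exact ge_of_tendsto hlim (eventually_mem_nhdsWithin.mono fun ε hε => key ε hε)

end KeyInequality

section Riesz

/-- Riesz representation of a functional dominated by the norm of a linear map. -/
lemma exists_inner_eq_of_norm_le {V H : Type*} [AddCommGroup V] [Module ℂ V]
    [NormedAddCommGroup H] [InnerProductSpace ℂ H] [CompleteSpace H] (T : V →ₗ[ℂ] H)
    (l : V →ₗ[ℂ] ℂ) {C : ℝ} (hC : 0 ≤ C) (h : ∀ x, ‖l x‖ ≤ C * ‖T x‖) :
    ∃ v : H, ‖v‖ ≤ C ∧ ∀ x, l x = inner ℂ v (T x) := by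
  obtain ⟨g, hg⟩ := T.rangeRestrict.exists_rightInverse_of_surjective T.range_rangeRestrict
  have hTg : ∀ y, T (g y) = y := fun y => congrArg Subtype.val (LinearMap.congr_fun hg y)
  have hl : ∀ x, l (g (T.rangeRestrict x)) = l x := by
    intro x
    have h1 := h (g (T.rangeRestrict x) - x)
    have h2 : (T.rangeRestrict x : H) = T x := rfl
    rw [map_sub, map_sub, hTg, h2, sub_self, norm_zero, mul_zero] at h1
    exact sub_eq_zero.1 (norm_le_zero_iff.1 h1)
  let f : StrongDual ℂ (LinearMap.range T) := (l.comp g).mkContinuous C fun y => by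
    have := h (g y)
    rwa [hTg] at this
  obtain ⟨F, hF, hFn⟩ := exists_extension_norm_eq (LinearMap.range T) f
  refine ⟨(InnerProductSpace.toDual ℂ H).symm F, ?_, fun x => ?_⟩
  · rw [LinearIsometryEquiv.norm_map, hFn]
    exact LinearMap.mkContinuous_norm_le _ hC _
  · rw [InnerProductSpace.toDual_symm_apply]
    have h1 : F (T x) = l (g (T.rangeRestrict x)) := hF (T.rangeRestrict x)
    rw [h1, hl]

end Riesz

section ClosedRange

open Filter Topology

variable {n : ℕ} {Ω : Set (Fin n → ℂ)}

lemma IsTest.memLp {w : (Fin n → ℂ) → ℂ} (hw : IsTest n Ω w) :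
    MemLp w 2 (volume.restrict Ω) :=
  (hw.1.continuous.memLp_of_hasCompactSupport hw.2.1).restrict Ω

lemma IsTest.differentiable {w : (Fin n → ℂ) → ℂ} (hw : IsTest n Ω w) : Differentiable ℝ w :=
  hw.1.differentiable (by simp)

lemma IsTest.memLp_dzCoord {w : (Fin n → ℂ) → ℂ} (hw : IsTest n Ω w) (j : Fin n) :
    MemLp (dzCoord n w j) 2 (volume.restrict Ω) :=
  ((ContDiff.dzCoord (m := (⊤ : ℕ∞)) (k := 1) hw.1
    (WithTop.coe_le_coe.2 (le_top : (2 : ℕ∞) ≤ ⊤)) j).continuous.memLp_of_hasCompactSupport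
      (hw.2.1.dzCoord j)).restrict Ω

lemma IsTest.conj {w : (Fin n → ℂ) → ℂ} (hw : IsTest n Ω w) :
    IsTest n Ω fun z => (starRingEnd ℂ) (w z) :=
  ⟨Complex.conjCLE.contDiff.comp hw.1, hw.2.1.comp_left (map_zero _),
    (closure_mono fun z hz => by
      simpa only [Function.mem_support, ne_eq, map_eq_zero] using hz).trans hw.2.2⟩

lemma isTest_zero : IsTest n Ω fun _ => 0 :=
  ⟨contDiff_const, HasCompactSupport.zero, by
    rw [show (fun _ : Fin n → ℂ => (0 : ℂ)) = 0 from rfl, tsupport_zero]; exact empty_subset _⟩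

/-- The space of `n`-tuples of test functions. -/
def testForms (n : ℕ) (Ω : Set (Fin n → ℂ)) : Submodule ℂ (Fin n → (Fin n → ℂ) → ℂ) where
  carrier := {h | ∀ j, IsTest n Ω (h j)}
  zero_mem' _ := isTest_zero
  add_mem' H H' j := ⟨(H j).1.add (H' j).1, (H j).2.1.add (H' j).2.1,
    (tsupport_add _ _).trans (union_subset (H j).2.2 (H' j).2.2)⟩
  smul_mem' a _ H j := ⟨(H j).1.const_smul a, (H j).2.1.smul_left (f := fun _ => a),
    (tsupport_smul_subset_right (fun _ => a) _).trans (H j).2.2⟩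

lemma testForms.isTest (h : testForms n Ω) (j : Fin n) : IsTest n Ω (h.1 j) :=
  (show ∀ j, IsTest n Ω (h.1 j) from h.2) j

lemma testForms.memLp_divergence (h : testForms n Ω) :
    MemLp (fun z => ∑ j, dzCoord n (h.1 j) j z) 2 (volume.restrict Ω) :=
  memLp_finsetSum _ fun j _ => (testForms.isTest h j).memLp_dzCoord j

/-- The divergence `∑ ∂h_j/∂z_j` of a test form, in `L²(Ω)`. -/
def divergence (n : ℕ) (Ω : Set (Fin n → ℂ)) :
    testForms n Ω →ₗ[ℂ] Lp ℂ 2 ((volume : Measure (Fin n → ℂ)).restrict Ω) where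
  toFun h := (testForms.memLp_divergence h).toLp _
  map_add' h h' := by
    rw [← MemLp.toLp_add]
    congr 1
    ext z
    simp only [Pi.add_apply, ← Finset.sum_add_distrib]
    refine Finset.sum_congr rfl fun j _ => ?_
    change dzCoord n (h.1 j + h'.1 j) j z = _
    simp only [dzCoord, fderiv_add ((testForms.isTest h j).differentiable z) ((testForms.isTest h' j).differentiable z),
      add_apply]
    ring
  map_smul' a h := by
    rw [RingHom.id_apply, ← MemLp.toLp_const_smul]
    congr 1
    ext z
    simp only [Pi.smul_apply, Finset.smul_sum]
    refine Finset.sum_congr rfl fun j _ => ?_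
    change dzCoord n (a • h.1 j) j z = _
    simp only [dzCoord, fderiv_const_smul ((testForms.isTest h j).differentiable z) a, smul_apply, smul_eq_mul]
    ring

/-- The pairing of an `L²` form with test forms. -/
def formPairing (α : Fin n → Lp ℂ 2 ((volume : Measure (Fin n → ℂ)).restrict Ω)) :
    testForms n Ω →ₗ[ℂ] ℂ where
  toFun h := ∑ j, inner ℂ (α j) ((testForms.isTest h j).memLp.toLp _)
  map_add' h h' := by
    rw [← Finset.sum_add_distrib]
    refine Finset.sum_congr rfl fun j _ => ?_
    rw [← inner_add_right, ← MemLp.toLp_add]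
    rfl
  map_smul' a h := by
    rw [RingHom.id_apply, smul_eq_mul, Finset.mul_sum]
    refine Finset.sum_congr rfl fun j _ => ?_
    rw [← inner_smul_right, ← MemLp.toLp_const_smul]
    rfl

lemma formPairing_apply (α : Fin n → Lp ℂ 2 ((volume : Measure (Fin n → ℂ)).restrict Ω))
    (h : testForms n Ω) :
    formPairing α h = ∑ j, ∫ z in Ω, (starRingEnd ℂ) (α j z) * h.1 j z := by
  change ∑ j, inner ℂ (α j) ((testForms.isTest h j).memLp.toLp _) = _
  refine Finset.sum_congr rfl fun j _ => ?_
  have := inner_toLp_toLp (Lp.memLp (α j)) (testForms.isTest h j).memLp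
  rwa [Lp.toLp_coeFn] at this

lemma exists_dbarEq_of_pairing_le
    {α : Fin n → Lp ℂ 2 ((volume : Measure (Fin n → ℂ)).restrict Ω)} {C : ℝ} (hC : 0 ≤ C)
    (h : ∀ x, ‖formPairing α x‖ ≤ C * ‖divergence n Ω x‖) :
    ∃ v : Lp ℂ 2 ((volume : Measure (Fin n → ℂ)).restrict Ω), ‖v‖ ≤ C ∧
      DbarEq n Ω (⇑v) (fun j => ⇑(α j)) := by
  obtain ⟨v, hv, hvl⟩ := exists_inner_eq_of_norm_le (divergence n Ω) (formPairing α) hC h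
  refine ⟨-v, by rwa [norm_neg], fun j w hw => ?_⟩
  let x : testForms n Ω := ⟨fun k z => if k = j then (starRingEnd ℂ) (w z) else 0, fun k => by
    by_cases hk : k = j
    · simp only [hk, if_true]; exact hw.conj
    · simp only [hk, if_false]; exact isTest_zero⟩
  have e1 : formPairing α x = (starRingEnd ℂ) (∫ z in Ω, α j z * w z) := by
    rw [formPairing_apply, Finset.sum_eq_single j, ← integral_conj]
    · exact integral_congr_ae (Eventually.of_forall fun z => by simp [x])
    · intro k _ hk; simp [x, hk]
    · simp
  have e2 : inner ℂ v (divergence n Ω x) = (starRingEnd ℂ) (∫ z in Ω, v z * dbarCoord n w j z) := by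
    have h1 := inner_toLp_toLp (Lp.memLp v) (testForms.memLp_divergence x)
    rw [Lp.toLp_coeFn] at h1
    change inner ℂ v ((testForms.memLp_divergence x).toLp _) = _
    rw [h1, ← integral_conj]
    refine integral_congr_ae (Eventually.of_forall fun z => ?_)
    have e3 : ∑ k, dzCoord n (x.1 k) k z = (starRingEnd ℂ) (dbarCoord n w j z) := by
      rw [Finset.sum_eq_single j]
      · simp only [x, if_true, dzCoord_conj]
      · intro k _ hk; simp [x, hk, dzCoord]
      · simp
    simp only [e3, map_mul]
  have e4 := hvl x
  rw [e1, e2] at e4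
  have e5 := (starRingEnd ℂ).injective e4
  rw [e5, ← integral_neg]
  refine integral_congr_ae ?_
  filter_upwards [Lp.coeFn_neg v] with z hz
  rw [hz]; simp

lemma le_of_mul_sq_le {A B S p d : ℝ} (hB : 0 < B) (hS : 0 ≤ S) (hd : 0 ≤ d)
    (h : B * p ^ 2 ≤ 2 * Real.exp A ^ 2 * S * d ^ 2) :
    p ≤ Real.exp A * Real.sqrt (2 / B) * Real.sqrt S * d := by
  refine le_of_sq_le_sq ?_ (by positivity)
  rw [mul_pow, mul_pow, mul_pow, Real.sq_sqrt (by positivity), Real.sq_sqrt hS]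
  have e : Real.exp A ^ 2 * (2 / B) * S * d ^ 2 = (2 * Real.exp A ^ 2 * S * d ^ 2) / B := by ring
  rw [e, le_div_iff₀ hB]
  linarith

lemma norm_formPairing_le {r φ : (Fin n → ℂ) → ℝ} (hr : IsLeviDefiningFn n Ω r)
    (hbd : Bornology.IsBounded Ω) (hφ : ContDiffOn ℝ 2 φ Ω) {A B : ℝ} (hB : 0 < B)
    (hbdφ : ∀ z ∈ Ω, |φ z| ≤ A)
    (hhess : ∀ z ∈ Ω, ∀ ξ : Fin n → ℂ, B * enormSq n ξ ≤ hessC n φ z ξ)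
    {u : Lp ℂ 2 ((volume : Measure (Fin n → ℂ)).restrict Ω)}
    {α : Fin n → Lp ℂ 2 ((volume : Measure (Fin n → ℂ)).restrict Ω)}
    (h : DbarEq n Ω (⇑u) (fun j => ⇑(α j))) (x : testForms n Ω) :
    ‖formPairing α x‖ ≤
      Real.exp A * Real.sqrt (2 / B) * Real.sqrt (∑ j, ‖α j‖ ^ 2) * ‖divergence n Ω x‖ := by
  have key := pairing_le_of_bounded_weight hr hbd hφ hB.le hbdφ hhess (Lp.memLp u)
    (fun j => Lp.memLp (α j)) h (testForms.isTest x)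
  have e1 : ∀ j, ∫ z in Ω, normSq (α j z) = ‖α j‖ ^ 2 := fun j => by
    have := norm_toLp_sq (Lp.memLp (α j))
    rw [Lp.toLp_coeFn] at this
    exact this.symm
  have e2 : ∫ z in Ω, normSq (∑ j, dzCoord n (x.1 j) j z) = ‖divergence n Ω x‖ ^ 2 :=
    (norm_toLp_sq (testForms.memLp_divergence x)).symm
  rw [← formPairing_apply] at key
  simp only [e1, e2] at key
  have hS : 0 ≤ ∑ j, ‖α j‖ ^ 2 := Finset.sum_nonneg fun j _ => sq_nonneg _
  exact le_of_mul_sq_le hB hS (norm_nonneg _) key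

lemma DbarEq.sub_self {u v : Lp ℂ 2 ((volume : Measure (Fin n → ℂ)).restrict Ω)}
    {α : Fin n → (Fin n → ℂ) → ℂ} (hu : DbarEq n Ω (⇑u) α) (hv : DbarEq n Ω (⇑v) α) :
    DbarEq n Ω (⇑(u - v)) (fun _ _ => 0) := by
  intro j w hw
  have hd : MemLp (dbarCoord n w j) 2 (volume.restrict Ω) :=
    ((ContDiff.dbarCoord (m := (⊤ : ℕ∞)) (k := 1) hw.1
      (WithTop.coe_le_coe.2 (le_top : (2 : ℕ∞) ≤ ⊤)) j).continuous.memLp_of_hasCompactSupport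
        (hw.2.1.dbarCoord j)).restrict Ω
  have i1 : Integrable (fun z => u z * dbarCoord n w j z) (volume.restrict Ω) :=
    (Lp.memLp u).integrable_mul hd
  have i2 : Integrable (fun z => v z * dbarCoord n w j z) (volume.restrict Ω) :=
    (Lp.memLp v).integrable_mul hd
  have e : ∫ z in Ω, (u - v) z * dbarCoord n w j z =
      ∫ z in Ω, (u z * dbarCoord n w j z - v z * dbarCoord n w j z) := by
    refine integral_congr_ae ?_
    filter_upwards [Lp.coeFn_sub u v] with z hz
    rw [hz, Pi.sub_apply, sub_mul]
  change _ = -∫ z in Ω, (u - v) z * dbarCoord n w j z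
  have h1 := hu j w hw
  have h2 := hv j w hw
  rw [e, integral_sub i1 i2]
  simp only [zero_mul, integral_zero]
  linear_combination h1 - h2

lemma isClosed_setOf_pairing_le (C : ℝ) :
    IsClosed {α : Fin n → Lp ℂ 2 ((volume : Measure (Fin n → ℂ)).restrict Ω) |
      ∀ x, ‖formPairing α x‖ ≤ C * Real.sqrt (∑ j, ‖α j‖ ^ 2) * ‖divergence n Ω x‖} := by
  rw [ofPred_forall]
  refine isClosed_iInter fun x => isClosed_le ?_ ?_
  · have : Continuous fun α : Fin n → Lp ℂ 2 ((volume : Measure (Fin n → ℂ)).restrict Ω) =>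
        ∑ j, inner ℂ (α j) ((testForms.isTest x j).memLp.toLp _) :=
      continuous_finsetSum _ fun j _ => (continuous_apply j).inner continuous_const
    exact this.norm
  · fun_prop

end ClosedRange

/-- **Bounded strictly plurisubharmonic weight (q = 0), bounded smooth case.**
If `Ω ⊆ ℂⁿ` is a bounded Levi-pseudoconvex open set with smooth boundary admitting a
real-valued `φ`, `C²` on a neighborhood of `closure Ω`, and constants `A, B > 0` with
`|φ| ≤ A` on `Ω` and `Hφ(z;ξ) ≥ B|ξ|²` on `Ω`, then `‖u‖ ≤ e^A√(2/B)‖∂̄u‖` for every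
`u ∈ D(∂̄)` orthogonal to `N(∂̄)`; in particular `R(∂̄)` is closed in `(L²(Ω))ⁿ`. -/
theorem closed_range_of_bounded_weight_bounded_domain
    {n : ℕ} (Ω : Set (Fin n → ℂ)) (hbd : Bornology.IsBounded Ω)
    (r : (Fin n → ℂ) → ℝ) (hr : IsLeviDefiningFn n Ω r)
    (φ : (Fin n → ℂ) → ℝ) (U : Set (Fin n → ℂ))
    (hU : IsOpen U) (hclU : closure Ω ⊆ U) (hφ : ContDiffOn ℝ 2 φ U)
    (A B : ℝ) (hA : 0 < A) (hB : 0 < B)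
    (hbdφ : ∀ z ∈ Ω, |φ z| ≤ A)
    (hhess : ∀ z ∈ Ω, ∀ ξ : Fin n → ℂ, B * enormSq n ξ ≤ hessC n φ z ξ) :
    (∀ u : Lp ℂ 2 ((volume : Measure (Fin n → ℂ)).restrict Ω),
      ∀ β : Fin n → Lp ℂ 2 ((volume : Measure (Fin n → ℂ)).restrict Ω),
      DbarEq n Ω (⇑u) (fun j => ⇑(β j)) →
      (∀ h : Lp ℂ 2 ((volume : Measure (Fin n → ℂ)).restrict Ω),
        DbarEq n Ω (⇑h) (fun _ _ => 0) → @inner ℂ _ _ u h = 0) →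
      ‖u‖ ≤ Real.exp A * Real.sqrt (2 / B) * Real.sqrt (∑ j, ‖β j‖ ^ 2)) ∧
    IsClosed {α : Fin n → Lp ℂ 2 ((volume : Measure (Fin n → ℂ)).restrict Ω) |
      ∃ u : Lp ℂ 2 ((volume : Measure (Fin n → ℂ)).restrict Ω),
        DbarEq n Ω (⇑u) (fun j => ⇑(α j))} := by
  have hφΩ : ContDiffOn ℝ 2 φ Ω := hφ.mono (subset_closure.trans hclU)
  have hC : ∀ S, 0 ≤ Real.exp A * Real.sqrt (2 / B) * Real.sqrt S := fun S => by positivity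
  constructor
  · intro u β huβ horth
    obtain ⟨v, hv, hvβ⟩ := exists_dbarEq_of_pairing_le (hC _)
      (norm_formPairing_le hr hbd hφΩ hB hbdφ hhess huβ)
    have h1 := horth (u - v) (huβ.sub_self hvβ)
    rw [inner_sub_right, sub_eq_zero, inner_self_eq_norm_sq_to_K] at h1
    have h2 := norm_inner_le_norm (𝕜 := ℂ) u v
    rw [← h1] at h2
    have h3 : ‖u‖ * ‖u‖ ≤ ‖u‖ * ‖v‖ := by
      simpa [sq] using h2
    rcases (norm_nonneg u).eq_or_lt with h0 | h0
    · rw [← h0]; exact hC _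
    · exact (le_of_mul_le_mul_left h3 h0).trans hv
  · refine (congrArg IsClosed (Set.ext fun α => ?_)).mpr
      (isClosed_setOf_pairing_le (n := n) (Ω := Ω) (Real.exp A * Real.sqrt (2 / B)))
    rw [mem_ofPred_eq, mem_ofPred_eq]
    constructor
    · rintro ⟨u, hu⟩
      exact norm_formPairing_le hr hbd hφΩ hB hbdφ hhess hu
    · intro h
      obtain ⟨v, -, hv⟩ := exists_dbarEq_of_pairing_le (hC _) h
      exact ⟨v, hv⟩
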